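/- Thin parabolic boundary Harnack principle in slit domains (Theorem 1.4): There exists a constant C>0 depending only on n, λ and Λ such that the following holds. Let S be a closed subset of {x_n=0}⊂ℝⁿ×ℝ. Let u and v be positive solutions of u_t = Lu and v_t = Lv in 𝒞₁∖S, both even in the x_n variable (u(x',−x_n,t)=u(x',x_n,t) and similarly for v), and suppose the extension of u by 0 on S is continuous on 𝒞₁. Then for every (x,t) ∈ 𝒞_{1/2}∖S one has u(x,t)/v(x,t) ≤ C · u(Ē)/v(E̲). -/

import Mathlib

noncomputable section
open scoped BigOperators
open Classical

abbrev Spc (m : ℕ) := EuclideanSpace ℝ (Fin (m + 1))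

/-- The last (vertical) coordinate `x_n` of a point `x ∈ ℝⁿ`. -/
def xlast {m : ℕ} (x : Spc m) : ℝ := x (Fin.last m)

/-- The `i`-th standard basis vector. -/
def eVec (m : ℕ) (i : Fin (m + 1)) : Spc m := EuclideanSpace.single i 1

/-- Reflection of a point of `ℝⁿ` in the hyperplane `{x_n = 0}`. -/
def reflectLast {m : ℕ} (x : Spc m) : Spc m :=
  (WithLp.equiv 2 _).symm fun i => if i = Fin.last m then -x i else x i

/-- The entry `∂²u/∂xᵢ∂xⱼ` of the spatial Hessian of `u(x,t)` at `p = (x,t)`. -/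
def sHess {m : ℕ} (u : Spc m × ℝ → ℝ) (p : Spc m × ℝ) (i j : Fin (m + 1)) : ℝ :=
  fderiv ℝ (fun y => fderiv ℝ (fun z => u (z, p.2)) y (eVec m j)) p.1 (eVec m i)

/-- The operator `Lu = tr(A(x) D²ₓu)` at the point `p = (x,t)`. -/
def Lop {m : ℕ} (A : Spc m → Matrix (Fin (m + 1)) (Fin (m + 1)) ℝ)
    (u : Spc m × ℝ → ℝ) (p : Spc m × ℝ) : ℝ :=
  ∑ i, ∑ j, A p.1 i j * sHess u p j i

/-- Uniform ellipticity with symmetric coefficients: `λ|ξ|² ≤ ξ·A(x)ξ ≤ Λ|ξ|²`. -/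
def IsElliptic {m : ℕ} (lam Lam : ℝ)
    (A : Spc m → Matrix (Fin (m + 1)) (Fin (m + 1)) ℝ) : Prop :=
  (∀ x, (A x).IsSymm) ∧
  ∀ (x ξ : Spc m),
    lam * ‖ξ‖ ^ 2 ≤ ∑ i, ∑ j, ξ i * A x i j * ξ j ∧
      ∑ i, ∑ j, ξ i * A x i j * ξ j ≤ Lam * ‖ξ‖ ^ 2

/-- `u` is (pointwise) a solution of `u_t = Lu` on `Ω`: twice continuously
differentiable in `x`, differentiable in `t`, with `∂ₜu = tr(A(x)D²ₓu)`. -/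
def SolvesL {m : ℕ} (A : Spc m → Matrix (Fin (m + 1)) (Fin (m + 1)) ℝ)
    (u : Spc m × ℝ → ℝ) (Ω : Set (Spc m × ℝ)) : Prop :=
  ∀ p ∈ Ω, ContDiffAt ℝ 2 (fun y => u (y, p.2)) p.1 ∧
    HasDerivAt (fun s => u (p.1, s)) (Lop A u p) p.2

/-- The cylinder `𝒞_r = B_r × (−r², r²)` in the slit-domain setting. -/
def CylS (m : ℕ) (r : ℝ) : Set (Spc m × ℝ) :=
  {p | ‖p.1‖ < r ∧ -r ^ 2 < p.2 ∧ p.2 < r ^ 2}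

/-- The point `Ē = (eₙ/2, 1/2)`. -/
def EbarS (m : ℕ) : Spc m × ℝ := (EuclideanSpace.single (Fin.last m) ((1 : ℝ) / 2), 1 / 2)

/-- The point `E̲ = (eₙ/2, −1/2)`. -/
def EundS (m : ℕ) : Spc m × ℝ := (EuclideanSpace.single (Fin.last m) ((1 : ℝ) / 2), -(1 / 2))

set_option linter.unusedSectionVars false

namespace KrylovSafonov

open Set Filter Topology MeasureTheory

variable {E : Type*} [NormedAddCommGroup E] [InnerProductSpace ℝ E] [FiniteDimensional ℝ E]

/-- Second spatial derivative of `u` at `p` in the direction `e`. -/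
def hess (u : E × ℝ → ℝ) (p : E × ℝ) (e : E) : ℝ :=
  fderiv ℝ (fderiv ℝ (fun y => u (y, p.2))) p.1 e e

/-- `u` solves, at the point `p`, a nondivergence parabolic equation whose coefficient matrix has
all its eigenvalues in `[l, L]`. -/
def SolAt (l L : ℝ) (u : E × ℝ → ℝ) (p : E × ℝ) : Prop :=
  ContDiffAt ℝ 2 (fun y => u (y, p.2)) p.1 ∧
    ∃ (b : OrthonormalBasis (Fin (Module.finrank ℝ E)) ℝ E) (μ : Fin (Module.finrank ℝ E) → ℝ),
      (∀ k, l ≤ μ k ∧ μ k ≤ L) ∧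
        HasDerivAt (fun s => u (p.1, s)) (∑ k, μ k * hess u p (b k)) p.2

theorem eventually_neg_of_hasDerivAt_neg {k : ℝ → ℝ} {c : ℝ} (hk : HasDerivAt k c 0)
    (h0 : k 0 = 0) (hc : c < 0) : ∀ᶠ r in 𝓝[>] (0 : ℝ), k r < 0 := by
  have h := (hasDerivAt_iff_tendsto_slope.1 hk).eventually (gt_mem_nhds hc)
  have h2 : ∀ᶠ r in 𝓝[>] (0 : ℝ), slope k 0 r < 0 :=
    h.filter_mono (nhdsWithin_mono _ fun x hx => ne_of_gt hx)
  filter_upwards [h2, self_mem_nhdsWithin] with r hr hr0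
  rw [slope_def_field, h0, sub_zero, sub_zero] at hr
  have hr0' : (0 : ℝ) < r := hr0
  by_contra hcon
  exact absurd hr (not_lt.2 (div_nonneg (not_lt.1 hcon) hr0'.le))


theorem le_fderiv_fderiv_of_secondDiff {f : E → ℝ} {x e : E} {q : ℝ} (hf : ContDiffAt ℝ 2 f x)
    (h : ∀ᶠ r in 𝓝[>] (0 : ℝ), q * r ^ 2 ≤ f (x + r • e) + f (x - r • e) - 2 * f x) :
    q ≤ fderiv ℝ (fderiv ℝ f) x e e := by
  by_contra hlt
  push Not at hlt
  have hdiff : ∀ᶠ y in 𝓝 x, DifferentiableAt ℝ f y := by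
    filter_upwards [hf.eventually (by simp)] with y hy
    exact hy.differentiableAt (by simp)
  have hf1 : DifferentiableAt ℝ (fderiv ℝ f) x :=
    (hf.fderiv_right (m := 1) (by norm_num)).differentiableAt (by simp)
  set H := fderiv ℝ (fderiv ℝ f) x with hH
  have hcp : ∀ r : ℝ, HasDerivAt (fun r : ℝ => x + r • e) e r := fun r => by
    simpa using ((hasDerivAt_id r).smul_const e).const_add x
  have hcm : ∀ r : ℝ, HasDerivAt (fun r : ℝ => x - r • e) (-e) r := fun r => by
    simpa using ((hasDerivAt_id r).smul_const e).const_sub x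
  set k : ℝ → ℝ := fun r => fderiv ℝ f (x + r • e) e - fderiv ℝ f (x - r • e) e - 2 * q * r with hk
  have hk0 : k 0 = 0 := by simp [hk]
  have hkd : HasDerivAt k (2 * (H e e - q)) 0 := by
    have e1 : HasDerivAt (fun r : ℝ => fderiv ℝ f (x + r • e)) (H e) 0 := by
      have h1 : HasFDerivAt (fderiv ℝ f) H (x + (0 : ℝ) • e) := by simpa using hf1.hasFDerivAt
      exact h1.comp_hasDerivAt (0 : ℝ) (hcp 0)
    have e2 : HasDerivAt (fun r : ℝ => fderiv ℝ f (x - r • e)) (H (-e)) 0 := by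
      have h1 : HasFDerivAt (fderiv ℝ f) H (x - (0 : ℝ) • e) := by simpa using hf1.hasFDerivAt
      exact h1.comp_hasDerivAt (0 : ℝ) (hcm 0)
    have e3 := e1.clm_apply (hasDerivAt_const (0 : ℝ) e)
    have e4 := e2.clm_apply (hasDerivAt_const (0 : ℝ) e)
    have e5 := (e3.sub e4).sub ((hasDerivAt_id (0 : ℝ)).const_mul (2 * q))
    refine e5.congr_deriv ?_
    simp; ring
  have hneg := eventually_neg_of_hasDerivAt_neg hkd hk0 (by linarith)
  have hcont : ∀ {g : ℝ → E}, Continuous g → g 0 = x → ∀ᶠ r in 𝓝[>] (0 : ℝ),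
      DifferentiableAt ℝ f (g r) := by
    intro g hg h0
    have : Tendsto g (𝓝 0) (𝓝 x) := by simpa [h0] using hg.tendsto 0
    exact (this.eventually hdiff).filter_mono nhdsWithin_le_nhds
  have hp := hcont (g := fun r => x + r • e) (by fun_prop) (by simp)
  have hm := hcont (g := fun r => x - r • e) (by fun_prop) (by simp)
  obtain ⟨δ, hδ, hall⟩ := mem_nhdsGT_iff_exists_Ioo_subset.1 (((hneg.and hp).and hm).and h)
  have hδ0 : (0 : ℝ) < δ := hδ
  set g : ℝ → ℝ := fun r => f (x + r • e) + f (x - r • e) - 2 * f x - q * r ^ 2 with hg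
  have hgd : ∀ r : ℝ, DifferentiableAt ℝ f (x + r • e) → DifferentiableAt ℝ f (x - r • e) →
      HasDerivAt g (k r) r := by
    intro r h1 h2
    have e1 := h1.hasFDerivAt.comp_hasDerivAt r (hcp r)
    have e2 := h2.hasFDerivAt.comp_hasDerivAt r (hcm r)
    have e3 := ((e1.add e2).sub_const (2 * f x)).sub ((hasDerivAt_pow 2 r).const_mul q)
    refine e3.congr_deriv ?_
    simp [hk]; ring
  have hx : DifferentiableAt ℝ f x := hf.differentiableAt (by simp)
  have hanti : StrictAntiOn g (Icc 0 (δ / 2)) := by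
    refine strictAntiOn_of_deriv_neg (convex_Icc _ _) ?_ ?_
    · intro r hr
      rcases hr.1.eq_or_lt with h0 | h0
      · subst h0
        exact (hgd 0 (by simpa using hx) (by simpa using hx)).continuousAt.continuousWithinAt
      · have := hall (show r ∈ Ioo 0 δ from ⟨h0, by linarith [hr.2]⟩)
        exact (hgd r this.1.1.2 this.1.2).continuousAt.continuousWithinAt
    · intro r hr
      rw [interior_Icc] at hr
      have := hall (show r ∈ Ioo 0 δ from ⟨hr.1, by linarith [hr.2]⟩)
      rw [(hgd r this.1.1.2 this.1.2).deriv]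
      exact this.1.1.1
  have hlt2 := hanti (left_mem_Icc.2 (by linarith)) (right_mem_Icc.2 (by linarith))
    (show (0 : ℝ) < δ / 2 by linarith)
  have hge := (hall (show δ / 2 ∈ Ioo 0 δ from ⟨by linarith, by linarith⟩)).2
  simp only [hg] at hlt2
  simp at hlt2
  linarith [show q * (δ / 2) ^ 2 ≤ _ from hge]

theorem deriv_nonpos_of_left_min {f : ℝ → ℝ} {t c : ℝ} (hf : HasDerivAt f c t)
    (h : ∀ᶠ s in 𝓝[<] t, f t ≤ f s) : c ≤ 0 := by
  have h1 := (hasDerivAt_iff_tendsto_slope.1 hf).mono_left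
    (nhdsWithin_mono t (fun x (hx : x ∈ Iio t) => ne_of_lt hx))
  refine le_of_tendsto h1 ?_
  filter_upwards [h, self_mem_nhdsWithin] with s hs hst
  rw [slope_def_field]
  exact div_nonpos_of_nonneg_of_nonpos (by linarith) (by linarith [show s < t from hst])

theorem sum_sq_inner_basis (b : OrthonormalBasis (Fin (Module.finrank ℝ E)) ℝ E) (w : E) :
    ∑ k, inner ℝ w (b k) ^ 2 = ‖w‖ ^ 2 := by
  have := b.sum_sq_norm_inner_left w
  simpa using this

/-- Touching from below by a test function whose second differences are controlled by the quadratic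
form `α ‖e‖² + β ⟪w, e⟫²`. -/
theorem SolAt.touch {l L : ℝ} (hl : 0 ≤ l) {u : E × ℝ → ℝ} {x : E} {t : ℝ}
    (hu : SolAt l L u (x, t))
    {φ : E → ℝ → ℝ} {τ α β : ℝ} {w : E}
    (h1 : ∀ᶠ s in 𝓝[<] t, u (x, t) - φ x t ≤ u (x, s) - φ x s)
    (h2 : ∀ᶠ y in 𝓝 x, u (x, t) - φ x t ≤ u (y, t) - φ y t)
    (h3 : HasDerivAt (φ x) τ t)
    (h4 : ∀ e : E, ‖e‖ = 1 → ∀ᶠ h in 𝓝[>] (0 : ℝ),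
      (α + β * inner ℝ w e ^ 2) * h ^ 2 ≤ φ (x + h • e) t + φ (x - h • e) t - 2 * φ x t) :
    ∃ s m : ℝ, l * Module.finrank ℝ E ≤ s ∧ s ≤ L * Module.finrank ℝ E ∧
      l * ‖w‖ ^ 2 ≤ m ∧ m ≤ L * ‖w‖ ^ 2 ∧ α * s + β * m ≤ τ := by
  obtain ⟨hC, b, μ, hμ, hd⟩ := hu
  have hcd : Tendsto (fun h : ℝ => h) (𝓝[>] 0) (𝓝 0) := nhdsWithin_le_nhds
  refine ⟨∑ k, μ k, ∑ k, μ k * inner ℝ w (b k) ^ 2, ?_, ?_, ?_, ?_, ?_⟩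
  · have : ∑ k : Fin (Module.finrank ℝ E), l ≤ ∑ k, μ k :=
      Finset.sum_le_sum fun k _ => (hμ k).1
    simpa [mul_comm] using this
  · have : ∑ k, μ k ≤ ∑ k : Fin (Module.finrank ℝ E), L :=
      Finset.sum_le_sum fun k _ => (hμ k).2
    simpa [mul_comm] using this
  · rw [← sum_sq_inner_basis b w, Finset.mul_sum]
    exact Finset.sum_le_sum fun k _ => mul_le_mul_of_nonneg_right (hμ k).1 (sq_nonneg _)
  · rw [← sum_sq_inner_basis b w, Finset.mul_sum]
    exact Finset.sum_le_sum fun k _ => mul_le_mul_of_nonneg_right (hμ k).2 (sq_nonneg _)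
  · have hle := deriv_nonpos_of_left_min (hd.sub h3) (by simpa using h1)
    have hq : ∀ k, α + β * inner ℝ w (b k) ^ 2 ≤ hess u (x, t) (b k) := by
      intro k
      refine le_fderiv_fderiv_of_secondDiff hC ?_
      have hp : ∀ᶠ h in 𝓝[>] (0 : ℝ), u (x, t) - φ x t ≤ u (x + h • b k, t) - φ (x + h • b k) t := by
        have : Tendsto (fun h : ℝ => x + h • b k) (𝓝[>] 0) (𝓝 x) := by
          have : Continuous fun h : ℝ => x + h • b k := by fun_prop
          simpa using (this.tendsto 0).mono_left nhdsWithin_le_nhds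
        exact this.eventually h2
      have hm : ∀ᶠ h in 𝓝[>] (0 : ℝ), u (x, t) - φ x t ≤ u (x - h • b k, t) - φ (x - h • b k) t := by
        have : Tendsto (fun h : ℝ => x - h • b k) (𝓝[>] 0) (𝓝 x) := by
          have : Continuous fun h : ℝ => x - h • b k := by fun_prop
          simpa using (this.tendsto 0).mono_left nhdsWithin_le_nhds
        exact this.eventually h2
      filter_upwards [hp, hm, h4 (b k) (b.orthonormal.1 k)] with h e1 e2 e3
      linarith
    have : ∑ k, μ k * (α + β * inner ℝ w (b k) ^ 2) ≤ ∑ k, μ k * hess u (x, t) (b k) :=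
      Finset.sum_le_sum fun k _ => mul_le_mul_of_nonneg_left (hq k) (hl.trans (hμ k).1)
    have e : ∑ k, μ k * (α + β * inner ℝ w (b k) ^ 2)
        = α * ∑ k, μ k + β * ∑ k, μ k * inner ℝ w (b k) ^ 2 := by
      rw [Finset.mul_sum, Finset.mul_sum, ← Finset.sum_add_distrib]
      exact Finset.sum_congr rfl fun k _ => by ring
    linarith

theorem SolAt.congr {l L : ℝ} {u v : E × ℝ → ℝ} {p : E × ℝ} (hu : SolAt l L u p)
    (h : v =ᶠ[𝓝 p] u) : SolAt l L v p := by
  obtain ⟨hC, b, μ, hμ, hd⟩ := hu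
  have hx : (fun y => v (y, p.2)) =ᶠ[𝓝 p.1] fun y => u (y, p.2) := by
    have : Tendsto (fun y : E => (y, p.2)) (𝓝 p.1) (𝓝 p) :=
      (Continuous.prodMk_left p.2).tendsto p.1
    exact this.eventually h
  have ht : (fun s => v (p.1, s)) =ᶠ[𝓝 p.2] fun s => u (p.1, s) := by
    have : Tendsto (fun s : ℝ => (p.1, s)) (𝓝 p.2) (𝓝 p) :=
      (Continuous.prodMk_right p.1).tendsto p.2
    exact this.eventually h
  refine ⟨hC.congr_of_eventuallyEq hx, b, μ, hμ, ?_⟩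
  have he : ∀ e, hess v p e = hess u p e := fun e => by
    unfold hess
    rw [hx.fderiv.fderiv_eq]
  simp only [he]
  exact hd.congr_of_eventuallyEq ht

theorem SolAt.affine {l L : ℝ} {u : E × ℝ → ℝ} {p : E × ℝ} (hu : SolAt l L u p) (c k : ℝ) :
    SolAt l L (fun q => c * u q + k) p := by
  obtain ⟨hC, b, μ, hμ, hd⟩ := hu
  refine ⟨(contDiffAt_const.mul hC).add contDiffAt_const, b, μ, hμ, ?_⟩
  have h1 : (fderiv ℝ fun y => c * u (y, p.2) + k) = fun y => c • fderiv ℝ (fun y => u (y, p.2)) y := by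
    funext y
    rw [fderiv_add_const]
    exact congrFun (fderiv_const_smul_field (𝕜 := ℝ) (f := fun y => u (y, p.2)) c) y
  have he : ∀ e, hess (fun q => c * u q + k) p e = c * hess u p e := fun e => by
    unfold hess
    rw [h1]
    have h2 : fderiv ℝ (fun y => c • fderiv ℝ (fun y => u (y, p.2)) y) p.1
        = c • fderiv ℝ (fderiv ℝ (fun y => u (y, p.2))) p.1 :=
      congrFun (fderiv_const_smul_field (𝕜 := ℝ) (f := fderiv ℝ (fun y => u (y, p.2))) c) p.1
    rw [h2]
    rfl
  refine ((hd.const_mul c).add_const k).congr_deriv ?_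
  rw [Finset.mul_sum]
  exact Finset.sum_congr rfl fun i _ => by rw [he]; ring

theorem SolAt.rescale {l L : ℝ} {u : E × ℝ → ℝ} {x0 : E} {t0 r : ℝ} {p : E × ℝ}
    (hu : SolAt l L u (x0 + r • p.1, t0 + r ^ 2 * p.2)) :
    SolAt l L (fun q => u (x0 + r • q.1, t0 + r ^ 2 * q.2)) p := by
  obtain ⟨hC, b, μ, hμ, hd⟩ := hu
  simp only at hC
  have hg : ∀ y : E, HasFDerivAt (fun y : E => x0 + r • y) (r • ContinuousLinearMap.id ℝ E) y :=
    fun y => ((hasFDerivAt_id y).const_smul r).const_add x0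
  refine ⟨?_, b, μ, hμ, ?_⟩
  · exact hC.comp p.1 (f := fun y : E => x0 + r • y) (by fun_prop)
  · set f := fun y => u (y, t0 + r ^ 2 * p.2) with hf
    have hev : (fderiv ℝ fun y => f (x0 + r • y)) =ᶠ[𝓝 p.1] fun y => r • fderiv ℝ f (x0 + r • y) := by
      have hdiff : ∀ᶠ y in 𝓝 (x0 + r • p.1), DifferentiableAt ℝ f y := by
        filter_upwards [hC.eventually (by simp)] with y hy
        exact hy.differentiableAt (by simp)
      have hT : Tendsto (fun y : E => x0 + r • y) (𝓝 p.1) (𝓝 (x0 + r • p.1)) := by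
        have : Continuous fun y : E => x0 + r • y := by fun_prop
        exact this.tendsto _
      filter_upwards [hT.eventually hdiff] with y hy
      have h1 := hy.hasFDerivAt.comp y (hg y)
      change fderiv ℝ (f ∘ fun y => x0 + r • y) y = _
      rw [h1.fderiv]
      ext e; simp
    have hf1 : DifferentiableAt ℝ (fderiv ℝ f) (x0 + r • p.1) :=
      (hC.fderiv_right (m := 1) (by norm_num)).differentiableAt (by simp)
    have he : ∀ e, hess (fun q => u (x0 + r • q.1, t0 + r ^ 2 * q.2)) p e
        = r ^ 2 * hess u (x0 + r • p.1, t0 + r ^ 2 * p.2) e := fun e => by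
      unfold hess
      dsimp only
      change fderiv ℝ (fderiv ℝ fun y => f (x0 + r • y)) p.1 e e = _
      have h1 : HasFDerivAt (fun y => r • fderiv ℝ f (x0 + r • y)) _ p.1 :=
        (hf1.hasFDerivAt.comp p.1 (hg p.1)).const_smul r
      rw [hev.fderiv_eq, h1.fderiv]
      simp [hf]; ring
    have ht : HasDerivAt (fun s : ℝ => t0 + r ^ 2 * s) (r ^ 2) p.2 := by
      simpa using ((hasDerivAt_id p.2).const_mul (r ^ 2)).const_add t0
    refine (hd.comp p.2 ht).congr_deriv ?_
    rw [Finset.sum_mul]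
    exact Finset.sum_congr rfl fun i _ => by rw [he]; ring

/-- Nonnegative continuous functions that are pointwise solutions on `s`. -/
def PosSol (l L : ℝ) (u : E × ℝ → ℝ) (s : Set (E × ℝ)) : Prop :=
  ContinuousOn u s ∧ (∀ p ∈ s, 0 ≤ u p) ∧ ∀ p ∈ s, SolAt l L u p

theorem PosSol.mono {l L : ℝ} {u : E × ℝ → ℝ} {s s' : Set (E × ℝ)} (hu : PosSol l L u s)
    (h : s' ⊆ s) : PosSol l L u s' :=
  ⟨hu.1.mono h, fun p hp => hu.2.1 p (h hp), fun p hp => hu.2.2 p (h hp)⟩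

theorem PosSol.affine {l L : ℝ} {u : E × ℝ → ℝ} {s : Set (E × ℝ)} (hu : PosSol l L u s) (c k : ℝ)
    (h : ∀ p ∈ s, 0 ≤ c * u p + k) : PosSol l L (fun q => c * u q + k) s :=
  ⟨(continuousOn_const.mul hu.1).add continuousOn_const, h, fun p hp => (hu.2.2 p hp).affine c k⟩

theorem PosSol.rescale {l L : ℝ} {u : E × ℝ → ℝ} {s s' : Set (E × ℝ)} {x0 : E} {t0 r : ℝ}
    (hu : PosSol l L u s) (h : ∀ p ∈ s', (x0 + r • p.1, t0 + r ^ 2 * p.2) ∈ s) :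
    PosSol l L (fun q => u (x0 + r • q.1, t0 + r ^ 2 * q.2)) s' := by
  refine ⟨?_, fun p hp => hu.2.1 _ (h p hp), fun p hp => (hu.2.2 _ (h p hp)).rescale⟩
  exact hu.1.comp (f := fun q : E × ℝ => (x0 + r • q.1, t0 + r ^ 2 * q.2))
    (by fun_prop) fun p hp => h p hp

end KrylovSafonov

namespace KrylovSafonov

open Set Filter Topology MeasureTheory

variable {E : Type*} [NormedAddCommGroup E] [InnerProductSpace ℝ E] [FiniteDimensional ℝ E]

/-- Comparison principle on a cylinder with a strict subsolution `φ` as lower barrier. -/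
theorem comparison {l L : ℝ} (hl : 0 ≤ l) {u : E × ℝ → ℝ} {φ : E → ℝ → ℝ} {x0 : E} {R t0 t1 : ℝ}
    (hu : ContinuousOn u (Metric.closedBall x0 R ×ˢ Icc t0 t1))
    (hφ : ContinuousOn (fun p : E × ℝ => φ p.1 p.2) (Metric.closedBall x0 R ×ˢ Icc t0 t1))
    (hlat : ∀ x t, ‖x - x0‖ = R → t0 < t → t ≤ t1 → φ x t ≤ u (x, t))
    (hbot : t0 ≤ t1 → ∀ x, ‖x - x0‖ ≤ R → φ x t0 ≤ u (x, t0))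
    (hint : ∀ x t, ‖x - x0‖ < R → t0 < t → t ≤ t1 → u (x, t) < φ x t → SolAt l L u (x, t) ∧
      ∃ (τ α β : ℝ) (w : E), HasDerivAt (φ x) τ t ∧
        (∀ e : E, ‖e‖ = 1 → ∀ᶠ h in 𝓝[>] (0 : ℝ),
          (α + β * inner ℝ w e ^ 2) * h ^ 2 ≤ φ (x + h • e) t + φ (x - h • e) t - 2 * φ x t) ∧
        ∀ s m : ℝ, l * Module.finrank ℝ E ≤ s → s ≤ L * Module.finrank ℝ E →
          l * ‖w‖ ^ 2 ≤ m → m ≤ L * ‖w‖ ^ 2 → τ < α * s + β * m) :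
    ∀ x t, ‖x - x0‖ ≤ R → t0 ≤ t → t ≤ t1 → φ x t ≤ u (x, t) := by
  intro x1 s1 hx1 hs0 hs1
  by_contra hlt
  push Not at hlt
  have hcpt : IsCompact (Metric.closedBall x0 R ×ˢ Icc t0 t1) :=
    (isCompact_closedBall x0 R).prod isCompact_Icc
  have hmem : ∀ {x t}, (x, t) ∈ Metric.closedBall x0 R ×ˢ Icc t0 t1 ↔
      ‖x - x0‖ ≤ R ∧ t0 ≤ t ∧ t ≤ t1 := by
    intro x t
    rw [mem_prod, mem_closedBall_iff_norm, mem_Icc]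
  obtain ⟨⟨x, t⟩, hp, hmin⟩ := hcpt.exists_isMinOn ⟨(x1, s1), hmem.2 ⟨hx1, hs0, hs1⟩⟩ (hu.sub hφ)
  have hmin' : ∀ y s, ‖y - x0‖ ≤ R → t0 ≤ s → s ≤ t1 → u (x, t) - φ x t ≤ u (y, s) - φ y s :=
    fun y s a b c => isMinOn_iff.1 hmin (y, s) (hmem.2 ⟨a, b, c⟩)
  obtain ⟨hxR, ht0, ht1⟩ := hmem.1 hp
  have hneg : u (x, t) < φ x t := by
    have := hmin' x1 s1 hx1 hs0 hs1
    linarith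
  have ht0' : t0 < t := by
    rcases ht0.eq_or_lt with h | h
    · subst h
      exact absurd (hbot ht1 x hxR) (not_le.2 hneg)
    · exact h
  have hxR' : ‖x - x0‖ < R := by
    rcases hxR.eq_or_lt with h | h
    · exact absurd (hlat x t h ht0' ht1) (not_le.2 hneg)
    · exact h
  obtain ⟨hsol, τ, α, β, w, hd, hsd, hstrict⟩ := hint x t hxR' ht0' ht1 hneg
  obtain ⟨s, m, h1, h2, h3, h4, h5⟩ := hsol.touch hl (φ := φ) (τ := τ) (α := α) (β := β) (w := w)
    (by
      have : Ioo t0 t ∈ 𝓝[<] t := Ioo_mem_nhdsLT ht0'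
      filter_upwards [this] with s hs
      exact hmin' x s hxR hs.1.le (hs.2.le.trans ht1))
    (by
      have : Metric.ball x0 R ∈ 𝓝 x := Metric.isOpen_ball.mem_nhds (mem_ball_iff_norm.2 hxR')
      filter_upwards [this] with y hy
      exact hmin' y t (mem_ball_iff_norm.1 hy).le ht0 ht1)
    hd hsd
  exact absurd h5 (not_le.2 (hstrict s m h1 h2 h3 h4))

theorem norm_add_smul_sq (w e : E) (h : ℝ) (he : ‖e‖ = 1) :
    ‖w + h • e‖ ^ 2 = ‖w‖ ^ 2 + 2 * h * inner ℝ w e + h ^ 2 := by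
  rw [norm_add_sq_real, inner_smul_right, norm_smul, he, mul_one, Real.norm_eq_abs, sq_abs]
  ring

theorem norm_sub_smul_sq (w e : E) (h : ℝ) (he : ‖e‖ = 1) :
    ‖w - h • e‖ ^ 2 = ‖w‖ ^ 2 - 2 * h * inner ℝ w e + h ^ 2 := by
  rw [norm_sub_sq_real, inner_smul_right, norm_smul, he, mul_one, Real.norm_eq_abs, sq_abs]
  ring

/-- Expansion of positivity: a lower bound on a ball spreads along the parabola
`‖x - x0‖² ≤ B (q + τ)` with polynomial loss. -/
theorem expansion {l L B : ℝ} (hl : 0 < l) (hB : 0 < B) :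
    ∃ α : ℕ, ∀ (u : E × ℝ → ℝ) (x0 : E) (R t0 t1 q κ : ℝ), 0 < q → 0 ≤ R → 0 ≤ κ →
      B * (q + (t1 - t0)) ≤ R ^ 2 →
      PosSol l L u (Metric.closedBall x0 R ×ˢ Icc t0 t1) →
      (∀ x, ‖x - x0‖ ^ 2 ≤ B * q → κ ≤ u (x, t0)) →
      ∀ x t, ‖x - x0‖ ≤ R → t0 ≤ t → t ≤ t1 →
        κ * (q / (q + (t - t0))) ^ α * max (1 - ‖x - x0‖ ^ 2 / (B * (q + (t - t0)))) 0 ^ 2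
          ≤ u (x, t) := by
  set d : ℝ := ((Module.finrank ℝ E : ℕ) : ℝ) with hd
  set k : ℝ := 2 + 4 * (L * d) / B + 8 * l / B with hk
  obtain ⟨α, hα⟩ := exists_nat_gt (k ^ 2 * B / (32 * l))
  refine ⟨α, ?_⟩
  intro u x0 R t0 t1 q κ hq hR hκ hBR hu hbot
  rcases hκ.eq_or_lt with h0 | hκ'
  · intro x t hx h0t ht1
    rw [← h0]
    simpa using hu.2.1 (x, t) ⟨mem_closedBall_iff_norm.2 hx, h0t, ht1⟩
  have hσ : ∀ t, t0 ≤ t → 0 < q + (t - t0) := fun t ht => by linarith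
  refine comparison (L := L) hl.le (φ := fun x t => κ * (q / (q + (t - t0))) ^ α *
    max (1 - ‖x - x0‖ ^ 2 / (B * (q + (t - t0)))) 0 ^ 2) hu.1 ?_ ?_ ?_ ?_
  · have hne : ∀ p ∈ Metric.closedBall x0 R ×ˢ Icc t0 t1, q + (p.2 - t0) ≠ 0 :=
      fun p hp => (hσ p.2 hp.2.1).ne'
    have hne' : ∀ p ∈ Metric.closedBall x0 R ×ˢ Icc t0 t1, B * (q + (p.2 - t0)) ≠ 0 :=
      fun p hp => (mul_pos hB (hσ p.2 hp.2.1)).ne'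
    have h1 : ContinuousOn (fun p : E × ℝ => q / (q + (p.2 - t0)))
        (Metric.closedBall x0 R ×ˢ Icc t0 t1) :=
      continuousOn_const.div (by fun_prop) hne
    have h2 : ContinuousOn (fun p : E × ℝ => ‖p.1 - x0‖ ^ 2 / (B * (q + (p.2 - t0))))
        (Metric.closedBall x0 R ×ˢ Icc t0 t1) :=
      ContinuousOn.div (by fun_prop) (by fun_prop) hne'
    exact (continuousOn_const.mul (h1.pow α)).mul
      (((continuousOn_const.sub h2).sup continuousOn_const).pow 2)
  · intro x t hx h0t ht1
    have : 1 ≤ ‖x - x0‖ ^ 2 / (B * (q + (t - t0))) := by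
      rw [le_div_iff₀ (mul_pos hB (hσ t h0t.le)), hx, one_mul]
      nlinarith
    rw [max_eq_right (by linarith)]
    simpa using hu.2.1 (x, t) ⟨mem_closedBall_iff_norm.2 hx.le, h0t.le, ht1⟩
  · intro ht1 x hx
    by_cases hxs : ‖x - x0‖ ^ 2 ≤ B * q
    · have h1 := hbot x hxs
      rw [sub_self, add_zero, div_self hq.ne', one_pow, mul_one]
      have h2 : max (1 - ‖x - x0‖ ^ 2 / (B * q)) 0 ≤ 1 := by
        refine max_le ?_ zero_le_one
        have : 0 ≤ ‖x - x0‖ ^ 2 / (B * q) := by positivity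
        linarith
      have h3 : max (1 - ‖x - x0‖ ^ 2 / (B * q)) 0 ^ 2 ≤ 1 := pow_le_one₀ (le_max_right _ _) h2
      nlinarith
    · have : 1 ≤ ‖x - x0‖ ^ 2 / (B * q) := by
        rw [le_div_iff₀ (by positivity)]
        linarith
      rw [sub_self, add_zero, max_eq_right (by linarith)]
      simpa using hu.2.1 (x, t0) ⟨mem_closedBall_iff_norm.2 hx, le_rfl, ht1⟩
  · intro x t hx h0t ht1 hlt
    have hmem : (x, t) ∈ Metric.closedBall x0 R ×ˢ Icc t0 t1 :=
      ⟨mem_closedBall_iff_norm.2 hx.le, h0t.le, ht1⟩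
    refine ⟨hu.2.2 _ hmem, ?_⟩
    have hu0 := hu.2.1 _ hmem
    set σ := q + (t - t0) with hσd
    have hσ0 : 0 < σ := hσ t h0t.le
    set s := 1 - ‖x - x0‖ ^ 2 / (B * σ) with hs
    have hs0 : 0 < s := by
      by_contra hcon
      simp only [max_eq_right (not_lt.1 hcon)] at hlt
      simp at hlt
      linarith
    have hs1 : s ≤ 1 := by
      have : 0 ≤ ‖x - x0‖ ^ 2 / (B * σ) := by positivity
      linarith
    set c := κ * (q / σ) ^ α with hc
    have hc0 : 0 < c := by positivity
    have hz : ‖x - x0‖ ^ 2 = (1 - s) * (B * σ) := by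
      rw [hs]; field_simp; ring
    refine ⟨c / σ * (-α * s ^ 2 + 2 * s * (1 - s)), -(4 * c * s / (B * σ)), 8 * c / (B * σ) ^ 2,
      x - x0, ?_, ?_, ?_⟩
    · have hσt : HasDerivAt (fun t : ℝ => q + (t - t0)) 1 t := by
        simpa using ((hasDerivAt_id t).sub_const t0).const_add q
      have h1 : HasDerivAt (fun t : ℝ => q / (q + (t - t0))) (-q / σ ^ 2) t := by
        have := (hasDerivAt_const t q).div hσt hσ0.ne'
        refine this.congr_deriv ?_
        simp [hσd]
      have h2 : HasDerivAt (fun t : ℝ => 1 - ‖x - x0‖ ^ 2 / (B * (q + (t - t0))))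
          (‖x - x0‖ ^ 2 * B / (B * σ) ^ 2) t := by
        have := ((hasDerivAt_const t (‖x - x0‖ ^ 2)).div (hσt.const_mul B)
          (mul_pos hB hσ0).ne').const_sub 1
        refine this.congr_deriv ?_
        simp [hσd]
        ring
      have h3 := ((h1.pow α).const_mul κ).mul (h2.pow 2)
      have hev : ∀ᶠ t' in 𝓝 t, 0 < 1 - ‖x - x0‖ ^ 2 / (B * (q + (t' - t0))) :=
        h2.continuousAt.eventually (lt_mem_nhds hs0)
      refine HasDerivAt.congr_of_eventuallyEq (h3.congr_deriv ?_) ?_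
      · simp only [Pi.pow_apply, ← hσd, ← hs]
        rw [hz, hc]
        cases α with
        | zero => simp; field_simp
        | succ a =>
          simp only [Nat.add_sub_cancel, Nat.cast_succ, pow_succ (q / σ)]
          generalize (q / σ) ^ a = X
          field_simp
          ring
      · filter_upwards [hev] with t' ht'
        simp [max_eq_left ht'.le]
    · intro e he
      have hcont : Continuous fun h : ℝ => 1 - ‖x + h • e - x0‖ ^ 2 / (B * σ) := by fun_prop
      have hcont' : Continuous fun h : ℝ => 1 - ‖x - h • e - x0‖ ^ 2 / (B * σ) := by fun_prop
      have hp : ∀ᶠ h in 𝓝[>] (0 : ℝ), 0 < 1 - ‖x + h • e - x0‖ ^ 2 / (B * σ) :=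
        ((hcont.tendsto 0).eventually (lt_mem_nhds (by simpa [hs] using hs0))).filter_mono
          nhdsWithin_le_nhds
      have hm : ∀ᶠ h in 𝓝[>] (0 : ℝ), 0 < 1 - ‖x - h • e - x0‖ ^ 2 / (B * σ) :=
        ((hcont'.tendsto 0).eventually (lt_mem_nhds (by simpa [hs] using hs0))).filter_mono
          nhdsWithin_le_nhds
      filter_upwards [hp, hm] with h h1 h2
      rw [max_eq_left h1.le, max_eq_left h2.le, max_eq_left hs0.le]
      rw [show x + h • e - x0 = (x - x0) + h • e by abel,
        show x - h • e - x0 = (x - x0) - h • e by abel, norm_add_smul_sq _ _ _ he,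
        norm_sub_smul_sq _ _ _ he]
      set y : ℝ := inner ℝ (x - x0) e
      have e1 : 1 - (‖x - x0‖ ^ 2 + 2 * h * y + h ^ 2) / (B * σ)
          = s - (2 * h * y + h ^ 2) / (B * σ) := by rw [hs]; ring
      have e2 : 1 - (‖x - x0‖ ^ 2 - 2 * h * y + h ^ 2) / (B * σ)
          = s - (-(2 * h * y) + h ^ 2) / (B * σ) := by rw [hs]; ring
      rw [e1, e2]
      have : c * (s - (2 * h * y + h ^ 2) / (B * σ)) ^ 2
          + c * (s - (-(2 * h * y) + h ^ 2) / (B * σ)) ^ 2 - 2 * (c * s ^ 2)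
          = (-(4 * c * s / (B * σ)) + 8 * c / (B * σ) ^ 2 * y ^ 2) * h ^ 2
            + 2 * c * (h ^ 2 / (B * σ)) ^ 2 := by
        field_simp; ring
      rw [this]
      have : 0 ≤ 2 * c * (h ^ 2 / (B * σ)) ^ 2 := by positivity
      linarith
    · intro S m _ hS hm _
      have hBσ : 0 < B * σ := by positivity
      have key : 0 < ((α : ℝ) + 2) * s ^ 2 - k * s + 8 * l / B := by
        rw [div_lt_iff₀ (by positivity)] at hα
        have ha : k ^ 2 < 4 * ((α : ℝ) + 2) * (8 * l / B) := by
          rw [mul_div_assoc', lt_div_iff₀ hB]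
          nlinarith
        have ha0 : (0 : ℝ) < (α : ℝ) + 2 := by positivity
        nlinarith [sq_nonneg (2 * ((α : ℝ) + 2) * s - k)]
      have h1 : 4 * c * s / (B * σ) * S ≤ 4 * c * s / (B * σ) * (L * d) :=
        mul_le_mul_of_nonneg_left hS (by positivity)
      have h2 : 8 * c / (B * σ) ^ 2 * (l * ‖x - x0‖ ^ 2) ≤ 8 * c / (B * σ) ^ 2 * m :=
        mul_le_mul_of_nonneg_left hm (by positivity)
      rw [hz] at h2
      have h3 : -(4 * c * s / (B * σ)) * (L * d) + 8 * c / (B * σ) ^ 2 * (l * ((1 - s) * (B * σ)))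
          - c / σ * (-α * s ^ 2 + 2 * s * (1 - s))
          = c / σ * (((α : ℝ) + 2) * s ^ 2 - k * s + 8 * l / B) := by
        rw [hk]; field_simp; ring
      have h4 := mul_pos (div_pos hc0 hσ0) key
      linarith

/-- In a thin strip around a hyperplane, a function that solves the equation where it exceeds `θ`
and is at most `θ` outside the strip exceeds `θ` only by a small amount. -/
theorem strip_bound {l L : ℝ} (hl : 0 < l) (hL : 0 ≤ L) :
    ∃ Γ : ℝ, 0 < Γ ∧ ∀ (f : E × ℝ → ℝ) (x0 ν : E) (R t0 h θ m : ℝ), ‖ν‖ = 1 → 0 < R → 0 < m →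
      ContinuousOn f (Metric.closedBall x0 R ×ˢ Icc (t0 - R ^ 2) t0) →
      (∀ p ∈ Metric.closedBall x0 R ×ˢ Icc (t0 - R ^ 2) t0, θ < f p → |inner ℝ ν p.1| < h →
        SolAt l L f p) →
      (∀ p ∈ Metric.closedBall x0 R ×ˢ Icc (t0 - R ^ 2) t0, h ≤ |inner ℝ ν p.1| → f p ≤ θ) →
      (∀ p ∈ Metric.closedBall x0 R ×ˢ Icc (t0 - R ^ 2) t0, f p ≤ θ + m) →
      f (x0, t0) ≤ θ + m * (Γ * h ^ 2 / R ^ 2) := by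
  set d : ℝ := ((Module.finrank ℝ E : ℕ) : ℝ) with hd
  have hd0 : 0 ≤ d := Nat.cast_nonneg _
  have hΓ : 0 < (1 + L * d) / l := by positivity
  refine ⟨(1 + L * d) / l, hΓ, ?_⟩
  set Γ := (1 + L * d) / l with hΓd
  intro f x0 ν R t0 h θ m hν hR hm hf hsol hout hbd
  have hR2 : 0 < R ^ 2 := by positivity
  set ψ : E → ℝ → ℝ := fun x t => ‖x - x0‖ ^ 2 / R ^ 2 + (t0 - t) / R ^ 2
    + Γ / R ^ 2 * max (h ^ 2 - inner ℝ ν x ^ 2) 0 with hψ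
  have hψ0 : ∀ x t, t ≤ t0 → 0 ≤ ψ x t := by
    intro x t ht
    have : 0 ≤ t0 - t := by linarith
    simp only [hψ]
    positivity
  have hmem : ∀ {x t}, ‖x - x0‖ ≤ R → t0 - R ^ 2 ≤ t → t ≤ t0 →
      (x, t) ∈ Metric.closedBall x0 R ×ˢ Icc (t0 - R ^ 2) t0 :=
    fun h1 h2 h3 => ⟨mem_closedBall_iff_norm.2 h1, h2, h3⟩
  have main := comparison (L := L) hl.le (u := fun p => (-1) * f p + 0)
    (φ := fun x t => -(θ + m * ψ x t))
    (x0 := x0) (R := R) (t0 := t0 - R ^ 2) (t1 := t0) (by fun_prop) ?_ ?_ ?_ ?_ x0 t0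
    (by simpa using hR.le) (by linarith) le_rfl
  · simp only [hψ, sub_self, norm_zero] at main
    have h1 : max (h ^ 2 - inner ℝ ν x0 ^ 2) 0 ≤ h ^ 2 :=
      max_le (by linarith [sq_nonneg (inner ℝ ν x0 : ℝ)]) (sq_nonneg h)
    have h2 : Γ / R ^ 2 * max (h ^ 2 - inner ℝ ν x0 ^ 2) 0 ≤ Γ / R ^ 2 * h ^ 2 :=
      mul_le_mul_of_nonneg_left h1 (by positivity)
    have h3 := mul_le_mul_of_nonneg_left h2 hm.le
    have h4 : m * (Γ * h ^ 2 / R ^ 2) = m * (Γ / R ^ 2 * h ^ 2) := by ring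
    rw [h4]
    norm_num at main
    linarith
  · simp only [hψ]
    fun_prop
  · intro x t hx h0 h1
    have : 1 ≤ ψ x t := by
      have : 0 ≤ t0 - t := by linarith
      simp only [hψ, hx]
      rw [div_self hR2.ne', add_assoc]
      have : 0 ≤ (t0 - t) / R ^ 2 + Γ / R ^ 2 * max (h ^ 2 - inner ℝ ν x ^ 2) 0 := by positivity
      linarith
    have h2 := hbd _ (hmem hx.le h0.le h1)
    nlinarith
  · intro _ x hx
    have : 1 ≤ ψ x (t0 - R ^ 2) := by
      simp only [hψ]
      rw [sub_sub_cancel, div_self hR2.ne']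
      have : 0 ≤ ‖x - x0‖ ^ 2 / R ^ 2 := by positivity
      have : 0 ≤ Γ / R ^ 2 * max (h ^ 2 - inner ℝ ν x ^ 2) 0 := by positivity
      linarith
    have h2 := hbd _ (hmem hx le_rfl (by linarith))
    nlinarith
  · intro x t hx h0 h1 hlt
    have hm' := hmem hx.le h0.le h1
    have hp := mul_nonneg hm.le (hψ0 x t h1)
    have hθ : θ < f (x, t) := by linarith
    have hin : |inner ℝ ν x| < h := by
      by_contra hcon
      exact absurd (hout _ hm' (not_lt.1 hcon)) (not_le.2 hθ)
    have hin2 : 0 < h ^ 2 - inner ℝ ν x ^ 2 := by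
      have := sq_lt_sq' (by linarith [abs_nonneg (inner ℝ ν x : ℝ)]) hin
      rw [sq_abs] at this
      linarith
    refine ⟨(hsol _ hm' hθ hin).affine (-1) 0, m / R ^ 2, -(2 * m / R ^ 2), 2 * Γ * m / R ^ 2, ν,
      ?_, ?_, ?_⟩
    · have h2 : HasDerivAt (fun t : ℝ => (t0 - t) / R ^ 2) (-1 / R ^ 2) t :=
        ((hasDerivAt_id t).const_sub t0).div_const _
      have h3 := ((((h2.const_add (‖x - x0‖ ^ 2 / R ^ 2)).add_const
        (Γ / R ^ 2 * max (h ^ 2 - inner ℝ ν x ^ 2) 0)).const_mul m).const_add θ).neg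
      refine h3.congr_deriv ?_
      ring
    · intro e he
      have hc1 : Continuous fun r : ℝ => h ^ 2 - inner ℝ ν (x + r • e) ^ 2 := by fun_prop
      have hc2 : Continuous fun r : ℝ => h ^ 2 - inner ℝ ν (x - r • e) ^ 2 := by fun_prop
      have hp : ∀ᶠ r in 𝓝[>] (0 : ℝ), 0 < h ^ 2 - inner ℝ ν (x + r • e) ^ 2 :=
        ((hc1.tendsto 0).eventually (lt_mem_nhds (by simpa using hin2))).filter_mono
          nhdsWithin_le_nhds
      have hm : ∀ᶠ r in 𝓝[>] (0 : ℝ), 0 < h ^ 2 - inner ℝ ν (x - r • e) ^ 2 :=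
        ((hc2.tendsto 0).eventually (lt_mem_nhds (by simpa using hin2))).filter_mono
          nhdsWithin_le_nhds
      filter_upwards [hp, hm] with r h1 h2
      simp only [hψ]
      rw [max_eq_left h1.le, max_eq_left h2.le, max_eq_left hin2.le,
        show x + r • e - x0 = (x - x0) + r • e by abel,
        show x - r • e - x0 = (x - x0) - r • e by abel, norm_add_smul_sq _ _ _ he,
        norm_sub_smul_sq _ _ _ he, inner_add_right, inner_sub_right, inner_smul_right]
      apply le_of_eq
      field_simp
      ring
    · intro S M _ hS hM _
      rw [hν] at hM
      have h2 : 2 * m / R ^ 2 * S ≤ 2 * m / R ^ 2 * (L * d) :=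
        mul_le_mul_of_nonneg_left hS (by positivity)
      have h3 : 2 * Γ * m / R ^ 2 * (l * 1 ^ 2) ≤ 2 * Γ * m / R ^ 2 * M :=
        mul_le_mul_of_nonneg_left hM (by positivity)
      have h4 : 2 * Γ * m / R ^ 2 * (l * 1 ^ 2) = m / R ^ 2 * (2 + 2 * (L * d)) := by
        rw [hΓd]; field_simp
      have h5 : 0 < m / R ^ 2 := by positivity
      have h6 : 2 * m / R ^ 2 = 2 * (m / R ^ 2) := by ring
      rw [h6] at h2 ⊢
      linarith

end KrylovSafonov

namespace KrylovSafonov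

open Set Filter Topology MeasureTheory

variable {E : Type*} [NormedAddCommGroup E] [InnerProductSpace ℝ E] [FiniteDimensional ℝ E]

theorem volume_image_le_of_lipschitzOn {g : ℝ → ℝ} {s : Set ℝ} {C : NNReal}
    (h : LipschitzOnWith C g s) : volume (g '' s) ≤ C * volume s := by
  have := h.hausdorffMeasure_image_le (d := 1) zero_le_one
  simpa [hausdorffMeasure_real] using this

/-- The values of a function at its running minima, where its left slopes are bounded, fill a set of
controlled measure. -/
theorem volume_image_runningMin_le {g : ℝ → ℝ} {s : Set ℝ} {C : ℝ} (hC : 0 ≤ C)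
    (hs : ∀ t ∈ s, 0 ≤ t)
    (hmin : ∀ t ∈ s, ∀ r, 0 ≤ r → r ≤ t → g t ≤ g r)
    (hslope : ∀ t ∈ s, ∀ᶠ r in 𝓝[<] t, g r - g t ≤ C * (t - r)) :
    volume (g '' s) ≤ ENNReal.ofReal C * volume s := by
  set S : ℕ → Set ℝ := fun k => {t ∈ s | ∀ r, t - 1 / ((k : ℝ) + 1) < r → r < t →
    g r - g t ≤ C * (t - r)} with hS
  have hmono : Monotone S := by
    intro k k' hk t ht
    refine ⟨ht.1, fun r h1 h2 => ht.2 r ?_ h2⟩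
    have : 1 / ((k' : ℝ) + 1) ≤ 1 / ((k : ℝ) + 1) :=
      one_div_le_one_div_of_le (by positivity) (by exact_mod_cast Nat.succ_le_succ hk)
    linarith
  have hU : s = ⋃ k, S k := by
    refine Subset.antisymm ?_ (iUnion_subset fun k t ht => ht.1)
    intro t ht
    obtain ⟨a, ha, hsub⟩ := mem_nhdsLT_iff_exists_Ioo_subset.1 (hslope t ht)
    obtain ⟨k, hk⟩ := exists_nat_one_div_lt (sub_pos.2 (show a < t from ha))
    exact mem_iUnion.2 ⟨k, ht, fun r h1 h2 => hsub ⟨by linarith, h2⟩⟩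
  have hk : ∀ k, volume (g '' S k) ≤ ENNReal.ofReal C * volume (S k) := by
    intro k
    set δ : ℝ := 1 / ((k : ℝ) + 1) with hδ
    have hδ0 : 0 < δ := by positivity
    set I : ℤ → Set ℝ := fun j => Ico (j • δ) ((j + 1) • δ) with hI
    have hIU : ⋃ j, I j = univ := iUnion_Ico_zsmul hδ0
    have hId : Pairwise (Function.onFun Disjoint I) := pairwise_disjoint_Ico_zsmul δ
    have hpiece : ∀ j, volume (g '' (S k ∩ I j)) ≤ ENNReal.ofReal C * volume (S k ∩ I j) := by
      intro j
      refine volume_image_le_of_lipschitzOn (C := C.toNNReal) (LipschitzOnWith.of_dist_le_mul ?_)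
      have key : ∀ x ∈ S k ∩ I j, ∀ y ∈ S k ∩ I j, x < y → |g x - g y| ≤ C * |x - y| := by
        intro x hx y hy hxy
        have h1 := hmin y hy.1.1 x (hs x hx.1.1) hxy.le
        have h2 : y - δ < x := by
          have := hx.2.1
          have := hy.2.2
          rw [add_smul, one_smul] at this
          linarith
        have h3 := hy.1.2 x h2 hxy
        rw [abs_of_nonneg (by linarith), abs_of_neg (by linarith)]
        linarith
      intro x hx y hy
      rw [Real.dist_eq, Real.dist_eq, Real.coe_toNNReal C hC]
      rcases lt_trichotomy x y with h | h | h
      · exact key x hx y hy h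
      · simp [h]
      · rw [abs_sub_comm, abs_sub_comm x]
        exact key y hy x hx h
    calc volume (g '' S k) = volume (⋃ j, g '' (S k ∩ I j)) := by
          rw [← image_iUnion, ← inter_iUnion, hIU, inter_univ]
      _ ≤ ∑' j, volume (g '' (S k ∩ I j)) := measure_iUnion_le _
      _ ≤ ∑' j, ENNReal.ofReal C * volume (S k ∩ I j) := ENNReal.tsum_le_tsum hpiece
      _ = ENNReal.ofReal C * ∑' j, (volume.restrict (S k)) (I j) := by
          rw [ENNReal.tsum_mul_left]
          congr 2
          funext j
          rw [Measure.restrict_apply measurableSet_Ico, inter_comm]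
      _ = ENNReal.ofReal C * volume (S k) := by
          rw [← measure_iUnion hId fun j => measurableSet_Ico, hIU, Measure.restrict_apply_univ]
  rw [hU, image_iUnion]
  have hmono' : Monotone fun k => g '' S k := fun a b hab => image_mono (hmono hab)
  rw [hmono'.measure_iUnion]
  refine iSup_le fun k => (hk k).trans ?_
  gcongr
  exact subset_iUnion S k

theorem norm_le_of_psd {T : E →L[ℝ] E} {c : ℝ}
    (b : OrthonormalBasis (Fin (Module.finrank ℝ E)) ℝ E)
    (hsymm : ∀ e f, inner ℝ (T e) f = inner ℝ (T f) e)
    (hpos : ∀ e, 0 ≤ inner ℝ (T e) e) (hc : ∀ k, inner ℝ (T (b k)) (b k) ≤ c) :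
    ‖T‖ ≤ (Module.finrank ℝ E) ^ 2 * |c| := by
  have hjk : ∀ j k, |inner ℝ (T (b j)) (b k)| ≤ |c| := by
    intro j k
    have h1 := hpos (b j + b k)
    have h2 := hpos (b j - b k)
    simp only [map_add, map_sub, inner_add_left, inner_add_right, inner_sub_left,
      inner_sub_right] at h1 h2
    rw [hsymm (b k) (b j)] at h1 h2
    have h3 := hc j
    have h4 := hc k
    have h5 := le_abs_self c
    rw [abs_le]
    constructor <;> linarith
  have hTb : ∀ j, ‖T (b j)‖ ≤ Module.finrank ℝ E * |c| := by
    intro j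
    rw [← b.sum_repr' (T (b j))]
    calc ‖∑ i, inner ℝ (b i) (T (b j)) • b i‖ ≤ ∑ i, ‖inner ℝ (b i) (T (b j)) • b i‖ :=
          norm_sum_le _ _
      _ ≤ ∑ i : Fin (Module.finrank ℝ E), |c| := by
          refine Finset.sum_le_sum fun i _ => ?_
          rw [norm_smul, b.orthonormal.1 i, mul_one, Real.norm_eq_abs, real_inner_comm]
          exact hjk j i
      _ = Module.finrank ℝ E * |c| := by simp
  refine T.opNorm_le_bound (by positivity) fun x => ?_
  conv_lhs => rw [← b.sum_repr' x]
  rw [map_sum]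
  calc ‖∑ i, T (inner ℝ (b i) x • b i)‖ ≤ ∑ i, ‖T (inner ℝ (b i) x • b i)‖ := norm_sum_le _ _
    _ ≤ ∑ i : Fin (Module.finrank ℝ E), ‖x‖ * (Module.finrank ℝ E * |c|) := by
        refine Finset.sum_le_sum fun i _ => ?_
        rw [map_smul, norm_smul]
        gcongr
        · have := norm_inner_le_norm (𝕜 := ℝ) (b i) x
          rwa [b.orthonormal.1 i, one_mul] at this
        · exact hTb i
    _ = Module.finrank ℝ E ^ 2 * |c| * ‖x‖ := by simp; ring

variable [MeasurableSpace E] [BorelSpace E]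

theorem abs_det_le_of_norm_le {T : E →L[ℝ] E} {C : ℝ} (hC : 0 ≤ C) (hT : ‖T‖ ≤ C) :
    |T.det| ≤ C ^ Module.finrank ℝ E := by
  have h1 := Measure.addHaar_image_continuousLinearMap (μ := (volume : Measure E)) T (Metric.ball 0 1)
  have h2 : T '' Metric.ball 0 1 ⊆ Metric.closedBall 0 C := by
    rintro _ ⟨x, hx, rfl⟩
    rw [mem_ball_zero_iff] at hx
    rw [mem_closedBall_zero_iff]
    calc ‖T x‖ ≤ ‖T‖ * ‖x‖ := T.le_opNorm x
      _ ≤ C * 1 := by gcongr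
      _ = C := mul_one C
  have h3 := measure_mono (μ := (volume : Measure E)) h2
  rw [h1, Measure.addHaar_closedBall volume 0 hC] at h3
  have hb : volume (Metric.ball (0 : E) 1) ≠ 0 := (Metric.measure_ball_pos volume _ one_pos).ne'
  have hb' : volume (Metric.ball (0 : E) 1) ≠ ⊤ := measure_ball_lt_top.ne
  rw [ENNReal.mul_le_mul_iff_left hb hb'] at h3
  exact (ENNReal.ofReal_le_ofReal_iff (by positivity)).1 h3

/-- If every `y ∈ Y` is the image of some point of the measurable set `K` at which `F` is
differentiable with derivative of norm at most `C`, then `|Y| ≤ C^d |K|`. -/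
theorem volume_le_of_image_bounded_deriv {F : E → E} {K Y : Set E} {C : ℝ} (hC : 0 ≤ C)
    (hK : MeasurableSet K)
    (h : ∀ y ∈ Y, ∃ x ∈ K, F x = y ∧ DifferentiableAt ℝ F x ∧ ‖fderiv ℝ F x‖ ≤ C) :
    volume Y ≤ ENNReal.ofReal (C ^ Module.finrank ℝ E) * volume K := by
  set s : Set E := K ∩ ({x | DifferentiableAt ℝ F x} ∩ {x | ‖fderiv ℝ F x‖ ≤ C}) with hs
  have hsm : MeasurableSet s :=
    hK.inter ((measurableSet_of_differentiableAt ℝ F).inter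
      (measurableSet_le (measurable_fderiv ℝ F).norm measurable_const))
  have h1 : Y ⊆ F '' s := fun y hy => by
    obtain ⟨x, hx, h1, h2, h3⟩ := h y hy
    exact ⟨x, ⟨hx, h2, h3⟩, h1⟩
  calc volume Y ≤ volume (F '' s) := measure_mono h1
    _ ≤ ∫⁻ x in s, ENNReal.ofReal |(fderiv ℝ F x).det| :=
        addHaar_image_le_lintegral_abs_det_fderiv volume hsm
          fun x hx => hx.2.1.hasFDerivAt.hasFDerivWithinAt
    _ ≤ ∫⁻ _ in s, ENNReal.ofReal (C ^ Module.finrank ℝ E) := by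
        refine setLIntegral_mono measurable_const fun x hx => ?_
        exact ENNReal.ofReal_le_ofReal (abs_det_le_of_norm_le hC hx.2.2)
    _ = ENNReal.ofReal (C ^ Module.finrank ℝ E) * volume s := setLIntegral_const _ _
    _ ≤ _ := by
        gcongr
        exact inter_subset_left

end KrylovSafonov

namespace KrylovSafonov

open Set Filter Topology MeasureTheory

variable {E : Type*} [NormedAddCommGroup E] [InnerProductSpace ℝ E] [FiniteDimensional ℝ E]

theorem norm_add_smul_sq' (w e : E) (h : ℝ) :
    ‖w + h • e‖ ^ 2 = ‖w‖ ^ 2 + 2 * h * inner ℝ w e + h ^ 2 * ‖e‖ ^ 2 := by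
  rw [norm_add_sq_real, inner_smul_right, norm_smul, mul_pow, Real.norm_eq_abs, sq_abs]
  ring

theorem norm_sub_smul_sq' (w e : E) (h : ℝ) :
    ‖w - h • e‖ ^ 2 = ‖w‖ ^ 2 - 2 * h * inner ℝ w e + h ^ 2 * ‖e‖ ^ 2 := by
  rw [norm_sub_sq_real, inner_smul_right, norm_smul, mul_pow, Real.norm_eq_abs, sq_abs]
  ring

/-- The barrier `N e^{-Kt} ((t - |x|²)₊)²`. -/
def abpBarrier (N K : ℝ) (x : E) (t : ℝ) : ℝ := N * Real.exp (-K * t) * max (t - ‖x‖ ^ 2) 0 ^ 2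

theorem continuous_abpBarrier (N K : ℝ) :
    Continuous fun p : E × ℝ => abpBarrier N K p.1 p.2 := by
  unfold abpBarrier
  fun_prop

theorem abpBarrier_of_nonpos {N K : ℝ} {x : E} {t : ℝ} (h : t - ‖x‖ ^ 2 ≤ 0) :
    abpBarrier N K x t = 0 := by
  simp [abpBarrier, max_eq_right h]

theorem abpBarrier_of_pos {N K : ℝ} {x : E} {t : ℝ} (h : 0 ≤ t - ‖x‖ ^ 2) :
    abpBarrier N K x t = N * Real.exp (-K * t) * (t - ‖x‖ ^ 2) ^ 2 := by
  simp [abpBarrier, max_eq_left h]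

theorem hasDerivAt_abpBarrier {N K : ℝ} {x : E} {t : ℝ} (hs : 0 < t - ‖x‖ ^ 2) :
    HasDerivAt (abpBarrier N K x)
      (N * Real.exp (-K * t) * (-K * (t - ‖x‖ ^ 2) ^ 2 + 2 * (t - ‖x‖ ^ 2))) t := by
  have h1 : HasDerivAt (fun t : ℝ => t - ‖x‖ ^ 2) 1 t := (hasDerivAt_id t).sub_const _
  have h2 : HasDerivAt (fun t : ℝ => Real.exp (-K * t)) (Real.exp (-K * t) * (-K)) t := by
    have := ((hasDerivAt_id t).const_mul (-K)).exp
    simpa using this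
  have h3 := (h2.const_mul N).mul (h1.pow 2)
  refine HasDerivAt.congr_of_eventuallyEq (h3.congr_deriv ?_) ?_
  · simp only [Pi.pow_apply]
    ring
  · filter_upwards [h1.continuousAt.eventually (lt_mem_nhds hs)] with t' ht'
    rw [abpBarrier_of_pos ht'.le]
    rfl

theorem secondDiff_abpBarrier {N K : ℝ} (hN : 0 ≤ N) {x : E} {t : ℝ} (hs : 0 < t - ‖x‖ ^ 2)
    (e : E) : ∀ᶠ h in 𝓝[>] (0 : ℝ),
      N * Real.exp (-K * t) * (-4 * (t - ‖x‖ ^ 2) * ‖e‖ ^ 2 + 8 * inner ℝ x e ^ 2) * h ^ 2 ≤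
        abpBarrier N K (x + h • e) t + abpBarrier N K (x - h • e) t - 2 * abpBarrier N K x t := by
  have hc1 : Continuous fun r : ℝ => t - ‖x + r • e‖ ^ 2 := by fun_prop
  have hc2 : Continuous fun r : ℝ => t - ‖x - r • e‖ ^ 2 := by fun_prop
  have hp : ∀ᶠ r in 𝓝[>] (0 : ℝ), 0 < t - ‖x + r • e‖ ^ 2 :=
    ((hc1.tendsto 0).eventually (lt_mem_nhds (by simpa using hs))).filter_mono nhdsWithin_le_nhds
  have hm : ∀ᶠ r in 𝓝[>] (0 : ℝ), 0 < t - ‖x - r • e‖ ^ 2 :=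
    ((hc2.tendsto 0).eventually (lt_mem_nhds (by simpa using hs))).filter_mono nhdsWithin_le_nhds
  filter_upwards [hp, hm] with h h1 h2
  rw [abpBarrier_of_pos h1.le, abpBarrier_of_pos h2.le, abpBarrier_of_pos hs.le,
    norm_add_smul_sq', norm_sub_smul_sq']
  have : 0 ≤ N * Real.exp (-K * t) * (2 * (h ^ 2 * ‖e‖ ^ 2) ^ 2) := by positivity
  linarith

theorem hasFDerivAt_norm_sq_sub (x y : E) :
    HasFDerivAt (fun x : E => ‖x - y‖ ^ 2) ((2 : ℝ) • innerSL ℝ (x - y)) x := by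
  have h := (hasStrictFDerivAt_norm_sq (x - y)).hasFDerivAt
  have h2 := h.comp x ((hasFDerivAt_id x).sub_const y)
  refine h2.congr_fderiv ?_
  ext e; simp

theorem hasFDerivAt_abpBarrier {N K : ℝ} {x : E} {t : ℝ} (hs : 0 < t - ‖x‖ ^ 2) :
    HasFDerivAt (fun y : E => abpBarrier N K y t)
      ((-4 * (N * Real.exp (-K * t)) * (t - ‖x‖ ^ 2)) • innerSL ℝ x) x := by
  have h1 : HasFDerivAt (fun y : E => t - ‖y‖ ^ 2) (-((2 : ℝ) • innerSL ℝ x)) x := by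
    have := (hasFDerivAt_norm_sq_sub x 0).const_sub t
    simpa using this
  have h2 := (h1.pow 2).const_mul (N * Real.exp (-K * t))
  refine HasFDerivAt.congr_of_eventuallyEq (h2.congr_fderiv ?_) ?_
  · ext e; simp; ring
  · filter_upwards [h1.continuousAt.eventually (lt_mem_nhds hs)] with t' ht'
    rw [abpBarrier_of_pos ht'.le]

/-- The map sending a contact point `x` to the vertex of the touching paraboloid. -/
def vertexMap (N K ε : ℝ) (u : E × ℝ → ℝ) (t : ℝ) (x : E) : E :=
  x + ε⁻¹ • ((InnerProductSpace.toDual ℝ E).symm (fderiv ℝ (fun y => u (y, t)) x)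
    + (4 * (N * Real.exp (-K * t)) * (t - ‖x‖ ^ 2)) • x)

theorem hasFDerivAt_vertexMap {N K ε : ℝ} {u : E × ℝ → ℝ} {t : ℝ} {x : E}
    (hu : ContDiffAt ℝ 2 (fun y => u (y, t)) x) :
    ∃ T : E →L[ℝ] E, HasFDerivAt (vertexMap N K ε u t) T x ∧ ∀ e f : E,
      inner ℝ (T e) f = inner ℝ e f + ε⁻¹ * (fderiv ℝ (fderiv ℝ (fun y => u (y, t))) x e f
        + N * Real.exp (-K * t) * (4 * (t - ‖x‖ ^ 2) * inner ℝ e f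
          - 8 * inner ℝ x e * inner ℝ x f)) := by
  have hf1 : DifferentiableAt ℝ (fderiv ℝ (fun y => u (y, t))) x :=
    (hu.fderiv_right (m := 1) (by norm_num)).differentiableAt (by simp)
  have h1 : HasFDerivAt (fun y : E => t - ‖y‖ ^ 2) (-((2 : ℝ) • innerSL ℝ x)) x := by
    have := (hasFDerivAt_norm_sq_sub x 0).const_sub t
    simpa using this
  have h2 := ((h1.const_mul (4 * (N * Real.exp (-K * t)))).smul (hasFDerivAt_id x))
  have h3 := ((InnerProductSpace.toDual ℝ E).symm.toContinuousLinearEquiv.hasFDerivAt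
    (x := fderiv ℝ (fun y => u (y, t)) x)).comp x hf1.hasFDerivAt
  have h4 := (hasFDerivAt_id x).add ((h3.add h2).const_smul ε⁻¹)
  refine ⟨_, h4, fun e f => ?_⟩
  simp [inner_add_left, inner_smul_left]
  ring

theorem exp_neg_mul_le_one {K t : ℝ} (hK : 0 ≤ K) (ht : 0 ≤ t) : Real.exp (-K * t) ≤ 1 :=
  Real.exp_le_one_iff.2 (by nlinarith)

theorem contact_time_absurd {a s t k l K q : ℝ} (ha : 2 ≤ a) (ht : 1 ≤ t) (hl : 0 < l)
    (hK : 0 < K) (hk : k ^ 2 ≤ 16 * l * K) (hq : q < 8 * l)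
    (h : a * (K * s ^ 2 - k * s + 8 * l * t) ≤ q) : False := by
  have h1 : 0 ≤ K * (K * s ^ 2 - k * s + 4 * l) := by
    nlinarith only [sq_nonneg (2 * K * s - k), hk]
  have h2 := nonneg_of_mul_nonneg_right h1 hK
  have h3 : l ≤ l * t := le_mul_of_one_le_right hl.le ht
  have h4 : 4 * l ≤ K * s ^ 2 - k * s + 8 * l * t := by linarith only [h2, h3]
  have h5 := mul_le_mul ha h4 (by linarith only [hl]) (by linarith only [ha])
  linarith only [h5, h, hq]

set_option maxHeartbeats 1000000 in
/-- A paraboloid touching `u - φ` from below at a negative value, at a running minimum in time,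
does so at a time less than `1`, and there `u` is bounded and the vertex map is controlled. -/
theorem contact_facts {l L N K ε : ℝ} (hl : 0 < l) (hlL : l ≤ L) (hK : 0 ≤ K)
    (hN : 2 ≤ N * Real.exp (-K * 5)) (hN0 : 0 < N)
    (hKk : (2 + 4 * (L * Module.finrank ℝ E) + 8 * l) ^ 2 ≤ 16 * l * K) (hε : 0 < ε)
    (hεL : ε * (L * Module.finrank ℝ E) < 8 * l) {u : E × ℝ → ℝ}
    (hu : PosSol l L u (Metric.closedBall 0 3 ×ˢ Icc 0 5)) {x y : E} {t : ℝ}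
    (hx : ‖x‖ ≤ 3) (ht0 : 0 < t) (ht5 : t ≤ 5)
    (hneg : u (x, t) - abpBarrier N K x t + ε / 2 * ‖x - y‖ ^ 2 < 0)
    (hsp : ∀ z : E, ‖z‖ ≤ 3 → u (x, t) - abpBarrier N K x t + ε / 2 * ‖x - y‖ ^ 2
      ≤ u (z, t) - abpBarrier N K z t + ε / 2 * ‖z - y‖ ^ 2)
    (htm : ∀ s, 0 ≤ s → s ≤ t → u (x, t) - abpBarrier N K x t ≤ u (x, s) - abpBarrier N K x s) :
    ‖x‖ ≤ 1 ∧ t ≤ 1 ∧ u (x, t) ≤ N ∧ vertexMap N K ε u t x = y ∧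
      DifferentiableAt ℝ (vertexMap N K ε u t) x ∧
      ‖fderiv ℝ (vertexMap N K ε u t) x‖ ≤ (Module.finrank ℝ E) ^ 2 *
        |1 + ε⁻¹ * ((2 * N + L * Module.finrank ℝ E * (4 * N + ε)) / l + 4 * N)| ∧
      ∀ᶠ s in 𝓝[<] t, (u (x, s) - abpBarrier N K x s) - (u (x, t) - abpBarrier N K x t)
        ≤ (L * Module.finrank ℝ E * (4 * N + ε) + 2 * N + 1) * (t - s) := by
  set D : ℝ := ((Module.finrank ℝ E : ℕ) : ℝ) with hD
  have hD0 : 0 ≤ D := Nat.cast_nonneg _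
  have hL : 0 < L := hl.trans_le hlL
  have hmem : ∀ {z : E} {r : ℝ}, ‖z‖ ≤ 3 → 0 ≤ r → r ≤ 5 →
      (z, r) ∈ Metric.closedBall (0 : E) 3 ×ˢ Icc (0 : ℝ) 5 :=
    fun h1 h2 h3 => ⟨mem_closedBall_zero_iff.2 h1, h2, h3⟩
  have hu0 := hu.2.1 _ (hmem hx ht0.le ht5)
  have hsq : 0 ≤ ε / 2 * ‖x - y‖ ^ 2 := by positivity
  have hs : 0 < t - ‖x‖ ^ 2 := by
    by_contra hcon
    rw [abpBarrier_of_nonpos (not_lt.1 hcon)] at hneg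
    linarith
  set s := t - ‖x‖ ^ 2 with hsd
  set a := N * Real.exp (-K * t) with ha
  have ha0 : 0 < a := by positivity
  have haN : a ≤ N := by
    exact mul_le_of_le_one_right hN0.le (exp_neg_mul_le_one hK ht0.le)
  have hx3 : ‖x‖ < 3 := by
    have : ‖x‖ ^ 2 < 5 := by linarith only [hs, ht5, hsd]
    nlinarith only [norm_nonneg x, this]
  have hnear : ∀ᶠ z in 𝓝 x, ‖z‖ ≤ 3 := by
    filter_upwards [Metric.isOpen_ball.mem_nhds (mem_ball_zero_iff.2 hx3)] with z hz
    exact (mem_ball_zero_iff.1 hz).le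
  have hsol := hu.2.2 _ (hmem hx ht0.le ht5)
  have hdb := hasDerivAt_abpBarrier (N := N) (K := K) hs
  rw [← ha, ← hsd] at hdb
  have hleft : ∀ᶠ r in 𝓝[<] t, u (x, t) - abpBarrier N K x t ≤ u (x, r) - abpBarrier N K x r := by
    filter_upwards [Ioo_mem_nhdsLT ht0] with r hr
    exact htm r hr.1.le hr.2.le
  have hsd2 : ∀ e : E, ∀ᶠ h in 𝓝[>] (0 : ℝ),
      (a * (-4 * s * ‖e‖ ^ 2 + 8 * inner ℝ x e ^ 2) - ε * ‖e‖ ^ 2) * h ^ 2 ≤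
        (abpBarrier N K (x + h • e) t - ε / 2 * ‖x + h • e - y‖ ^ 2)
          + (abpBarrier N K (x - h • e) t - ε / 2 * ‖x - h • e - y‖ ^ 2)
          - 2 * (abpBarrier N K x t - ε / 2 * ‖x - y‖ ^ 2) := by
    intro e
    filter_upwards [secondDiff_abpBarrier (K := K) hN0.le hs e] with h hh
    rw [show x + h • e - y = (x - y) + h • e by abel,
      show x - h • e - y = (x - y) - h • e by abel, norm_add_smul_sq', norm_sub_smul_sq']
    rw [← ha, ← hsd] at hh
    linarith
  have ht1 : t < 1 := by
    by_contra hcon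
    have ht1 : 1 ≤ t := not_lt.1 hcon
    have ha2 : 2 ≤ a := by
      refine hN.trans (mul_le_mul_of_nonneg_left (Real.exp_le_exp.2 ?_) hN0.le)
      nlinarith only [hK, ht5]
    obtain ⟨S, m, -, hS, hm, -, hle⟩ := hsol.touch hl.le
      (φ := fun z r => abpBarrier N K z r - ε / 2 * ‖z - y‖ ^ 2)
      (τ := a * (-K * s ^ 2 + 2 * s)) (α := -4 * a * s - ε) (β := 8 * a) (w := x)
      (by
        filter_upwards [hleft] with r hr
        linarith)
      (by
        filter_upwards [hnear] with z hz
        linarith [hsp z hz])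
      (hdb.sub_const _)
      (by
        intro e he
        filter_upwards [hsd2 e] with h hh
        rw [he] at hh
        linarith)
    have hz : ‖x‖ ^ 2 = t - s := by rw [hsd]; ring
    rw [hz] at hm
    have h1 : (4 * a * s + ε) * S ≤ (4 * a * s + ε) * (L * D) :=
      mul_le_mul_of_nonneg_left hS (by positivity)
    have h2 : 8 * a * (l * (t - s)) ≤ 8 * a * m := mul_le_mul_of_nonneg_left hm (by positivity)
    have h3 : a * (K * s ^ 2 - (2 + 4 * (L * D) + 8 * l) * s + 8 * l * t) ≤ ε * (L * D) := by
      linarith only [h1, h2, hle]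
    have hK0 : 0 < K := by
      by_contra hcon
      have h0 : K = 0 := le_antisymm (not_lt.1 hcon) hK
      rw [h0, mul_zero] at hKk
      have : 0 < 2 + 4 * (L * D) + 8 * l := by positivity
      exact absurd hKk (not_le.2 (by positivity))
    exact contact_time_absurd ha2 ht1 hl hK0 hKk hεL h3
  have hx1 : ‖x‖ ≤ 1 := by
    have : ‖x‖ ^ 2 < 1 := by linarith only [hs, ht1, hsd]
    nlinarith only [norm_nonneg x, this]
  have hs1 : s ≤ 1 := by linarith only [sq_nonneg ‖x‖, hsd, ht1]
  obtain ⟨hC, b, μ, hμ, hd⟩ := hsol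
  simp only at hC hd
  have hmin : IsLocalMin (fun z => u (z, t) - abpBarrier N K z t + ε / 2 * ‖z - y‖ ^ 2) x := by
    filter_upwards [hnear] with z hz
    exact hsp z hz
  have hess_ge : ∀ e : E, a * (-4 * s * ‖e‖ ^ 2 + 8 * inner ℝ x e ^ 2) - ε * ‖e‖ ^ 2
      ≤ fderiv ℝ (fderiv ℝ (fun z => u (z, t))) x e e := by
    intro e
    refine le_fderiv_fderiv_of_secondDiff hC ?_
    have hT1 : Tendsto (fun h : ℝ => x + h • e) (𝓝[>] 0) (𝓝 x) := by
      have : Continuous fun h : ℝ => x + h • e := by fun_prop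
      simpa using (this.tendsto 0).mono_left nhdsWithin_le_nhds
    have hT2 : Tendsto (fun h : ℝ => x - h • e) (𝓝[>] 0) (𝓝 x) := by
      have : Continuous fun h : ℝ => x - h • e := by fun_prop
      simpa using (this.tendsto 0).mono_left nhdsWithin_le_nhds
    filter_upwards [hsd2 e, hT1.eventually hnear, hT2.eventually hnear] with h h1 h2 h3
    have h4 := hsp _ h2
    have h5 := hsp _ h3
    linarith
  have hφt : a * (-K * s ^ 2 + 2 * s) ≤ 2 * N := by
    have : a * (-K * s ^ 2 + 2 * s) ≤ a * 2 := by
      refine mul_le_mul_of_nonneg_left ?_ ha0.le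
      nlinarith [mul_nonneg hK (sq_nonneg s)]
    linarith
  have hq : ∀ k, -(4 * N + ε) ≤ hess u (x, t) (b k) := by
    intro k
    have h1 := hess_ge (b k)
    rw [b.orthonormal.1 k] at h1
    have h2 : 0 ≤ a * (8 * inner ℝ x (b k) ^ 2) := by positivity
    have h3 : a * s ≤ N * 1 := mul_le_mul haN hs1 hs.le hN0.le
    have : hess u (x, t) (b k) = fderiv ℝ (fderiv ℝ (fun z => u (z, t))) x (b k) (b k) := rfl
    linarith
  have hc0 : 0 ≤ 4 * N + ε := by positivity
  have hμS : ∑ k, μ k ≤ L * D := by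
    have : ∑ k, μ k ≤ ∑ k : Fin (Module.finrank ℝ E), L := Finset.sum_le_sum fun k _ => (hμ k).2
    simpa [hD, mul_comm] using this
  have hle := deriv_nonpos_of_left_min (hd.sub hdb) (by simpa using hleft)
  have hsumge : -(L * D * (4 * N + ε)) ≤ ∑ k, μ k * hess u (x, t) (b k) := by
    have h1 : ∑ k, μ k * (-(4 * N + ε)) ≤ ∑ k, μ k * hess u (x, t) (b k) :=
      Finset.sum_le_sum fun k _ => mul_le_mul_of_nonneg_left (hq k) (hl.le.trans (hμ k).1)
    rw [← Finset.sum_mul] at h1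
    nlinarith
  have hqle : ∀ k, hess u (x, t) (b k) ≤ (2 * N + L * D * (4 * N + ε)) / l := by
    intro k
    have h1 : μ k * (hess u (x, t) (b k) + (4 * N + ε))
        ≤ ∑ j, μ j * (hess u (x, t) (b j) + (4 * N + ε)) :=
      Finset.single_le_sum (f := fun j => μ j * (hess u (x, t) (b j) + (4 * N + ε)))
        (fun j _ => mul_nonneg (hl.le.trans (hμ j).1) (by linarith [hq j])) (Finset.mem_univ k)
    have h2 : ∑ j, μ j * (hess u (x, t) (b j) + (4 * N + ε))
        = ∑ j, μ j * hess u (x, t) (b j) + (∑ j, μ j) * (4 * N + ε) := by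
      rw [Finset.sum_mul, ← Finset.sum_add_distrib]
      exact Finset.sum_congr rfl fun j _ => by ring
    have h3 : (∑ j, μ j) * (4 * N + ε) ≤ L * D * (4 * N + ε) :=
      mul_le_mul_of_nonneg_right hμS hc0
    have h4 : l * (hess u (x, t) (b k) + (4 * N + ε)) ≤ μ k * (hess u (x, t) (b k) + (4 * N + ε)) :=
      mul_le_mul_of_nonneg_right (hμ k).1 (by linarith [hq k])
    rw [le_div_iff₀ hl]
    nlinarith
  obtain ⟨T, hT, hTi⟩ := hasFDerivAt_vertexMap (N := N) (K := K) (ε := ε) hC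
  simp only [← ha, ← hsd] at hTi
  refine ⟨hx1, ht1.le, ?_, ?_, hT.differentiableAt, ?_, ?_⟩
  · have h1 : abpBarrier N K x t ≤ N := by
      rw [abpBarrier_of_pos hs.le, ← hsd, ← ha]
      have : s ^ 2 ≤ 1 := pow_le_one₀ hs.le hs1
      nlinarith
    linarith
  · have h0 := (((hC.differentiableAt (by simp)).hasFDerivAt.sub
      (hasFDerivAt_abpBarrier (N := N) (K := K) hs)).add
      ((hasFDerivAt_norm_sq_sub x y).const_mul (ε / 2)))
    have h1 := hmin.hasFDerivAt_eq_zero h0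
    rw [← ha, ← hsd] at h1
    have h2 : (InnerProductSpace.toDual ℝ E).symm (fderiv ℝ (fun y => u (y, t)) x)
        = -((4 * a * s) • x) - ε • (x - y) := by
      refine ext_inner_right ℝ fun e => ?_
      have h3 := congrArg (fun F : E →L[ℝ] ℝ => F e) h1
      simp at h3
      simp [inner_sub_left, inner_smul_left]
      linarith
    rw [vertexMap, h2, ← ha, ← hsd, show -((4 * a * s) • x) - ε • (x - y) + (4 * a * s) • x
      = -(ε • (x - y)) by abel, smul_neg, smul_smul, inv_mul_cancel₀ hε.ne', one_smul]
    abel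
  · rw [hT.fderiv]
    have hsymm := hC.isSymmSndFDerivAt (by simp)
    refine norm_le_of_psd b ?_ ?_ ?_
    · intro e f
      rw [hTi, hTi, hsymm e f, real_inner_comm]
      ring
    · intro e
      have h1 := hess_ge e
      rw [hTi, real_inner_self_eq_norm_sq]
      have h2 : ε⁻¹ * (-ε * ‖e‖ ^ 2) ≤ ε⁻¹ * (fderiv ℝ (fderiv ℝ (fun z => u (z, t))) x e e
          + a * (4 * s * ‖e‖ ^ 2 - 8 * inner ℝ x e * inner ℝ x e)) :=
        mul_le_mul_of_nonneg_left (by linarith) (by positivity)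
      have h3 : ε⁻¹ * (-ε * ‖e‖ ^ 2) = -‖e‖ ^ 2 := by field_simp
      linarith
    · intro k
      have h1 := hqle k
      have h1' : fderiv ℝ (fderiv ℝ (fun z => u (z, t))) x (b k) (b k)
        ≤ (2 * N + L * D * (4 * N + ε)) / l := h1
      rw [hTi, real_inner_self_eq_norm_sq, b.orthonormal.1 k]
      have h3 : a * s ≤ N * 1 := mul_le_mul haN hs1 hs.le hN0.le
      have h4 : 0 ≤ a * (8 * inner ℝ x (b k) ^ 2) := by positivity
      have h5 : ε⁻¹ * (fderiv ℝ (fderiv ℝ (fun z => u (z, t))) x (b k) (b k)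
          + a * (4 * s * 1 ^ 2 - 8 * inner ℝ x (b k) * inner ℝ x (b k)))
          ≤ ε⁻¹ * ((2 * N + L * D * (4 * N + ε)) / l + 4 * N) :=
        mul_le_mul_of_nonneg_left (by linarith) (by positivity)
      linarith
  · have h1 := hd.sub hdb
    set c := ∑ k, μ k * hess u (x, t) (b k) - a * (-K * s ^ 2 + 2 * s) with hc
    have h2 := (hasDerivAt_iff_tendsto_slope.1 h1).mono_left
      (nhdsWithin_mono t (fun r (hr : r ∈ Iio t) => ne_of_lt hr))
    have h3 : -(L * D * (4 * N + ε) + 2 * N + 1) < c := by linarith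
    filter_upwards [h2.eventually (lt_mem_nhds h3), self_mem_nhdsWithin] with r hr hrt
    have hrt' : r - t < 0 := sub_neg.2 hrt
    rw [slope_def_field, lt_div_iff_of_neg hrt'] at hr
    simp only [Pi.sub_apply] at hr
    linarith

end KrylovSafonov

namespace KrylovSafonov

open Set Filter Topology MeasureTheory

variable {E : Type*} [NormedAddCommGroup E] [InnerProductSpace ℝ E] [FiniteDimensional ℝ E]

theorem exists_infConvolution {f : E × ℝ → ℝ} (hf : ContinuousOn f (Metric.closedBall 0 3 ×ˢ Icc 0 5))
    (ε : ℝ) : ∃ g : E × ℝ → ℝ, Continuous g ∧ ∀ y t, 0 ≤ t → t ≤ 5 →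
      (∀ x, ‖x‖ ≤ 3 → g (y, t) ≤ f (x, t) + ε / 2 * ‖x - y‖ ^ 2) ∧
      ∃ x, ‖x‖ ≤ 3 ∧ g (y, t) = f (x, t) + ε / 2 * ‖x - y‖ ^ 2 := by
  obtain ⟨U, hU⟩ := ContinuousMap.exists_restrict_eq
    (Metric.isClosed_closedBall.prod isClosed_Icc) ⟨_, hf.domRestrict⟩
  have hUe : ∀ x t, ‖x‖ ≤ 3 → 0 ≤ t → t ≤ 5 → U (x, t) = f (x, t) := by
    intro x t hx h0 h5
    exact congrArg (fun F => F ⟨(x, t), mem_closedBall_zero_iff.2 hx, h0, h5⟩) hU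
  have hc : Continuous ↿(fun (p : E × ℝ) (x : E) => U (x, p.2) + ε / 2 * ‖x - p.1‖ ^ 2 :
      E × ℝ → E → ℝ) := by
    have := U.continuous
    simp only [Function.HasUncurry.uncurry, id]
    fun_prop
  refine ⟨_, (isCompact_closedBall (0 : E) 3).continuous_sInf hc, fun y t h0 h5 => ?_⟩
  have hc' : ContinuousOn (fun x : E => U (x, t) + ε / 2 * ‖x - y‖ ^ 2) (Metric.closedBall 0 3) := by
    have := U.continuous
    fun_prop
  obtain ⟨x, hx, hxm⟩ := (isCompact_closedBall (0 : E) 3).exists_sInf_image_eq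
    ⟨0, by simp⟩ hc'
  refine ⟨fun z hz => ?_, x, mem_closedBall_zero_iff.1 hx, ?_⟩
  · rw [← hUe z t hz h0 h5]
    exact csInf_le ((isCompact_closedBall (0 : E) 3).image_of_continuousOn hc').bddBelow
      ⟨z, mem_closedBall_zero_iff.2 hz, rfl⟩
  · rw [← hUe x t (mem_closedBall_zero_iff.1 hx) h0 h5]
    exact hxm

/-- A continuous function that goes from nonnegative to at most `-1/2` takes all the values between
`-1/2` and `0` at running minima. -/
theorem subset_image_runningMin {g : ℝ → ℝ} (hg : Continuous g) (h0 : 0 ≤ g 0)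
    (h5 : g 5 ≤ -(1 / 2)) :
    Ioo (-(1 / 2)) 0 ⊆ g '' {t | (0 ≤ t ∧ t ≤ 5) ∧ g t < 0 ∧ ∀ r, 0 ≤ r → r ≤ t → g t ≤ g r} := by
  rintro c ⟨hc1, hc2⟩
  have hK : IsCompact (Icc (0 : ℝ) 5 ∩ g ⁻¹' {c}) :=
    isCompact_Icc.inter_right (isClosed_singleton.preimage hg)
  have hne : (Icc (0 : ℝ) 5 ∩ g ⁻¹' {c}).Nonempty := by
    obtain ⟨t, ht, htc⟩ := intermediate_value_Icc' (show (0 : ℝ) ≤ 5 by norm_num) hg.continuousOn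
      (show c ∈ Icc (g 5) (g 0) from ⟨by linarith, by linarith⟩)
    exact ⟨t, ht, htc⟩
  obtain ⟨t, ⟨ht, htc⟩, hmin⟩ := hK.exists_isLeast hne
  have htc' : g t = c := htc
  refine ⟨t, ⟨ht, by linarith, fun r hr0 hrt => ?_⟩, htc'⟩
  by_contra hlt
  push Not at hlt
  obtain ⟨r', hr', hrc⟩ := intermediate_value_Icc' hr0 hg.continuousOn
    (show c ∈ Icc (g r) (g 0) from ⟨by linarith, by linarith⟩)
  have h1 := hmin ⟨⟨hr'.1, hr'.2.trans (hrt.trans ht.2)⟩, hrc⟩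
  have : r = t := le_antisymm hrt (h1.trans hr'.2)
  rw [this] at hlt
  exact lt_irrefl _ hlt

variable [MeasurableSpace E] [BorelSpace E]

theorem measurableSet_sublevel {u : E × ℝ → ℝ} {K : Set (E × ℝ)} (hK : IsClosed K)
    (hu : ContinuousOn u K) (N : ℝ) : MeasurableSet {p | p ∈ K ∧ u p ≤ N} :=
  (hu.preimage_isClosed_of_isClosed hK isClosed_Iic).measurableSet

/-- **Measure estimate.** If a nonnegative solution is small at one point of the top, then it is
bounded on a fixed portion of the bottom cylinder. -/
theorem measure_estimate {l L : ℝ} (hl : 0 < l) (hlL : l ≤ L) :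
    ∃ N μ : ℝ, 0 < N ∧ 0 < μ ∧ ∀ u : E × ℝ → ℝ,
      PosSol l L u (Metric.closedBall 0 3 ×ˢ Icc 0 5) → ∀ x1 : E, ‖x1‖ ≤ 2 → u (x1, 5) ≤ 1 →
      ENNReal.ofReal μ * volume (Metric.closedBall (0 : E) 1) ≤
        volume {p : E × ℝ | p ∈ Metric.closedBall (0 : E) 1 ×ˢ Icc (0 : ℝ) 1 ∧ u p ≤ N} := by
  have hL : 0 < L := hl.trans_le hlL
  obtain ⟨D, hD⟩ : ∃ D : ℝ, D = ((Module.finrank ℝ E : ℕ) : ℝ) := ⟨_, rfl⟩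
  have hD0 : 0 ≤ D := hD ▸ Nat.cast_nonneg _
  set K : ℝ := (2 + 4 * (L * D) + 8 * l) ^ 2 / (16 * l) with hK
  have hK0 : 0 ≤ K := by positivity
  set N : ℝ := 2 * Real.exp (5 * K) with hN
  have hN0 : 0 < N := by positivity
  have hN2 : N * Real.exp (-K * 5) = 2 := by
    rw [hN, mul_assoc, ← Real.exp_add]
    ring_nf
    simp
  obtain ⟨ε, hε, hε9, hεL⟩ : ∃ ε : ℝ, 0 < ε ∧ ε ≤ 1 / 25 ∧ ε * (L * D) < 8 * l := by
    refine ⟨min (1 / 25) (l / (L * D + 1)), by positivity, min_le_left _ _, ?_⟩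
    have h1 : min (1 / 25) (l / (L * D + 1)) ≤ l / (L * D + 1) := min_le_right _ _
    have h2 : l / (L * D + 1) * (L * D) ≤ l := by
      rw [div_mul_eq_mul_div, div_le_iff₀ (by positivity)]
      linarith only [hl]
    have h3 := mul_le_mul_of_nonneg_right h1 (show 0 ≤ L * D by positivity)
    linarith
  set C1 : ℝ := L * D * (4 * N + ε) + 2 * N + 1 with hC1
  have hC1p : 0 < C1 := by positivity
  set C2 : ℝ := D ^ 2 * |1 + ε⁻¹ * ((2 * N + L * D * (4 * N + ε)) / l + 4 * N)| + 1 with hC2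
  have hC2p : 0 < C2 := by positivity
  refine ⟨N, (1 / 2) * C1⁻¹ * (C2 ^ Module.finrank ℝ E)⁻¹, hN0, by positivity, ?_⟩
  intro u hu x1 hx1 hux1
  set φ := abpBarrier (E := E) N K with hφ
  have hf : ContinuousOn (fun p : E × ℝ => u p - φ p.1 p.2) (Metric.closedBall 0 3 ×ˢ Icc 0 5) :=
    hu.1.sub (continuous_abpBarrier N K).continuousOn
  obtain ⟨g, hg, hgm⟩ := exists_infConvolution hf ε
  simp only at hgm
  have hg0 : ∀ y : E, 0 ≤ g (y, 0) := by
    intro y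
    obtain ⟨-, x, hx, hxe⟩ := hgm y 0 le_rfl (by norm_num)
    have h1 := hu.2.1 (x, 0) ⟨mem_closedBall_zero_iff.2 hx, by norm_num, by norm_num⟩
    have h2 : φ x 0 = 0 := abpBarrier_of_nonpos (by have := sq_nonneg ‖x‖; linarith)
    rw [hxe, h2]
    positivity
  have hg5 : ∀ y : E, ‖y‖ ≤ 1 → g (y, 5) ≤ -(1 / 2) := by
    intro y hy
    have h1 := (hgm y 5 (by norm_num) le_rfl).1 x1 (by linarith)
    have hsq : ‖x1‖ ^ 2 ≤ 4 := by nlinarith only [norm_nonneg x1, hx1]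
    have h2 : 2 ≤ φ x1 5 := by
      rw [hφ, abpBarrier_of_pos (by linarith), hN2]
      nlinarith only [hsq]
    have h3 : ‖x1 - y‖ ≤ 3 := (norm_sub_le _ _).trans (by linarith)
    have h4 : ‖x1 - y‖ ^ 2 ≤ 9 := by nlinarith only [norm_nonneg (x1 - y), h3]
    have h5 : ε / 2 * ‖x1 - y‖ ^ 2 ≤ (1 / 25) / 2 * 9 := by gcongr
    linarith
  -- contact data
  have hcontact : ∀ y : E, ∀ t, 0 ≤ t → t ≤ 5 → g (y, t) < 0 →
      (∀ r, 0 ≤ r → r ≤ t → g (y, t) ≤ g (y, r)) → t ≤ 1 ∧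
      (∃ x : E, (‖x‖ ≤ 1 ∧ u (x, t) ≤ N) ∧ vertexMap N K ε u t x = y ∧
        DifferentiableAt ℝ (vertexMap N K ε u t) x ∧ ‖fderiv ℝ (vertexMap N K ε u t) x‖ ≤ C2) ∧
      ∀ᶠ r in 𝓝[<] t, g (y, r) - g (y, t) ≤ C1 * (t - r) := by
    intro y t h0 h5 hneg hrun
    have h0' : 0 < t := by
      rcases h0.eq_or_lt with h | h
      · rw [← h] at hneg
        exact absurd hneg (not_lt.2 (hg0 y))
      · exact h
    obtain ⟨hle, x, hx, hxe⟩ := hgm y t h0 h5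
    obtain ⟨a1, a2, a3, a4, a5, a6, a7⟩ := contact_facts (y := y) hl hlL hK0 hN2.ge hN0
      (by rw [← hD, hK]; field_simp; rfl) hε (by rw [← hD]; exact hεL) hu hx h0' h5
      (by rw [← hxe]; exact hneg) (fun z hz => by rw [← hxe]; exact hle z hz)
      (fun s hs0 hst => by
        have h1 := hrun s hs0 hst
        have h2 := (hgm y s hs0 (hst.trans h5)).1 x hx
        rw [hxe] at h1
        linarith)
    rw [← hD] at a6 a7
    refine ⟨a2, ⟨x, ⟨a1, a3⟩, a4, a5, a6.trans (by rw [hC2]; linarith)⟩, ?_⟩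
    filter_upwards [a7, Ioo_mem_nhdsLT h0'] with r hr hr0
    have h2 := (hgm y r hr0.1.le (hr0.2.le.trans h5)).1 x hx
    rw [hxe]
    linarith
  -- the set of contact vertices
  set R : Set (E × ℝ) := {p | (‖p.1‖ ≤ 1 ∧ 0 ≤ p.2 ∧ p.2 ≤ 5) ∧ g p < 0 ∧
    ∀ θ ∈ Icc (0 : ℝ) 1, g p ≤ g (p.1, θ * p.2)} with hR
  have hRm : MeasurableSet R := by
    have h1 : IsClosed {p : E × ℝ | ‖p.1‖ ≤ 1 ∧ 0 ≤ p.2 ∧ p.2 ≤ 5} :=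
      (isClosed_le continuous_fst.norm continuous_const).inter
        ((isClosed_le continuous_const continuous_snd).inter
          (isClosed_le continuous_snd continuous_const))
    have h2 : IsOpen {p : E × ℝ | g p < 0} := isOpen_lt hg continuous_const
    have h3 : IsClosed {p : E × ℝ | ∀ θ ∈ Icc (0 : ℝ) 1, g p ≤ g (p.1, θ * p.2)} := by
      simp only [ofPred_forall]
      exact isClosed_iInter fun θ => isClosed_iInter fun _ => isClosed_le hg (by fun_prop)
    exact h1.measurableSet.inter (h2.measurableSet.inter h3.measurableSet)
  have hRrun : ∀ y t, (y, t) ∈ R → ∀ r, 0 ≤ r → r ≤ t → g (y, t) ≤ g (y, r) := by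
    rintro y t ⟨⟨-, h0, -⟩, hneg, hθ⟩ r hr hrt
    rcases h0.eq_or_lt with h | h
    · have : r = t := le_antisymm hrt (h.symm.le.trans hr)
      rw [this]
    · have := hθ (r / t) ⟨div_nonneg hr h0, (div_le_one h).2 hrt⟩
      simpa [div_mul_cancel₀ _ h.ne'] using this
  have hlow : ∀ y ∈ Metric.closedBall (0 : E) 1,
      ENNReal.ofReal (1 / 2 * C1⁻¹) ≤ volume (Prod.mk y ⁻¹' R) := by
    intro y hy
    rw [mem_closedBall_zero_iff] at hy
    have h1 := volume_image_runningMin_le (g := fun t => g (y, t)) (s := Prod.mk y ⁻¹' R)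
      hC1p.le (fun t ht => ht.1.2.1) (fun t ht => hRrun y t ht)
      (fun t ht => (hcontact y t ht.1.2.1 ht.1.2.2 ht.2.1 (hRrun y t ht)).2.2)
    have h2 : Ioo (-(1 / 2 : ℝ)) 0 ⊆ (fun t => g (y, t)) '' (Prod.mk y ⁻¹' R) := by
      refine (subset_image_runningMin (g := fun t => g (y, t)) (by fun_prop) (hg0 y)
        (hg5 y hy)).trans (image_mono ?_)
      rintro t ⟨⟨h0, h5⟩, hneg, hr⟩
      exact ⟨⟨hy, h0, h5⟩, hneg, fun θ hθ => hr _ (mul_nonneg hθ.1 h0)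
        (mul_le_of_le_one_left h0 hθ.2)⟩
    have h3 := (measure_mono h2).trans h1
    rw [Real.volume_Ioo] at h3
    rw [ENNReal.ofReal_mul (by norm_num), ENNReal.ofReal_inv_of_pos hC1p]
    refine ENNReal.div_le_of_le_mul' ?_
    simpa using h3
  have hslice : ∀ t, volume ((fun y => (y, t)) ⁻¹' R) ≤ ENNReal.ofReal (C2 ^ Module.finrank ℝ E) *
      volume ((fun y => (y, t)) ⁻¹'
        {p : E × ℝ | p ∈ Metric.closedBall (0 : E) 1 ×ˢ Icc (0 : ℝ) 1 ∧ u p ≤ N}) := by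
    intro t
    refine volume_le_of_image_bounded_deriv (F := vertexMap N K ε u t) hC2p.le ?_ ?_
    · refine measurable_prodMk_right (measurableSet_sublevel
        (Metric.isClosed_closedBall.prod isClosed_Icc) (hu.1.mono ?_) N)
      exact prod_mono (Metric.closedBall_subset_closedBall (by norm_num))
        (Icc_subset_Icc le_rfl (by norm_num))
    · intro y hy
      obtain ⟨h1, ⟨x, ⟨hx1, hx2⟩, hx3⟩, -⟩ :=
        hcontact y t hy.1.2.1 hy.1.2.2 hy.2.1 (hRrun y t hy)
      exact ⟨x, ⟨⟨mem_closedBall_zero_iff.2 hx1, hy.1.2.1, h1⟩, hx2⟩, hx3⟩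
  set G : Set (E × ℝ) := {p : E × ℝ | p ∈ Metric.closedBall (0 : E) 1 ×ˢ Icc (0 : ℝ) 1 ∧ u p ≤ N}
    with hG
  have hGm : MeasurableSet G := measurableSet_sublevel
    (Metric.isClosed_closedBall.prod isClosed_Icc) (hu.1.mono
      (prod_mono (Metric.closedBall_subset_closedBall (by norm_num))
        (Icc_subset_Icc le_rfl (by norm_num)))) N
  have hRlow : ENNReal.ofReal (1 / 2 * C1⁻¹) * volume (Metric.closedBall (0 : E) 1) ≤ volume R := by
    rw [Measure.volume_eq_prod, Measure.prod_apply hRm, ← setLIntegral_const]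
    refine (setLIntegral_mono' Metric.isClosed_closedBall.measurableSet hlow).trans ?_
    exact setLIntegral_le_lintegral _ _
  have hRup : volume R ≤ ENNReal.ofReal (C2 ^ Module.finrank ℝ E) * volume G := by
    rw [Measure.volume_eq_prod, Measure.prod_apply_symm hRm, Measure.prod_apply_symm hGm,
      ← lintegral_const_mul' _ _ ENNReal.ofReal_ne_top]
    exact lintegral_mono hslice
  have h := hRlow.trans hRup
  have hp : 0 < C2 ^ Module.finrank ℝ E := by positivity
  rw [mul_comm (1 / 2 * C1⁻¹), ENNReal.ofReal_mul (by positivity), ENNReal.ofReal_inv_of_pos hp,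
    mul_assoc]
  refine (ENNReal.inv_mul_le_iff (by simpa using hp) ENNReal.ofReal_ne_top).2 h

end KrylovSafonov

namespace KrylovSafonov

open Set Filter Topology MeasureTheory

theorem measure_le_of_forward_density {W G : Set ℝ} (hW : MeasurableSet W) (hG : MeasurableSet G)
    {κ : ℝ} (hκ : 0 < κ) (h : ∀ τ ∈ W, ∃ b > τ,
      volume (W ∩ Ico τ b) ≤ ENNReal.ofReal κ * volume (G ∩ Ico τ b)) :
    volume W ≤ ENNReal.ofReal κ * volume G := by
  by_cases hGt : volume G = ⊤
  · rw [hGt, ENNReal.mul_top (by simpa using hκ)]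
    exact le_top
  rw [hW.measure_eq_iSup_isCompact]
  refine iSup₂_le fun K hKW => iSup_le fun hK => ?_
  rcases K.eq_empty_or_nonempty with rfl | hne
  · simp
  have hfinG : ∀ s, volume (G ∩ s) ≠ ⊤ := fun s =>
    ne_top_of_le_ne_top hGt (measure_mono inter_subset_left)
  have hfinK : ∀ s, volume (K ∩ s) ≠ ⊤ := fun s =>
    ne_top_of_le_ne_top hK.measure_lt_top.ne (measure_mono inter_subset_left)
  set F : ℝ → ℝ := fun a => volume.real (K ∩ Ici a) with hF
  set H : ℝ → ℝ := fun a => volume.real (G ∩ Ici a) with hH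
  have hHanti : ∀ a b, a ≤ b → H b ≤ H a := fun a b hab =>
    measureReal_mono (inter_subset_inter_right _ (Ici_subset_Ici.2 hab)) (hfinG _)
  have hsplit : ∀ (S : Set ℝ) (a b : ℝ), a ≤ b → S ∩ Ici a = S ∩ Ico a b ∪ S ∩ Ici b := by
    intro S a b hab
    rw [← inter_union_distrib_left, Ico_union_Ici_eq_Ici hab]
  have key : ∀ ε > 0, volume.real K ≤ κ * volume.real G + ε := by
    intro ε hε
    by_contra hcon
    push Not at hcon
    set A : Set ℝ := {a | a ∈ K ∧ κ * H a + ε ≤ F a} with hA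
    obtain ⟨m, hmK, hm⟩ := hK.exists_isLeast hne
    have hmA : m ∈ A := by
      refine ⟨hmK, ?_⟩
      have h1 : F m = volume.real K := by
        rw [hF]
        simp only
        rw [inter_eq_self_of_subset_left (show K ⊆ Ici m from fun x hx => hm hx)]
      have h2 : H m ≤ volume.real G := measureReal_mono inter_subset_left hGt
      rw [h1]
      nlinarith
    have hAb : BddAbove A := hK.bddAbove.mono fun x hx => hx.1
    set a := sSup A with ha
    have haK : a ∈ K := by
      have h1 := csSup_mem_closure ⟨m, hmA⟩ hAb
      exact hK.isClosed.closure_subset_iff.2 (fun x hx => hx.1) h1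
    have haF : κ * H a + ε ≤ F a := by
      refine le_of_forall_pos_lt_add fun δ hδ => ?_
      obtain ⟨a', ha', hlt⟩ := exists_lt_of_lt_csSup ⟨m, hmA⟩ (show a - δ < sSup A by linarith)
      have hle : a' ≤ a := le_csSup hAb ha'
      have h1 : F a' ≤ (a - a') + F a := by
        have h2 : F a' ≤ volume.real (Ico a' a) + F a := by
          refine (measureReal_mono (s₂ := Ico a' a ∪ K ∩ Ici a) ?_ ?_).trans
            (measureReal_union_le _ _)
          · rw [hsplit K a' a hle]
            exact union_subset_union_left _ inter_subset_right
          · exact (measure_union_lt_top (by simp) (hfinK _).lt_top).ne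
        rwa [Real.volume_real_Ico_of_le hle] at h2
      have h3 := mul_le_mul_of_nonneg_left (hHanti a' a hle) hκ.le
      linarith [ha'.2]
    obtain ⟨b, hab, hb⟩ := h a (hKW haK)
    have hFb : F b < κ * H b + ε := by
      have hHb : 0 ≤ κ * H b := mul_nonneg hκ.le measureReal_nonneg
      rcases (K ∩ Ici b).eq_empty_or_nonempty with he | hne'
      · simp only [hF, he, measureReal_empty]
        linarith
      · obtain ⟨b', ⟨hb'K, hbb'⟩, hb'm⟩ := (hK.inter_right isClosed_Ici).exists_isLeast hne'
        have hbb : b ≤ b' := hbb'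
        have h1 : F b = F b' := by
          simp only [hF]
          congr 1
          exact Subset.antisymm (fun x hx => ⟨hx.1, hb'm hx⟩)
            (inter_subset_inter_right _ (Ici_subset_Ici.2 hbb))
        have h2 : b' ∉ A := fun hb'A => by
          have := le_csSup hAb hb'A
          linarith
        have h3 : F b' < κ * H b' + ε := by
          by_contra hc
          exact h2 ⟨hb'K, not_lt.1 hc⟩
        have h4 := mul_le_mul_of_nonneg_left (hHanti b b' hbb) hκ.le
        linarith
    have hb' : volume.real (K ∩ Ico a b) ≤ κ * volume.real (G ∩ Ico a b) := by
      have h1 : volume (K ∩ Ico a b) ≤ ENNReal.ofReal κ * volume (G ∩ Ico a b) :=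
        (measure_mono (inter_subset_inter_left _ hKW)).trans hb
      have h2 := ENNReal.toReal_mono (ENNReal.mul_ne_top ENNReal.ofReal_ne_top (hfinG _)) h1
      rwa [ENNReal.toReal_mul, ENNReal.toReal_ofReal hκ.le] at h2
    have h1 : F a ≤ volume.real (K ∩ Ico a b) + F b := by
      have := measureReal_union_le (μ := volume) (K ∩ Ico a b) (K ∩ Ici b)
      rwa [← hsplit K a b hab.le] at this
    have h2 : H a = volume.real (G ∩ Ico a b) + H b := by
      simp only [hH]
      rw [hsplit G a b hab.le]
      refine measureReal_union ?_ (hG.inter measurableSet_Ici) (hfinG _) (hfinG _)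
      exact disjoint_left.2 fun x hx hx' => absurd hx.2.2 (not_lt.2 hx'.2)
    rw [h2] at haF
    linarith
  have hfin := le_of_forall_pos_le_add key
  have h1 : volume K = ENNReal.ofReal (volume.real K) :=
    (ENNReal.ofReal_toReal hK.measure_lt_top.ne).symm
  have h2 : volume G = ENNReal.ofReal (volume.real G) := (ENNReal.ofReal_toReal hGt).symm
  rw [h1, h2, ← ENNReal.ofReal_mul hκ.le]
  exact ENNReal.ofReal_le_ofReal hfin

/-- The measure of a union of intervals is controlled by that of a union of long intervals lying
after them. -/
theorem volume_iUnion_le_forward {ι : Type*} (t ρ : ι → ℝ) (hρ : ∀ i, 0 < ρ i) {T : ℝ}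
    (hT : 6 < T) :
    volume (⋃ i, Ioo (t i - 2 * ρ i) (t i + 2 * ρ i)) ≤ ENNReal.ofReal (1 + (15 / 2) / (T - 6)) *
      volume (⋃ i, Ioo (t i + 11 / 2 * ρ i) (t i + (T - 1 / 2) * ρ i)) := by
  set O := ⋃ i, Ioo (t i - 2 * ρ i) (t i + 2 * ρ i) with hO
  set G := ⋃ i, Ioo (t i + 11 / 2 * ρ i) (t i + (T - 1 / 2) * ρ i) with hG
  have hOm : MeasurableSet O := (isOpen_iUnion fun i => isOpen_Ioo).measurableSet
  have hGm : MeasurableSet G := (isOpen_iUnion fun i => isOpen_Ioo).measurableSet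
  have hT' : 0 < T - 6 := by linarith
  have hκ : 0 < (15 / 2) / (T - 6) := by positivity
  have h1 : volume (O \ G) ≤ ENNReal.ofReal ((15 / 2) / (T - 6)) * volume G := by
    refine measure_le_of_forward_density (hOm.diff hGm) hGm hκ ?_
    rintro τ ⟨hτ, -⟩
    obtain ⟨i, hi⟩ := mem_iUnion.1 hτ
    have hri := hρ i
    have hb : t i + 11 / 2 * ρ i < t i + (T - 1 / 2) * ρ i := by nlinarith
    refine ⟨t i + (T - 1 / 2) * ρ i, by linarith [hi.2], ?_⟩
    have h2 : (O \ G) ∩ Ico τ (t i + (T - 1 / 2) * ρ i) ⊆ Icc τ (t i + 11 / 2 * ρ i) := by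
      rintro x ⟨⟨-, hxG⟩, hx⟩
      refine ⟨hx.1, ?_⟩
      by_contra hc
      exact hxG (mem_iUnion.2 ⟨i, not_le.1 hc, hx.2⟩)
    have h3 : Ioo (t i + 11 / 2 * ρ i) (t i + (T - 1 / 2) * ρ i) ⊆
        G ∩ Ico τ (t i + (T - 1 / 2) * ρ i) := fun x hx =>
      ⟨mem_iUnion.2 ⟨i, hx⟩, by linarith [hx.1, hi.2], hx.2⟩
    refine (measure_mono h2).trans (le_trans ?_ (mul_le_mul_right (measure_mono h3) _))
    rw [Real.volume_Icc, Real.volume_Ioo, ← ENNReal.ofReal_mul hκ.le]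
    refine ENNReal.ofReal_le_ofReal ?_
    have : 15 / 2 / (T - 6) * (t i + (T - 1 / 2) * ρ i - (t i + 11 / 2 * ρ i)) = 15 / 2 * ρ i := by
      field_simp
      ring
    rw [this]
    linarith [hi.1]
  calc volume O ≤ volume (G ∪ O \ G) := measure_mono (by rw [union_sdiff_self]; exact subset_union_right)
    _ ≤ volume G + volume (O \ G) := measure_union_le _ _
    _ ≤ volume G + ENNReal.ofReal ((15 / 2) / (T - 6)) * volume G := by gcongr
    _ = _ := by rw [ENNReal.ofReal_add one_pos.le hκ.le, ENNReal.ofReal_one, add_mul, one_mul]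

variable {E : Type*} [NormedAddCommGroup E] [InnerProductSpace ℝ E] [FiniteDimensional ℝ E]

/-- The open parabolic cylinder of radius `r` centred at `P`. -/
def cyl (P : E × ℝ) (r : ℝ) : Set (E × ℝ) :=
  Metric.ball P.1 r ×ˢ Ioo (P.2 - r ^ 2 / 2) (P.2 + r ^ 2 / 2)

theorem isOpen_cyl (P : E × ℝ) (r : ℝ) : IsOpen (cyl P r) := Metric.isOpen_ball.prod isOpen_Ioo

theorem self_mem_cyl (P : E × ℝ) {r : ℝ} (hr : 0 < r) : P ∈ cyl P r := by
  have : 0 < r ^ 2 := by positivity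
  exact ⟨Metric.mem_ball_self hr, by linarith, by linarith⟩

theorem cyl_subset_of_inter {P Q : E × ℝ} {a b : ℝ} (ha : 0 < a) (h : (cyl P a ∩ cyl Q b).Nonempty)
    (hab : a ≤ 2 * b) : cyl P a ⊆ cyl Q (5 * b) := by
  obtain ⟨⟨z, τ⟩, ⟨hz1, hτ1⟩, hz2, hτ2⟩ := h
  have hb : 0 < b := by linarith
  have hab2 : a ^ 2 ≤ 4 * b ^ 2 := by nlinarith
  have hb2 : 0 < b ^ 2 := by positivity
  rintro ⟨x, t⟩ ⟨hx, ht⟩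
  simp only [Metric.mem_ball, mem_Ioo] at hz1 hz2 hτ1 hτ2 hx ht
  refine ⟨?_, ?_, ?_⟩
  · rw [Metric.mem_ball]
    have h1 := dist_triangle4 x P.1 z Q.1
    rw [dist_comm P.1 z] at h1
    linarith
  · change Q.2 - (5 * b) ^ 2 / 2 < t
    nlinarith
  · change t < Q.2 + (5 * b) ^ 2 / 2
    nlinarith

variable [MeasurableSpace E] [BorelSpace E]

theorem volume_cyl (P : E × ℝ) {r : ℝ} (hr : 0 < r) : volume (cyl P r) =
    ENNReal.ofReal (r ^ (Module.finrank ℝ E + 2)) * volume (Metric.ball (0 : E) 1) := by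
  rw [cyl, Measure.volume_eq_prod, Measure.prod_prod, Measure.addHaar_ball_of_pos _ _ hr,
    Real.volume_Ioo, pow_add, ENNReal.ofReal_mul (by positivity)]
  rw [show P.2 + r ^ 2 / 2 - (P.2 - r ^ 2 / 2) = r ^ 2 by ring]
  ring

theorem volume_cyl_five (P : E × ℝ) {r : ℝ} (hr : 0 < r) : volume (cyl P (5 * r)) =
    ENNReal.ofReal (5 ^ (Module.finrank ℝ E + 2)) * volume (cyl P r) := by
  rw [volume_cyl P hr, volume_cyl P (by positivity), mul_pow, ENNReal.ofReal_mul (by positivity),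
    mul_assoc]

theorem volume_union_cyl_diff_ge {S : Set (E × ℝ)} (r : E × ℝ → ℝ) {r0 μ : ℝ}
    (hr : ∀ P ∈ S, 0 < r P ∧ r P ≤ r0)
    (hd : ∀ P ∈ S, ENNReal.ofReal μ * volume (cyl P (r P)) ≤ volume (cyl P (r P) \ S))
    (hS : MeasurableSet S) (hμ : 0 ≤ μ) :
    ENNReal.ofReal (μ / 5 ^ (Module.finrank ℝ E + 2)) * volume (⋃ P : S, cyl P.1 (r P.1)) ≤
      volume ((⋃ P : S, cyl P.1 (r P.1)) \ S) := by
  obtain ⟨V, hVS, hVd, hV⟩ := Vitali.exists_disjoint_subfamily_covering_enlargement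
    (fun P : E × ℝ => cyl P (r P)) S r 2 (by norm_num) (fun P hP => (hr P hP).1.le) r0
    (fun P hP => (hr P hP).2) (fun P hP => ⟨P, self_mem_cyl P (hr P hP).1⟩)
  have hVc : V.Countable := hVd.countable_of_isOpen (fun P _ => isOpen_cyl P _)
    (fun P hP => ⟨P, self_mem_cyl P (hr P (hVS hP)).1⟩)
  have hp : (0 : ℝ) < 5 ^ (Module.finrank ℝ E + 2) := by positivity
  have h1 : volume (⋃ P : S, cyl P.1 (r P.1)) ≤
      ENNReal.ofReal (5 ^ (Module.finrank ℝ E + 2)) * ∑' P : V, volume (cyl P.1 (r P.1)) := by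
    have hsub : (⋃ P : S, cyl P.1 (r P.1)) ⊆ ⋃ P ∈ V, cyl P (5 * r P) := by
      refine iUnion_subset fun ⟨P, hP⟩ => ?_
      obtain ⟨Q, hQ, hPQ, hle⟩ := hV P hP
      exact (cyl_subset_of_inter (hr P hP).1 hPQ hle).trans
        (subset_biUnion_of_mem (u := fun P => cyl P (5 * r P)) hQ)
    refine (measure_mono hsub).trans ((measure_biUnion_le _ hVc _).trans ?_)
    rw [← ENNReal.tsum_mul_left]
    exact ENNReal.tsum_le_tsum fun P => (volume_cyl_five P.1 (hr P (hVS P.2)).1).le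
  have h2 : ENNReal.ofReal μ * ∑' P : V, volume (cyl P.1 (r P.1)) ≤
      volume ((⋃ P : S, cyl P.1 (r P.1)) \ S) := by
    rw [← ENNReal.tsum_mul_left]
    refine (ENNReal.tsum_le_tsum fun P : V => hd P (hVS P.2)).trans ?_
    rw [← measure_biUnion hVc (f := fun P => cyl P (r P) \ S)]
    · refine measure_mono (iUnion₂_subset fun P hP => sdiff_subset_sdiff_left ?_)
      exact subset_iUnion (fun P : S => cyl P.1 (r P.1)) ⟨P, hVS hP⟩
    · exact hVd.mono_on fun P _ => sdiff_subset
    · exact fun P _ => (isOpen_cyl P _).measurableSet.diff hS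
  refine le_trans ?_ h2
  refine (mul_le_mul_right h1 _).trans ?_
  rw [← mul_assoc, ← ENNReal.ofReal_mul (by positivity), div_mul_cancel₀ _ hp.ne']

/-- **Ink spots.** -/
theorem ink_spots {S : Set (E × ℝ)} (hS : MeasurableSet S) (r : E × ℝ → ℝ) {r0 μ T : ℝ}
    (hr : ∀ P ∈ S, 0 < r P ∧ r P ≤ r0) (hT : 6 < T) (hμ : 0 ≤ μ)
    (hμ1 : μ ≤ 1)
    (hd : ∀ P ∈ S, ENNReal.ofReal μ * volume (cyl P (2 * r P)) ≤ volume (cyl P (2 * r P) \ S))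
    (hfin : volume (⋃ P : S, cyl P.1 (2 * r P.1)) ≠ ⊤) :
    volume S ≤ ENNReal.ofReal ((1 - μ / 5 ^ (Module.finrank ℝ E + 2)) * (1 + (15 / 2) / (T - 6))) *
      volume (⋃ P : S, Metric.ball P.1.1 (2 * r P.1) ×ˢ
        Ioo (P.1.2 + 11 / 2 * r P.1 ^ 2) (P.1.2 + (T - 1 / 2) * r P.1 ^ 2)) := by
  set O := ⋃ P : S, cyl P.1 (2 * r P.1) with hO
  set G := ⋃ P : S, Metric.ball P.1.1 (2 * r P.1) ×ˢ
        Ioo (P.1.2 + 11 / 2 * r P.1 ^ 2) (P.1.2 + (T - 1 / 2) * r P.1 ^ 2) with hG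
  have hOm : MeasurableSet O := (isOpen_iUnion fun P => isOpen_cyl _ _).measurableSet
  have hGm : MeasurableSet G :=
    (isOpen_iUnion fun P => Metric.isOpen_ball.prod isOpen_Ioo).measurableSet
  have hSO : S ⊆ O := fun P hP => mem_iUnion.2 ⟨⟨P, hP⟩, self_mem_cyl P (by linarith [(hr P hP).1])⟩
  set c := μ / 5 ^ (Module.finrank ℝ E + 2) with hc
  have hc1 : c ≤ 1 := div_le_one_of_le₀ (hμ1.trans (one_le_pow₀ (by norm_num))) (by positivity)
  have hc0 : 0 ≤ c := by positivity
  have h1 : ENNReal.ofReal c * volume O ≤ volume (O \ S) :=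
    volume_union_cyl_diff_ge (fun P => 2 * r P) (r0 := 2 * r0)
      (fun P hP => ⟨by linarith [(hr P hP).1], by linarith [(hr P hP).2]⟩) hd hS hμ
  have h2 : volume S ≤ ENNReal.ofReal (1 - c) * volume O := by
    have h3 := measure_inter_add_sdiff (μ := volume) O hS
    rw [inter_eq_self_of_subset_right hSO] at h3
    have h4 : volume O = ENNReal.ofReal (1 - c) * volume O + ENNReal.ofReal c * volume O := by
      rw [← add_mul, ← ENNReal.ofReal_add (by linarith) hc0, sub_add_cancel, ENNReal.ofReal_one,
        one_mul]
    have h5 : ENNReal.ofReal c * volume O ≠ ⊤ := ENNReal.mul_ne_top ENNReal.ofReal_ne_top hfin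
    refine (ENNReal.add_le_add_iff_right h5).1 ?_
    rw [← h4, ← h3]
    gcongr
    rw [h3]
    exact h1
  have h3 : volume O ≤ ENNReal.ofReal (1 + (15 / 2) / (T - 6)) * volume G := by
    rw [Measure.volume_eq_prod, Measure.prod_apply hOm, Measure.prod_apply hGm,
      ← lintegral_const_mul' _ _ ENNReal.ofReal_ne_top]
    refine lintegral_mono fun x => ?_
    have e1 : Prod.mk x ⁻¹' O = ⋃ P : {P : S // x ∈ Metric.ball P.1.1 (2 * r P.1)},
        Ioo (P.1.1.2 - 2 * r P.1.1 ^ 2) (P.1.1.2 + 2 * r P.1.1 ^ 2) := by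
      ext t
      simp only [hO, cyl, mem_preimage, mem_iUnion, mem_prod, mem_Ioo]
      have e : ∀ P, (2 * r P) ^ 2 / 2 = 2 * r P ^ 2 := fun P => by ring
      simp only [e]
      exact ⟨fun ⟨P, h1, h2⟩ => ⟨⟨P, h1⟩, h2⟩, fun ⟨⟨P, h1⟩, h2⟩ => ⟨P, h1, h2⟩⟩
    have e2 : Prod.mk x ⁻¹' G = ⋃ P : {P : S // x ∈ Metric.ball P.1.1 (2 * r P.1)},
        Ioo (P.1.1.2 + 11 / 2 * r P.1.1 ^ 2) (P.1.1.2 + (T - 1 / 2) * r P.1.1 ^ 2) := by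
      ext t
      simp only [hG, mem_preimage, mem_iUnion, mem_prod, mem_Ioo]
      exact ⟨fun ⟨P, h1, h2⟩ => ⟨⟨P, h1⟩, h2⟩, fun ⟨⟨P, h1⟩, h2⟩ => ⟨P, h1, h2⟩⟩
    simp only [e1, e2]
    exact volume_iUnion_le_forward _ _ (fun P => by have := (hr P.1.1 P.1.2).1; positivity) hT
  rw [ENNReal.ofReal_mul (by linarith), mul_assoc]
  exact h2.trans (by gcongr)

end KrylovSafonov

namespace KrylovSafonov

open Set Filter Topology MeasureTheory

variable {E : Type*} [NormedAddCommGroup E] [InnerProductSpace ℝ E] [FiniteDimensional ℝ E]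
  [MeasurableSpace E] [BorelSpace E]

theorem map_affine_volume (a : E) (b : ℝ) {r : ℝ} (hr : 0 < r) :
    Measure.map (fun p : E × ℝ => (a + r • p.1, b + r ^ 2 * p.2)) volume =
      ENNReal.ofReal (r ^ (Module.finrank ℝ E + 2))⁻¹ • (volume : Measure (E × ℝ)) := by
  have h1 : Measure.map (fun x : E => a + r • x) volume =
      ENNReal.ofReal (r ^ (Module.finrank ℝ E))⁻¹ • (volume : Measure E) := by
    have : (fun x : E => a + r • x) = (fun x => a + x) ∘ fun x => r • x := rfl
    rw [this, ← Measure.map_map (measurable_const_add a) (measurable_const_smul r),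
      Measure.map_addHaar_smul _ hr.ne', Measure.map_smul, map_add_left_eq_self,
      abs_of_pos (by positivity)]
  have h2 : Measure.map (fun x : ℝ => b + r ^ 2 * x) volume =
      ENNReal.ofReal (r ^ 2)⁻¹ • (volume : Measure ℝ) := by
    have : (fun x : ℝ => b + r ^ 2 * x) = (fun x => b + x) ∘ fun x => r ^ 2 * x := rfl
    rw [this, ← Measure.map_map (measurable_const_add b) (measurable_const_mul (r ^ 2)),
      Real.map_volume_mul_left (by positivity), Measure.map_smul, map_add_left_eq_self,
      abs_of_pos (by positivity)]
  have h3 : (fun p : E × ℝ => (a + r • p.1, b + r ^ 2 * p.2)) =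
      Prod.map (fun x : E => a + r • x) (fun x : ℝ => b + r ^ 2 * x) := rfl
  rw [h3, Measure.volume_eq_prod, ← Measure.map_prod_map _ _ (by fun_prop) (by fun_prop), h1, h2,
    Measure.prod_smul_left, Measure.prod_smul_right, smul_smul, pow_add, mul_inv,
    ENNReal.ofReal_mul (by positivity)]

theorem propagation {l L : ℝ} (hl : 0 < l) (hlL : l ≤ L) :
    ∃ μ : ℝ, 0 < μ ∧ μ ≤ 1 ∧ ∀ T : ℝ, 6 < T → ∃ M : ℝ, 1 ≤ M ∧
      ∀ (v : E × ℝ → ℝ) (P : E × ℝ) (r s : ℝ), 0 < r → 0 < s →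
      PosSol l L v (Metric.closedBall P.1 (T * r) ×ˢ
        Icc (P.2 - r ^ 2 / 2) (P.2 + (T - 1 / 2) * r ^ 2)) →
      volume {p | p ∈ cyl P r ∧ v p ≤ M * s} < ENNReal.ofReal μ * volume (cyl P r) →
      ∀ x t, ‖x - P.1‖ ≤ 2 * r → P.2 + 11 / 2 * r ^ 2 ≤ t → t ≤ P.2 + (T - 1 / 2) * r ^ 2 →
        s < v (x, t) := by
  obtain ⟨N, μ, hN, hμ, hest⟩ := measure_estimate (E := E) hl hlL
  obtain ⟨α, hα⟩ := expansion (E := E) (l := l) (L := L) (B := 4) hl (by norm_num)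
  refine ⟨min μ 1, lt_min hμ one_pos, min_le_right _ _, fun T hT => ?_⟩
  have hT0 : 0 < T := by linarith
  set κ : ℝ := 8 * T ^ α with hκ
  have hκ0 : 0 < κ := by positivity
  refine ⟨max 1 (N * κ), le_max_left _ _, ?_⟩
  intro v P r s hr hs hv hvol x t hx ht1 ht2
  set w : E × ℝ → ℝ := fun q => v (P.1 + r • q.1, (P.2 - r ^ 2 / 2) + r ^ 2 * q.2) with hw
  have hwp : PosSol l L w (Metric.closedBall 0 T ×ˢ Icc 0 T) := by
    refine hv.rescale ?_
    rintro ⟨y, σ⟩ ⟨hy, h1, h2⟩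
    simp only [mem_closedBall_zero_iff] at hy
    have hr2 : 0 < r ^ 2 := by positivity
    refine ⟨?_, ?_, ?_⟩
    · simp only [Metric.mem_closedBall, dist_eq_norm, add_sub_cancel_left, norm_smul,
        Real.norm_eq_abs, abs_of_pos hr]
      nlinarith
    · simp only at h1 ⊢; nlinarith
    · simp only at h2 ⊢; nlinarith
  have hkey : ∀ y : E, ‖y‖ ≤ 2 → κ * s < w (y, 5) := by
    intro y hy
    by_contra hcon
    push Not at hcon
    have hks : 0 < κ * s := by positivity
    have h1 : PosSol l L (fun q => (κ * s)⁻¹ * w q + 0) (Metric.closedBall 0 3 ×ˢ Icc 0 5) := by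
      have h0 := hwp.mono (s' := Metric.closedBall 0 3 ×ˢ Icc 0 5)
        (prod_mono (Metric.closedBall_subset_closedBall (by linarith))
          (Icc_subset_Icc le_rfl (by linarith)))
      refine h0.affine _ _ fun p hp => ?_
      have := h0.2.1 p hp
      positivity
    have h2 := hest _ h1 y hy (by
      rw [add_zero, inv_mul_le_iff₀ hks, mul_one]; exact hcon)
    have hsub : {p : E × ℝ | p ∈ Metric.closedBall (0 : E) 1 ×ˢ Icc (0 : ℝ) 1 ∧
        (κ * s)⁻¹ * w p + 0 ≤ N} ⊆
        (fun p : E × ℝ => (P.1 + r • p.1, (P.2 - r ^ 2 / 2) + r ^ 2 * p.2)) ⁻¹'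
          {p | p ∈ cyl P r ∧ v p ≤ max 1 (N * κ) * s} ∪
        ((Metric.sphere (0 : E) 1 ×ˢ (univ : Set ℝ)) ∪ ((univ : Set E) ×ˢ ({0, 1} : Set ℝ))) := by
      rintro ⟨z, σ⟩ ⟨⟨hz, h3, h4⟩, h5⟩
      simp only [mem_closedBall_zero_iff] at hz h3 h4
      rw [add_zero, inv_mul_le_iff₀ hks] at h5
      by_cases hz1 : ‖z‖ = 1
      · exact Or.inr (Or.inl ⟨by simpa using hz1, mem_univ _⟩)
      by_cases hs0 : σ = 0
      · exact Or.inr (Or.inr ⟨mem_univ _, by simp [hs0]⟩)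
      by_cases hs1 : σ = 1
      · exact Or.inr (Or.inr ⟨mem_univ _, by simp [hs1]⟩)
      have hz' := lt_of_le_of_ne hz hz1
      have h3' := lt_of_le_of_ne h3 (Ne.symm hs0)
      have h4' := lt_of_le_of_ne h4 hs1
      have hr2 : 0 < r ^ 2 := by positivity
      refine Or.inl ⟨⟨?_, ?_, ?_⟩, ?_⟩
      · simp only [Metric.mem_ball, dist_eq_norm, add_sub_cancel_left, norm_smul,
          Real.norm_eq_abs, abs_of_pos hr]
        nlinarith
      · simp only; nlinarith
      · simp only; nlinarith
      · refine h5.trans ?_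
        have := mul_le_mul_of_nonneg_right (le_max_right 1 (N * κ)) hs.le
        linarith
    have h3 := h2.trans (measure_mono hsub)
    have hnull : volume ((Metric.sphere (0 : E) 1 ×ˢ (univ : Set ℝ)) ∪
        ((univ : Set E) ×ˢ ({0, 1} : Set ℝ))) = 0 := by
      refine measure_union_null ?_ ?_
      · rw [Measure.volume_eq_prod, Measure.prod_prod,
          Measure.addHaar_sphere_of_ne_zero _ _ one_ne_zero, zero_mul]
      · rw [Measure.volume_eq_prod, Measure.prod_prod,
          (Set.toFinite ({0, 1} : Set ℝ)).measure_zero, mul_zero]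
    have h4 := h3.trans (measure_union_le _ _)
    rw [hnull, add_zero] at h4
    have h5 := h4.trans (Measure.le_map_apply (by fun_prop) _)
    rw [map_affine_volume _ _ hr] at h5
    rw [Measure.smul_apply, smul_eq_mul] at h5
    have hd : 0 < r ^ (Module.finrank ℝ E + 2) := by positivity
    have h6 : ENNReal.ofReal μ * volume (cyl P r) ≤
        volume {p | p ∈ cyl P r ∧ v p ≤ max 1 (N * κ) * s} := by
      rw [volume_cyl P hr]
      calc ENNReal.ofReal μ * (ENNReal.ofReal (r ^ (Module.finrank ℝ E + 2)) *
            volume (Metric.ball (0 : E) 1))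
          ≤ ENNReal.ofReal (r ^ (Module.finrank ℝ E + 2)) * (ENNReal.ofReal μ *
            volume (Metric.closedBall (0 : E) 1)) := by
            rw [mul_left_comm]
            gcongr
            exact Metric.ball_subset_closedBall
        _ ≤ ENNReal.ofReal (r ^ (Module.finrank ℝ E + 2)) *
            (ENNReal.ofReal (r ^ (Module.finrank ℝ E + 2))⁻¹ *
              volume {p | p ∈ cyl P r ∧ v p ≤ max 1 (N * κ) * s}) := by gcongr
        _ = _ := by
            rw [← mul_assoc, ← ENNReal.ofReal_mul hd.le, mul_inv_cancel₀ hd.ne',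
              ENNReal.ofReal_one, one_mul]
    refine absurd hvol (not_lt.2 (le_trans ?_ h6))
    gcongr
    exact min_le_left _ _
  have hexp := hα w 0 T 5 T 1 (κ * s) one_pos hT0.le (by positivity) (by nlinarith)
    (hwp.mono (prod_mono le_rfl (Icc_subset_Icc (by norm_num) le_rfl)))
    (fun y hy => (hkey y (by rw [sub_zero] at hy; nlinarith [norm_nonneg y])).le)
  set y : E := r⁻¹ • (x - P.1) with hy
  set σ : ℝ := (t - (P.2 - r ^ 2 / 2)) / r ^ 2 with hσ
  have hr2 : 0 < r ^ 2 := by positivity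
  have hy2 : ‖y‖ ≤ 2 := by
    rw [hy, norm_smul, norm_inv, Real.norm_eq_abs, abs_of_pos hr, inv_mul_le_iff₀ hr]; linarith
  have hσ6 : 6 ≤ σ := by rw [hσ, le_div_iff₀ hr2]; linarith
  have hσT : σ ≤ T := by rw [hσ, div_le_iff₀ hr2]; linarith
  have hval : w (y, σ) = v (x, t) := by
    simp only [hw, hy, hσ]
    congr 2
    · rw [smul_smul, mul_inv_cancel₀ hr.ne', one_smul, add_sub_cancel]
    · field_simp; ring
  have h1 := hexp y σ (by rw [sub_zero]; linarith) (by linarith) hσT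
  rw [hval, sub_zero] at h1
  refine lt_of_lt_of_le ?_ h1
  have hA : (1 / T) ^ α ≤ (1 / (1 + (σ - 5))) ^ α := by
    have : 0 < 1 + (σ - 5) := by linarith
    gcongr; linarith
  have hB : (1 / 2 : ℝ) ≤ max (1 - ‖y‖ ^ 2 / (4 * (1 + (σ - 5)))) 0 := by
    refine le_max_of_le_left ?_
    have : ‖y‖ ^ 2 / (4 * (1 + (σ - 5))) ≤ 1 / 2 := by
      rw [div_le_iff₀ (by linarith)]; nlinarith [norm_nonneg y]
    linarith
  have hB2 : (1 / 2 : ℝ) ^ 2 ≤ max (1 - ‖y‖ ^ 2 / (4 * (1 + (σ - 5)))) 0 ^ 2 := by gcongr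
  calc s < 8 * T ^ α * s * (1 / T) ^ α * (1 / 2) ^ 2 := by
        have : T ^ α * (1 / T) ^ α = 1 := by rw [← mul_pow, mul_one_div_cancel hT0.ne', one_pow]
        have e : 8 * T ^ α * s * (1 / T) ^ α * (1 / 2) ^ 2 = 2 * s * (T ^ α * (1 / T) ^ α) := by ring
        rw [e, this]; linarith
    _ ≤ _ := by
        have : 0 ≤ 1 / (1 + (σ - 5)) := one_div_nonneg.2 (by linarith)
        rw [← hκ]; gcongr


set_option maxHeartbeats 2000000 in
theorem growth_of_half_measure {l L : ℝ} (hl : 0 < l) (hlL : l ≤ L) :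
    ∃ c : ℝ, 0 < c ∧ ∀ v : E × ℝ → ℝ,
      PosSol l L v (Metric.closedBall 0 16 ×ˢ Icc (-1) 2) →
      volume (Metric.ball (0 : E) 1 ×ˢ Ioo (0 : ℝ) 1) ≤
        2 * volume {p : E × ℝ | p ∈ Metric.ball (0 : E) 1 ×ˢ Ioo (0 : ℝ) 1 ∧ 1 < v p} →
      ∀ x : E, ‖x‖ ≤ 1 → c ≤ v (x, 2) := by
  obtain ⟨μ, hμ, hμ1, hprop⟩ := propagation (E := E) hl hlL
  obtain ⟨α, hα⟩ := expansion (E := E) (l := l) (L := L) (B := 64) hl (by norm_num)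
  obtain ⟨d, hd⟩ : ∃ d : ℕ, d = Module.finrank ℝ E := ⟨_, rfl⟩
  obtain ⟨c0, hc0⟩ : ∃ z : ℝ, z = μ / 5 ^ (d + 2) := ⟨_, rfl⟩
  have hc0p : 0 < c0 := by rw [hc0]; positivity
  have hc01 : c0 ≤ 1 := by
    rw [hc0, div_le_one (by positivity)]
    exact hμ1.trans (one_le_pow₀ (by norm_num))
  obtain ⟨T, hT⟩ : ∃ z : ℝ, z = 6 + (15 / 2) / c0 := ⟨_, rfl⟩
  have hT6 : 6 < T := by rw [hT]; have : 0 < (15 / 2) / c0 := by positivity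
                         linarith
  have hfac : (1 - c0) * (1 + (15 / 2) / (T - 6)) = 1 - c0 ^ 2 := by
    have : T - 6 = (15 / 2) / c0 := by rw [hT]; ring
    rw [this]; field_simp; ring
  obtain ⟨M, hM1, hM⟩ := hprop T hT6
  have hM0 : 0 < M := by linarith
  obtain ⟨θ, hθ⟩ : ∃ z : ℝ, z = 1 - c0 ^ 2 := ⟨_, rfl⟩
  rw [← hθ] at hfac
  have hθ0 : 0 ≤ θ := by rw [hθ]; nlinarith
  have hθ1 : θ < 1 := by rw [hθ]; nlinarith
  obtain ⟨N, hN⟩ : ∃ N : ℕ, θ ^ N < 1 / (4 * (3 / 2) ^ (d + 1)) :=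
    exists_pow_lt_of_lt_one (by positivity) hθ1
  obtain ⟨r0, hr0⟩ : ∃ z : ℝ, z = 1 / (2 * T * (N + 1)) := ⟨_, rfl⟩
  have hr0p : 0 < r0 := by
    have : 0 < T := by linarith
    rw [hr0]; positivity
  have hTr : T * r0 * (N + 1) = 1 / 2 := by
    rw [hr0]; have : T ≠ 0 := by linarith
    have : (N : ℝ) + 1 ≠ 0 := by positivity
    field_simp
  have hN0 : (0 : ℝ) ≤ N := Nat.cast_nonneg _
  have hTrp : 0 < T * r0 := by have : 0 < T := by linarith
                               positivity
  have hTr2 : T * r0 ≤ 1 / 2 := by nlinarith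
  have hr12 : r0 ≤ 1 / 12 := by nlinarith
  obtain ⟨q, hq⟩ : ∃ z : ℝ, z = r0 ^ 2 / 16 := ⟨_, rfl⟩
  have hqp : 0 < q := by rw [hq]; positivity
  refine ⟨M⁻¹ ^ N * (q / (q + 2)) ^ α * (1 / 2) ^ 2, by positivity, ?_⟩
  intro v hv hhalf x hx
  obtain ⟨ρ, hρ⟩ : ∃ ρ : ℕ → ℝ, ρ = fun k : ℕ => 1 + (k : ℝ) * (T * r0) := ⟨_, rfl⟩
  set E' : ℕ → Set (E × ℝ) := fun k =>
    (Metric.ball (0 : E) (ρ k) ×ˢ Ioo (0 : ℝ) (ρ k)) ∩ v ⁻¹' (Ioi (M⁻¹ ^ k)) with hE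
  have hρle : ∀ k : ℕ, k ≤ N → ρ k ≤ 3 / 2 := by
    intro k hk
    have : (k : ℝ) ≤ N := by exact_mod_cast hk
    rw [hρ]; simp only; nlinarith only [this, hTr, hTrp]
  have hcv : ∀ k : ℕ, k ≤ N → ContinuousOn v (Metric.ball (0 : E) (ρ k) ×ˢ Ioo (0 : ℝ) (ρ k)) := by
    intro k hk
    have := hρle k hk
    exact hv.1.mono (prod_mono (Metric.ball_subset_closedBall.trans
      (Metric.closedBall_subset_closedBall (by linarith)))
      (fun z hz => ⟨by linarith [hz.1], by linarith [hz.2]⟩))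
  have hEo : ∀ k : ℕ, k ≤ N → IsOpen (E' k) := fun k hk =>
    (hcv k hk).isOpen_inter_preimage (Metric.isOpen_ball.prod isOpen_Ioo) isOpen_Ioi
  have hMpow : ∀ k : ℕ, 0 < M⁻¹ ^ k := fun k => by positivity
  have hPS : ∀ k : ℕ, k ≤ N → ∀ P ∈ E' k, ∀ r, 0 < r → r ≤ r0 →
      PosSol l L v (Metric.closedBall P.1 (T * r) ×ˢ
        Icc (P.2 - r ^ 2 / 2) (P.2 + (T - 1 / 2) * r ^ 2)) := by
    rintro k hk ⟨y, τ⟩ ⟨⟨hy, h1, h2⟩, -⟩ r hr hrr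
    have h3 := hρle k hk
    simp only [mem_ball_zero_iff] at hy h1 h2
    have hT0 : 0 < T := by linarith only [hT6]
    have h4 : T * r ≤ 1 / 2 := (mul_le_mul_of_nonneg_left hrr hT0.le).trans hTr2
    have h6 : r ^ 2 ≤ r := by nlinarith only [hr, hrr, hr12]
    have h5 : T * r ^ 2 ≤ 1 / 2 := (mul_le_mul_of_nonneg_left h6 hT0.le).trans h4
    have h7 : r ≤ 1 := by linarith only [hrr, hr12]
    refine hv.mono (prod_mono ?_ (Icc_subset_Icc ?_ ?_))
    · refine Metric.closedBall_subset_closedBall' ?_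
      rw [dist_zero_right]; linarith
    · simp only; linarith only [h6, h7, h1]
    · have := sq_nonneg r
      simp only; linarith only [h5, h2, h3, this]
  set good : ℕ → E × ℝ → ℝ → Prop := fun k P r =>
    volume {p | p ∈ cyl P r ∧ v p ≤ M⁻¹ ^ k} < ENNReal.ofReal μ * volume (cyl P r) with hgood
  have hvolpos : ∀ (P : E × ℝ) {r : ℝ}, 0 < r → 0 < volume (cyl P r) := fun P r hr =>
    (isOpen_cyl P r).measure_pos _ ⟨P, self_mem_cyl P hr⟩
  have hMk : ∀ k : ℕ, M * M⁻¹ ^ (k + 1) = M⁻¹ ^ k := fun k => by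
    rw [pow_succ]; field_simp
  have hgp : ∀ k : ℕ, k ≤ N → ∀ P ∈ E' k, ∀ r, 0 < r → r ≤ r0 → good k P r →
      ∀ x t, ‖x - P.1‖ ≤ 2 * r → P.2 + 11 / 2 * r ^ 2 ≤ t → t ≤ P.2 + (T - 1 / 2) * r ^ 2 →
        M⁻¹ ^ (k + 1) < v (x, t) := by
    intro k hk P hP r hr hrr hg
    refine hM v P r _ hr (hMpow _) (hPS k hk P hP r hr hrr) ?_
    rw [hMk]; exact hg
  have hsmall : ∀ k : ℕ, k ≤ N → ∀ P ∈ E' k, ∃ j : ℕ, good k P (r0 * (1 / 2) ^ j) := by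
    intro k hk P hP
    obtain ⟨ε, hε, hball⟩ := Metric.isOpen_iff.1 (hEo k hk) P hP
    obtain ⟨j, hj⟩ := exists_pow_lt_of_lt_one hε (by norm_num : (1 / 2 : ℝ) < 1)
    refine ⟨j, ?_⟩
    have hjp : (0 : ℝ) < (1 / 2) ^ j := by positivity
    have hj1 : (1 / 2 : ℝ) ^ j ≤ 1 := pow_le_one₀ (by norm_num) (by norm_num)
    have hrp : 0 < r0 * (1 / 2) ^ j := by positivity
    have hrlt : r0 * (1 / 2) ^ j < ε := by nlinarith only [hj, hr12, hr0p, hjp]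
    have hr1 : r0 * (1 / 2) ^ j ≤ 1 := by nlinarith only [hj1, hr12, hr0p, hjp]
    have hemp : {p | p ∈ cyl P (r0 * (1 / 2) ^ j) ∧ v p ≤ M⁻¹ ^ k} = ∅ := by
      ext ⟨y, τ⟩
      simp only [mem_ofPred_eq, mem_empty_iff_false, iff_false, not_and, not_le]
      rintro ⟨hy, h1, h2⟩
      simp only [Metric.mem_ball] at hy h1 h2
      have : (y, τ) ∈ E' k := by
        refine hball ?_
        rw [Metric.mem_ball, Prod.dist_eq, max_lt_iff, Real.dist_eq, abs_lt]
        have hsq : (r0 * (1 / 2) ^ j) ^ 2 ≤ r0 * (1 / 2) ^ j := by nlinarith only [hrp, hr1]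
        exact ⟨by linarith only [hy, hrlt], by simp only; linarith only [h1, hsq, hrp, hrlt],
          by simp only; linarith only [h2, hsq, hrp, hrlt]⟩
      exact this.2
    simp only [hgood, hemp, measure_empty]
    exact ENNReal.mul_pos (by simpa using hμ) (hvolpos P hrp).ne'
  by_cases hterm : ∃ k : ℕ, k < N ∧ ∃ P ∈ E' k, good k P r0
  · obtain ⟨k, hk, P, hP, hg⟩ := hterm
    have h1 := hgp k hk.le P hP r0 hr0p le_rfl hg
    obtain ⟨y, τ⟩ := P
    obtain ⟨⟨hy, hτ0, hτ1⟩, -⟩ := hP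
    have h3 := hρle k hk.le
    simp only [mem_ball_zero_iff] at hy hτ0 hτ1 h1
    have hr02 : r0 ^ 2 ≤ 1 / 144 := by nlinarith only [hr0p, hr12]
    have hr00 : 0 < r0 ^ 2 := by positivity
    have h4 := hα v y 14 (τ + 11 / 2 * r0 ^ 2) 2 q (M⁻¹ ^ (k + 1)) hqp (by norm_num) (hMpow _).le
      (by linarith only [hq, hr02, hr00, hτ0]) (hv.mono (prod_mono (Metric.closedBall_subset_closedBall' (by
        rw [dist_zero_right]; linarith)) (Icc_subset_Icc (by linarith only [hr00, hτ0]) le_rfl)))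
      (fun z hz => (h1 z _ (by
        refine abs_le_of_sq_le_sq' (a := ‖z - y‖) ?_ (by positivity) |>.2
        rw [hq] at hz; linarith) le_rfl (by nlinarith only [hT6, hr00])).le)
      x 2 (by
        have := norm_sub_le x y
        linarith) (by linarith only [hr02, hτ1, h3]) le_rfl
    refine le_trans ?_ h4
    have hA : M⁻¹ ^ N ≤ M⁻¹ ^ (k + 1) :=
      pow_le_pow_of_le_one (by positivity) (inv_le_one_of_one_le₀ hM1) hk
    have hs0 : 0 < q + (2 - (τ + 11 / 2 * r0 ^ 2)) := by linarith only [hr02, hτ1, h3, hqp]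
    have hs1 : q + (2 - (τ + 11 / 2 * r0 ^ 2)) ≤ q + 2 := by linarith only [hr00, hτ0]
    have hB : (q / (q + 2)) ^ α ≤ (q / (q + (2 - (τ + 11 / 2 * r0 ^ 2)))) ^ α := by
      gcongr
    have hC : (1 / 2 : ℝ) ≤
        max (1 - ‖x - y‖ ^ 2 / (64 * (q + (2 - (τ + 11 / 2 * r0 ^ 2))))) 0 := by
      refine le_max_of_le_left ?_
      have hxy : ‖x - y‖ ≤ 5 / 2 := by
        have := norm_sub_le x y
        linarith
      have : ‖x - y‖ ^ 2 / (64 * (q + (2 - (τ + 11 / 2 * r0 ^ 2)))) ≤ 1 / 2 := by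
        rw [div_le_iff₀ (by linarith only [hs0])]
        nlinarith only [norm_nonneg (x - y), hxy, hr02, hτ1, h3, hqp]
      linarith
    have hB0 : 0 ≤ q / (q + (2 - (τ + 11 / 2 * r0 ^ 2))) := by positivity
    gcongr
  · push Not at hterm
    exfalso
    have hstep : ∀ k : ℕ, k < N → volume (E' k) ≤ ENNReal.ofReal θ * volume (E' (k + 1)) := by
      intro k hk
      have hsm : ∀ P : E × ℝ, P ∈ E' k → ∃ j : ℕ, good k P (r0 * (1 / 2) ^ j) := hsmall k hk.le
      obtain ⟨r, hr⟩ : ∃ r : E × ℝ → ℝ, r = fun P =>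
        if h : P ∈ E' k then r0 * (1 / 2) ^ (Nat.find (hsm P h)) else 0 := ⟨_, rfl⟩
      have hrP : ∀ P ∈ E' k, 0 < r P ∧ r P ≤ r0 ∧ good k P (r P) ∧ ¬ good k P (2 * r P) := by
        intro P hP
        have hre : r P = r0 * (1 / 2) ^ (Nat.find (hsm P hP)) := by simp only [hr, hP, dif_pos]
        have hsp := Nat.find_spec (hsm P hP)
        have hmin := fun j => Nat.find_min (m := j) (hsm P hP)
        obtain ⟨j, hj⟩ : ∃ j, j = Nat.find (hsm P hP) := ⟨_, rfl⟩
        rw [← hj] at hre hsp hmin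
        rw [hre]
        refine ⟨by positivity, ?_, hsp, ?_⟩
        · have : (1 / 2 : ℝ) ^ j ≤ 1 := pow_le_one₀ (by norm_num) (by norm_num)
          exact mul_le_of_le_one_right hr0p.le this
        · rcases j with _ | j
          · exact absurd (by simpa using hsp) (hterm k hk P hP)
          · have h2 := hmin j (Nat.lt_succ_self j)
            have e : 2 * (r0 * (1 / 2) ^ (j + 1)) = r0 * (1 / 2) ^ j := by rw [pow_succ]; ring
            rw [e]; exact h2
      have hink := ink_spots (hEo k hk.le).measurableSet r (r0 := r0) (μ := μ) (T := T)
        (fun P hP => ⟨(hrP P hP).1, (hrP P hP).2.1⟩) hT6 hμ.le hμ1 ?_ ?_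
      · rw [← hd, ← hc0, hfac] at hink
        refine hink.trans ?_
        gcongr
        refine iUnion_subset ?_
        rintro ⟨⟨y, τ⟩, hP⟩ ⟨z, σ⟩ ⟨hz, h1, h2⟩
        obtain ⟨g1, g2, g3, -⟩ := hrP _ hP
        have hfin := hgp k hk.le _ hP _ g1 g2 g3
        simp only [Metric.mem_ball] at hz h1 h2 hfin
        rw [dist_eq_norm] at hz
        refine ⟨?_, hfin z σ hz.le h1.le h2.le⟩
        obtain ⟨⟨hy, hτ0, hτ1⟩, -⟩ := hP
        simp only [mem_ball_zero_iff] at hy hτ0 hτ1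
        obtain ⟨rr, hrr⟩ : ∃ rr, rr = r (y, τ) := ⟨_, rfl⟩
        rw [← hrr] at g1 g2 hz h1 h2
        have hρs : ρ (k + 1) = ρ k + T * r0 := by simp only [hρ]; push_cast; ring
        have hrr2 : rr ^ 2 ≤ r0 := by nlinarith only [g1, g2, hr12]
        have hTrr : T * rr ^ 2 ≤ T * r0 := by
          have : 0 < T := by linarith
          gcongr
        refine ⟨?_, ?_, ?_⟩
        · rw [mem_ball_zero_iff, hρs]
          have := norm_sub_norm_le z y
          simp only
          nlinarith only [this, hz, hy, g2, hr0p, hT6]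
        · simp only; nlinarith only [h1, hτ0, g1]
        · simp only [hρs]; nlinarith only [h2, hτ1, hTrr, g1]
      · intro P hP
        obtain ⟨g1, g2, -, g4⟩ := hrP P hP
        refine (not_lt.1 g4).trans (measure_mono ?_)
        rintro p ⟨hp1, hp2⟩
        exact ⟨hp1, fun hp => absurd hp.2 (not_lt.2 hp2)⟩
      · refine ne_top_of_le_ne_top
          ((isCompact_closedBall (0 : E × ℝ) 10).measure_lt_top (μ := volume)).ne (measure_mono ?_)
        refine iUnion_subset ?_
        rintro ⟨⟨y, τ⟩, hP⟩ ⟨z, σ⟩ ⟨hz, h1, h2⟩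
        simp only [Metric.mem_ball] at hz h1 h2
        obtain ⟨g1, g2, -, -⟩ := hrP _ hP
        obtain ⟨⟨hy, hτ0, hτ1⟩, -⟩ := hP
        have h3 := hρle k hk.le
        simp only [mem_ball_zero_iff] at hy hτ0 hτ1
        obtain ⟨rr, hrr⟩ : ∃ rr, rr = r (y, τ) := ⟨_, rfl⟩
        rw [← hrr] at g1 g2 hz h1 h2
        rw [mem_closedBall_zero_iff, Prod.norm_def, max_le_iff, Real.norm_eq_abs, abs_le]
        rw [dist_eq_norm] at hz
        have := norm_sub_norm_le z y
        have hrr2 : (2 * rr) ^ 2 ≤ 1 := by nlinarith only [g1, g2, hr12]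
        refine ⟨by simp only; linarith, by simp only; linarith only [h1, hτ0, hrr2],
          by simp only; linarith only [h2, hτ1, h3, hrr2]⟩
    have hiter : ∀ k : ℕ, k ≤ N → volume (E' 0) ≤ ENNReal.ofReal θ ^ k * volume (E' k) := by
      intro k
      induction k with
      | zero => intro _; simp
      | succ k ih =>
        intro hk
        refine (ih (by omega)).trans ?_
        rw [pow_succ, mul_assoc]
        gcongr
        exact hstep k (by omega)
    have hB : volume (Metric.ball (0 : E) 1 ×ˢ Ioo (0 : ℝ) 1) = volume (Metric.ball (0 : E) 1) := by
      rw [Measure.volume_eq_prod, Measure.prod_prod, Real.volume_Ioo]; simp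
    have hEN : volume (E' N) ≤ ENNReal.ofReal ((3 / 2) ^ (d + 1)) *
        volume (Metric.ball (0 : E) 1) := by
      refine (measure_mono (inter_subset_left.trans (Set.prod_mono (Metric.ball_subset_ball
        (hρle N le_rfl)) (Ioo_subset_Ioo le_rfl (hρle N le_rfl))))).trans ?_
      rw [Measure.volume_eq_prod, Measure.prod_prod, Measure.addHaar_ball_of_pos _ _ (by norm_num),
        Real.volume_Ioo, ← hd, pow_succ, ENNReal.ofReal_mul (by positivity), sub_zero]
      apply le_of_eq; ring
    have hE0 : {p : E × ℝ | p ∈ Metric.ball (0 : E) 1 ×ˢ Ioo (0 : ℝ) 1 ∧ 1 < v p} = E' 0 := by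
      simp only [hE, hρ, Nat.cast_zero, zero_mul, add_zero, pow_zero]; rfl
    rw [hE0, hB] at hhalf
    have hb0 : volume (Metric.ball (0 : E) 1) ≠ 0 := (Metric.measure_ball_pos _ _ one_pos).ne'
    have hbt : volume (Metric.ball (0 : E) 1) ≠ ⊤ := measure_ball_lt_top.ne
    have h5 : volume (Metric.ball (0 : E) 1) ≤
        ENNReal.ofReal (1 / 2) * volume (Metric.ball (0 : E) 1) := by
      calc volume (Metric.ball (0 : E) 1) ≤ 2 * volume (E' 0) := hhalf
        _ ≤ 2 * (ENNReal.ofReal θ ^ N * (ENNReal.ofReal ((3 / 2) ^ (d + 1)) *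
            volume (Metric.ball (0 : E) 1))) := by
            gcongr
            exact (hiter N le_rfl).trans (by gcongr)
        _ = ENNReal.ofReal (2 * θ ^ N * (3 / 2) ^ (d + 1)) * volume (Metric.ball (0 : E) 1) := by
            rw [ENNReal.ofReal_mul (by positivity), ENNReal.ofReal_mul (by positivity),
              ENNReal.ofReal_pow hθ0, ENNReal.ofReal_ofNat]
            ring
        _ ≤ _ := by
            gcongr
            rw [lt_div_iff₀ (by positivity)] at hN
            linarith
    have h6 : ENNReal.ofReal (1 / 2) * volume (Metric.ball (0 : E) 1) <
        1 * volume (Metric.ball (0 : E) 1) := by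
      rw [ENNReal.mul_lt_mul_iff_left hb0 hbt]
      rw [ENNReal.ofReal_lt_one]; norm_num
    rw [one_mul] at h6
    exact absurd h5 (not_le.2 h6)

end KrylovSafonov

namespace KrylovSafonov

open Set Filter Topology MeasureTheory

variable {E : Type*} [NormedAddCommGroup E] [InnerProductSpace ℝ E] [FiniteDimensional ℝ E]

theorem lower_bound_of_almost_max {l L : ℝ} (hl : 0 < l) (hlL : l ≤ L) :
    ∃ c : ℝ, 0 < c ∧ ∀ (u : E × ℝ → ℝ) (x0 : E) (t0 r : ℝ), 0 < r →
      PosSol l L u (Metric.closedBall x0 (16 * r) ×ˢ Icc (t0 - 3 * r ^ 2) t0) →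
      0 < u (x0, t0) →
      (∀ p ∈ Metric.closedBall x0 (16 * r) ×ˢ Icc (t0 - 3 * r ^ 2) t0,
        u p ≤ (1 + c) * u (x0, t0)) →
      ∀ x : E, ‖x - x0‖ ≤ r → c * u (x0, t0) ≤ u (x, t0) := by
  let : MeasurableSpace E := borel E
  have : BorelSpace E := ⟨rfl⟩
  obtain ⟨c, hc, hG⟩ := growth_of_half_measure (E := E) hl hlL
  refine ⟨c / 4, by positivity, ?_⟩
  intro u x0 t0 r hr hu hm hmax x hx
  obtain ⟨m, hmd⟩ : ∃ m, m = u (x0, t0) := ⟨_, rfl⟩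
  rw [← hmd] at hm hmax ⊢
  set w : E × ℝ → ℝ := fun q => u (x0 + r • q.1, (t0 - 2 * r ^ 2) + r ^ 2 * q.2) with hw
  have hmap : ∀ q ∈ Metric.closedBall (0 : E) 16 ×ˢ Icc (-1 : ℝ) 2,
      (x0 + r • q.1, (t0 - 2 * r ^ 2) + r ^ 2 * q.2) ∈
        Metric.closedBall x0 (16 * r) ×ˢ Icc (t0 - 3 * r ^ 2) t0 := by
    rintro ⟨y, σ⟩ ⟨hy, h1, h2⟩
    simp only [mem_closedBall_zero_iff] at hy h1 h2
    have hr2 : 0 < r ^ 2 := by positivity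
    refine ⟨?_, ?_, ?_⟩
    · simp only [Metric.mem_closedBall, dist_eq_norm, add_sub_cancel_left, norm_smul,
        Real.norm_eq_abs, abs_of_pos hr]
      nlinarith
    · simp only; nlinarith
    · simp only; nlinarith
  have hwp := hu.rescale (x0 := x0) (t0 := t0 - 2 * r ^ 2) (r := r) hmap
  have hm2 : 0 < m / 2 := by positivity
  have hA : PosSol l L (fun q => (m / 2)⁻¹ * w q + 0)
      (Metric.closedBall 0 16 ×ˢ Icc (-1) 2) := by
    refine hwp.affine _ _ fun p hp => ?_
    have := hwp.2.1 p hp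
    positivity
  have hB : PosSol l L (fun q => (-(m / 2)⁻¹) * w q + (m / 2)⁻¹ * ((1 + c / 4) * m))
      (Metric.closedBall 0 16 ×ˢ Icc (-1) 2) := by
    refine hwp.affine _ _ fun p hp => ?_
    have := hmax _ (hmap p hp)
    have h2 : w p ≤ (1 + c / 4) * m := this
    have h3 := mul_le_mul_of_nonneg_left h2 (inv_nonneg.2 hm2.le)
    linarith
  have hsub : Metric.ball (0 : E) 1 ×ˢ Ioo (0 : ℝ) 1 ⊆
      {p : E × ℝ | p ∈ Metric.ball (0 : E) 1 ×ˢ Ioo (0 : ℝ) 1 ∧ 1 < (m / 2)⁻¹ * w p + 0} ∪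
      {p : E × ℝ | p ∈ Metric.ball (0 : E) 1 ×ˢ Ioo (0 : ℝ) 1 ∧
        1 < (-(m / 2)⁻¹) * w p + (m / 2)⁻¹ * ((1 + c / 4) * m)} := by
    intro p hp
    by_cases h : 1 < (m / 2)⁻¹ * w p + 0
    · exact Or.inl ⟨hp, h⟩
    · refine Or.inr ⟨hp, ?_⟩
      have e : (m / 2)⁻¹ * ((1 + c / 4) * m) = 2 + c / 2 := by field_simp; ring
      rw [e]; linarith
  have hvol := (measure_mono hsub (μ := volume)).trans (measure_union_le _ _)
  have hcase : ∀ a b e : ENNReal, a ≤ b + e → a ≤ 2 * b ∨ a ≤ 2 * e := by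
    intro a b e h
    rcases le_total b e with hbe | hbe
    · exact Or.inr (h.trans (by rw [two_mul]; gcongr))
    · exact Or.inl (h.trans (by rw [two_mul]; gcongr))
  rcases hcase _ _ _ hvol with h | h
  · have h2 := hG _ hA h (r⁻¹ • (x - x0)) (by
      rw [norm_smul, norm_inv, Real.norm_eq_abs, abs_of_pos hr, inv_mul_le_iff₀ hr]; linarith)
    have e : w (r⁻¹ • (x - x0), 2) = u (x, t0) := by
      simp only [hw]
      congr 2
      · rw [smul_smul, mul_inv_cancel₀ hr.ne', one_smul, add_sub_cancel]
      · ring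
    rw [e, add_zero, ← div_eq_inv_mul, le_div_iff₀ hm2] at h2
    nlinarith
  · have h2 := hG _ hB h 0 (by simp)
    have e : w (0, 2) = m := by
      simp only [hw, hmd]
      congr 2
      · simp
      · ring
    rw [e] at h2
    have e2 : -(m / 2)⁻¹ * m + (m / 2)⁻¹ * ((1 + c / 4) * m) = c / 2 := by field_simp; ring
    rw [e2] at h2
    linarith

theorem harnack_unit {l L : ℝ} (hl : 0 < l) (hlL : l ≤ L) :
    ∃ C : ℝ, 1 ≤ C ∧ ∀ u : E × ℝ → ℝ,
      PosSol l L u (Metric.closedBall 0 6 ×ˢ Icc (-1) 1) →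
      ∀ x : E, ‖x‖ ≤ 1 → u (0, 0) ≤ C * u (x, 1) := by
  obtain ⟨c, hc, hmaxl⟩ := lower_bound_of_almost_max (E := E) hl hlL
  obtain ⟨α, hα⟩ := expansion (E := E) (l := l) (L := L) (B := 8) hl (by norm_num)
  obtain ⟨γ, hγ⟩ : ∃ γ : ℕ, γ = 2 * α + 2 := ⟨_, rfl⟩
  have hγ0 : (0 : ℝ) ≤ γ := Nat.cast_nonneg _
  obtain ⟨ε, hε⟩ : ∃ ε : ℝ, ε = c / (32 * (1 + c) * (γ + 1)) := ⟨_, rfl⟩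
  have hεp : 0 < ε := by rw [hε]; positivity
  have hεe : 32 * ε * ((1 + c) * (γ + 1)) = c := by
    rw [hε]; field_simp
  have hε1 : 32 * ε ≤ 1 := by
    have h1 : 1 + c ≤ (1 + c) * (γ + 1) := by nlinarith
    have h2 : 32 * ε * (1 + c) ≤ c := by
      have := mul_le_mul_of_nonneg_left h1 (by positivity : 0 ≤ 32 * ε)
      linarith
    nlinarith
  have hbern : 1 ≤ (1 + c) * (1 - 16 * ε) ^ γ := by
    have h1 := one_add_mul_le_pow (a := -(16 * ε)) (by linarith) γ
    have h2 : 1 - 16 * ε * γ ≤ (1 - 16 * ε) ^ γ := by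
      have e : 1 + -(16 * ε) = 1 - 16 * ε := by ring
      rw [e] at h1; linarith
    have h3 : 1 ≤ (1 + c) * (1 - 16 * ε * γ) := by
      have : 0 ≤ ε * (1 + c) := by positivity
      nlinarith
    exact h3.trans (by gcongr)
  have hcst : 0 < 4 * 24 ^ α / (c * ε ^ (2 * α)) := by positivity
  refine ⟨1 + 4 * 24 ^ α / (c * ε ^ (2 * α)), by linarith, ?_⟩
  intro u hu x hx
  have hux : 0 ≤ u (x, 1) := hu.2.1 _ ⟨by simpa using by linarith, by simp⟩
  rcases (hu.2.1 (0, 0) ⟨by simp, by simp⟩).eq_or_lt with h0 | h0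
  · rw [← h0]; positivity
  set δ : E × ℝ → ℝ := fun p => min (1 - ‖p.1‖) (1 + p.2) with hδ
  have hδc : Continuous δ := by fun_prop
  set K := Metric.closedBall (0 : E) 1 ×ˢ Icc (-1 : ℝ) 0 with hK
  have hKc : IsCompact K := (isCompact_closedBall _ _).prod isCompact_Icc
  have hKs : K ⊆ Metric.closedBall (0 : E) 6 ×ˢ Icc (-1 : ℝ) 1 :=
    prod_mono (Metric.closedBall_subset_closedBall (by norm_num)) (Icc_subset_Icc le_rfl (by norm_num))
  obtain ⟨⟨y, τ⟩, hyK, hmax⟩ := hKc.exists_isMaxOn (f := fun p => u p * δ p ^ γ)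
    ⟨(0, 0), by simp [hK]⟩ ((hu.1.mono hKs).mul (hδc.continuousOn.pow γ))
  obtain ⟨hy, hτ1, hτ0⟩ := hyK
  simp only [mem_closedBall_zero_iff] at hy hτ1 hτ0
  obtain ⟨d, hd⟩ : ∃ d, d = δ (y, τ) := ⟨_, rfl⟩
  have hd0' : 0 ≤ d := by rw [hd]; exact le_min (by simpa using hy) (by simp only; linarith)
  have hdy : d ≤ 1 - ‖y‖ := by rw [hd]; exact min_le_left _ _
  have hdτ : d ≤ 1 + τ := by rw [hd]; exact min_le_right _ _
  have hδ0 : δ ((0 : E), (0 : ℝ)) = 1 := by simp [hδ]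
  have hmax0 : u (0, 0) ≤ u (y, τ) * d ^ γ := by
    have := hmax (show ((0 : E), (0 : ℝ)) ∈ K by simp [hK])
    simpa [hδ0, ← hd] using this
  have hup : 0 ≤ u (y, τ) := hu.2.1 _ (hKs ⟨by simpa using hy, hτ1, hτ0⟩)
  have hd0 : 0 < d := by
    rcases hd0'.eq_or_lt with h | h
    · rw [← h, zero_pow (by omega), mul_zero] at hmax0; linarith
    · exact h
  have hd1 : d ≤ 1 := by linarith [norm_nonneg y]
  have hup' : 0 < u (y, τ) := by
    rcases hup.eq_or_lt with h | h
    · rw [← h, zero_mul] at hmax0; linarith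
    · exact h
  have hρ0 : 0 < ε * d := by positivity
  have hρd : 32 * (ε * d) ≤ d := by nlinarith
  have hsq : 3 * (ε * d) ^ 2 ≤ 16 * (ε * d) := by nlinarith
  have hlow := hmaxl u y τ (ε * d) hρ0 (hu.mono (Set.prod_mono (Metric.closedBall_subset_closedBall' (by
    rw [dist_zero_right]; linarith)) (Icc_subset_Icc (by linarith) (by linarith)))) hup' (by
    rintro ⟨z, σ⟩ ⟨hz, hσ1, hσ2⟩
    simp only [Metric.mem_closedBall, dist_eq_norm] at hz hσ1 hσ2
    have hzn : ‖z‖ ≤ ‖y‖ + 16 * (ε * d) := by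
      have := norm_sub_norm_le z y
      linarith
    have hδz : (1 - 16 * ε) * d ≤ δ (z, σ) := by
      refine le_min ?_ ?_
      · simp only; linarith
      · simp only; linarith
    have h1 : u (z, σ) * δ (z, σ) ^ γ ≤ u (y, τ) * d ^ γ := by
      have := hmax (show (z, σ) ∈ K from ⟨by rw [mem_closedBall_zero_iff]; simp only; linarith,
        by simp only; linarith, by simp only; linarith⟩)
      simpa [← hd] using this
    have huz : 0 ≤ u (z, σ) := hu.2.1 _ ⟨by rw [mem_closedBall_zero_iff]; simp only; linarith,
        by simp only; linarith, by simp only; linarith⟩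
    have h16 : 0 ≤ 1 - 16 * ε := by linarith
    have h2 : u (z, σ) * ((1 - 16 * ε) * d) ^ γ ≤ u (y, τ) * d ^ γ := by
      refine le_trans ?_ h1
      gcongr
    rw [mul_pow, ← mul_assoc] at h2
    have h3 : u (z, σ) * (1 - 16 * ε) ^ γ ≤ u (y, τ) := le_of_mul_le_mul_right h2 (by positivity)
    calc u (z, σ) ≤ u (z, σ) * ((1 + c) * (1 - 16 * ε) ^ γ) := le_mul_of_one_le_right huz hbern
      _ = (1 + c) * (u (z, σ) * (1 - 16 * ε) ^ γ) := by ring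
      _ ≤ _ := by gcongr)
  have hρ1 : (ε * d) ^ 2 ≤ 1 := by nlinarith
  have hexp := hα u y 5 τ 1 ((ε * d) ^ 2 / 8) (c * u (y, τ)) (by positivity) (by norm_num)
    (by positivity) (by linarith) (hu.mono (prod_mono (Metric.closedBall_subset_closedBall' (by
      rw [dist_zero_right]; linarith)) (Icc_subset_Icc hτ1 le_rfl)))
    (fun z hz => hlow z (by
      refine (abs_le_of_sq_le_sq' (a := ‖z - y‖) ?_ hρ0.le).2
      linarith)) x 1 (by
        have := norm_sub_le x y
        linarith) (by linarith) le_rfl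
  have hεd2 : 0 < (ε * d) ^ 2 := by positivity
  have hs0 : 0 < (ε * d) ^ 2 / 8 + (1 - τ) := by linarith only [hεd2, hτ0]
  have hB : ((ε * d) ^ 2 / 24) ^ α ≤ ((ε * d) ^ 2 / 8 / ((ε * d) ^ 2 / 8 + (1 - τ))) ^ α := by
    refine pow_le_pow_left₀ (by positivity) ?_ α
    rw [le_div_iff₀ hs0]
    nlinarith only [hεd2, hρ1, hτ1]
  have hC : (1 / 2 : ℝ) ≤ max (1 - ‖x - y‖ ^ 2 / (8 * ((ε * d) ^ 2 / 8 + (1 - τ)))) 0 := by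
    refine le_max_of_le_left ?_
    have hxy : ‖x - y‖ ≤ 2 := by
      have := norm_sub_le x y
      linarith
    have : ‖x - y‖ ^ 2 / (8 * ((ε * d) ^ 2 / 8 + (1 - τ))) ≤ 1 / 2 := by
      rw [div_le_iff₀ (by linarith)]
      nlinarith [norm_nonneg (x - y), sq_nonneg (ε * d)]
    linarith
  have hfin : c * u (y, τ) * ((ε * d) ^ 2 / 24) ^ α * (1 / 2) ^ 2 ≤ u (x, 1) := by
    refine le_trans ?_ hexp
    gcongr
  have hdγ : d ^ γ ≤ d ^ (2 * α) := pow_le_pow_of_le_one hd0.le hd1 (by omega)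
  have e : c * u (y, τ) * ((ε * d) ^ 2 / 24) ^ α * (1 / 2) ^ 2 =
      (u (y, τ) * d ^ (2 * α)) * (c * ε ^ (2 * α)) / (4 * 24 ^ α) := by
    rw [div_pow, ← pow_mul, mul_pow]; field_simp; ring
  rw [e, div_le_iff₀ (by positivity)] at hfin
  have h5 : u (0, 0) ≤ 4 * 24 ^ α / (c * ε ^ (2 * α)) * u (x, 1) := by
    rw [div_mul_eq_mul_div, le_div_iff₀ (by positivity)]
    have h6 : u (0, 0) ≤ u (y, τ) * d ^ (2 * α) := hmax0.trans (by gcongr)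
    calc u (0, 0) * (c * ε ^ (2 * α)) ≤ u (y, τ) * d ^ (2 * α) * (c * ε ^ (2 * α)) := by gcongr
      _ ≤ _ := by linarith
  linarith

theorem harnack {l L : ℝ} (hl : 0 < l) (hlL : l ≤ L) :
    ∃ C : ℝ, 1 ≤ C ∧ ∀ (u : E × ℝ → ℝ) (x0 : E) (t0 r : ℝ), 0 < r →
      PosSol l L u (Metric.closedBall x0 (6 * r) ×ˢ Icc (t0 - r ^ 2) (t0 + r ^ 2)) →
      ∀ x : E, ‖x - x0‖ ≤ r → u (x0, t0) ≤ C * u (x, t0 + r ^ 2) := by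
  obtain ⟨C, hC, h⟩ := harnack_unit (E := E) hl hlL
  refine ⟨C, hC, fun u x0 t0 r hr hu x hx => ?_⟩
  have hw := hu.rescale (x0 := x0) (t0 := t0) (r := r)
    (s' := Metric.closedBall 0 6 ×ˢ Icc (-1) 1) (by
    rintro ⟨y, σ⟩ ⟨hy, h1, h2⟩
    simp only [mem_closedBall_zero_iff] at hy h1 h2
    have hr2 : 0 < r ^ 2 := by positivity
    refine ⟨?_, ?_, ?_⟩
    · simp only [Metric.mem_closedBall, dist_eq_norm, add_sub_cancel_left, norm_smul,
        Real.norm_eq_abs, abs_of_pos hr]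
      nlinarith
    · simp only; nlinarith
    · simp only; nlinarith)
  have h2 := h _ hw (r⁻¹ • (x - x0)) (by
      rw [norm_smul, norm_inv, Real.norm_eq_abs, abs_of_pos hr, inv_mul_le_iff₀ hr]; linarith)
  simpa [smul_smul, mul_inv_cancel₀ hr.ne'] using h2

/-- Harnack inequality along a segment inside the domain. -/
theorem harnack_segment {l L : ℝ} (hl : 0 < l) (hlL : l ≤ L) {D τ0 : ℝ} (hτ0 : 0 < τ0) :
    ∃ C : ℝ, 1 ≤ C ∧ ∀ (u : E × ℝ → ℝ) (x y : E) (t s ρ : ℝ), 0 < ρ →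
      τ0 * ρ ^ 2 ≤ s - t → s - t ≤ D * ρ ^ 2 → ‖y - x‖ ≤ D * ρ →
      (∀ θ ∈ Icc (0 : ℝ) 1,
        PosSol l L u (Metric.closedBall (x + θ • (y - x)) ρ ×ˢ Icc (t - ρ ^ 2) s)) →
      u (x, t) ≤ C * u (y, s) := by
  obtain ⟨C, hC, h⟩ := harnack (E := E) hl hlL
  obtain ⟨N, hN⟩ := exists_nat_gt (max (36 * D) (D ^ 2 / τ0))
  have hN1 := (le_max_left _ _).trans_lt hN
  have hN2 := (le_max_right _ _).trans_lt hN
  refine ⟨C ^ N, one_le_pow₀ hC, fun u x y t s ρ hρ h1 h2 h3 hu => ?_⟩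
  have hst : 0 < s - t := lt_of_lt_of_le (by positivity) h1
  have hρ2 : 0 < ρ ^ 2 := by positivity
  have hD : 0 < D := by
    by_contra hcon
    push Not at hcon
    nlinarith
  have hN0 : (0 : ℝ) < N := by
    have : 0 < 36 * D := by positivity
    linarith
  obtain ⟨r, hr, hr2⟩ : ∃ r : ℝ, 0 < r ∧ r ^ 2 = (s - t) / N :=
    ⟨√((s - t) / N), Real.sqrt_pos.2 (by positivity), Real.sq_sqrt (by positivity)⟩
  have hr2N : r ^ 2 * N = s - t := by rw [hr2]; field_simp
  have h6r : 6 * r ≤ ρ := by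
    refine (abs_le_of_sq_le_sq' (a := 6 * r) ?_ hρ.le).2
    have : 36 * (r ^ 2 * N) ≤ N * ρ ^ 2 := by rw [hr2N]; nlinarith
    have h4 : (36 * r ^ 2) * N ≤ ρ ^ 2 * N := by linarith
    have := le_of_mul_le_mul_right h4 hN0
    linarith
  have hstep : ‖y - x‖ ≤ N * r := by
    refine (abs_le_of_sq_le_sq' (a := ‖y - x‖) ?_ (by positivity)).2
    have h4 : ‖y - x‖ ^ 2 ≤ D ^ 2 * ρ ^ 2 := by
      rw [← mul_pow]; gcongr
    have h5 : D ^ 2 ≤ N * τ0 := by rw [div_lt_iff₀ hτ0] at hN2; exact hN2.le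
    have h6 : D ^ 2 * ρ ^ 2 ≤ N * (s - t) := by nlinarith
    rw [← hr2N] at h6
    calc ‖y - x‖ ^ 2 ≤ N * (r ^ 2 * N) := h4.trans h6
      _ = (N * r) ^ 2 := by ring
  have hr6 : r ≤ ρ := by linarith
  have hr6' : r ^ 2 ≤ ρ ^ 2 := by gcongr
  have hind : ∀ k : ℕ, k ≤ N → u (x, t) ≤ C ^ k * u (x + ((k : ℝ) / N) • (y - x), t + k * r ^ 2) := by
    intro k
    induction k with
    | zero => intro _; simp
    | succ k ih =>
      intro hk
      have hk' : (k : ℝ) + 1 ≤ N := by exact_mod_cast hk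
      refine (ih (by omega)).trans ?_
      have hk0 : (0 : ℝ) ≤ k := Nat.cast_nonneg _
      have hθ : (k : ℝ) / N ∈ Icc (0 : ℝ) 1 :=
        ⟨by positivity, by rw [div_le_one hN0]; linarith⟩
      have hq : (k + 1) * r ^ 2 ≤ s - t := by rw [← hr2N]; nlinarith [sq_nonneg r]
      have h7 := h u (x + ((k : ℝ) / N) • (y - x)) (t + k * r ^ 2) r hr ((hu _ hθ).mono
        (Set.prod_mono (Metric.closedBall_subset_closedBall h6r) (Icc_subset_Icc (by
          have : 0 ≤ k * r ^ 2 := by positivity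
          linarith) (by linarith)))) (x + (((k + 1 : ℕ) : ℝ) / N) • (y - x)) (by
          have e : x + (((k + 1 : ℕ) : ℝ) / N) • (y - x) - (x + ((k : ℝ) / N) • (y - x)) =
              (1 / N : ℝ) • (y - x) := by
            rw [add_sub_add_left_eq_sub, ← sub_smul]; congr 1; push_cast; ring
          rw [e, norm_smul, Real.norm_eq_abs, abs_of_pos (by positivity), one_div,
            inv_mul_le_iff₀ hN0]
          exact hstep)
      rw [pow_succ C, mul_assoc]
      gcongr
      refine h7.trans (le_of_eq ?_)
      congr 3
      push_cast; ring
  have := hind N le_rfl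
  rw [div_self hN0.ne', one_smul, add_sub_cancel, mul_comm (N : ℝ), hr2N, add_sub_cancel] at this
  exact this

theorem harnack_poly {l L : ℝ} (hl : 0 < l) (hlL : l ≤ L) {D : ℝ} (hD : 5 ≤ D) :
    ∃ (C : ℝ) (α : ℕ), 1 ≤ C ∧ ∀ (u : E × ℝ → ℝ) (x0 y : E) (t0 τ r R : ℝ), 0 < r →
      2 * r ^ 2 ≤ τ → 0 ≤ R → (1 + 4 * D) * τ ≤ R ^ 2 → ‖y - x0‖ ^ 2 ≤ D * τ →
      PosSol l L u (Metric.closedBall x0 R ×ˢ Icc (t0 - r ^ 2) (t0 + τ)) →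
      u (x0, t0) ≤ C * (τ / r ^ 2) ^ α * u (y, t0 + τ) := by
  obtain ⟨C, hC, h⟩ := harnack (E := E) hl hlL
  obtain ⟨α, hα⟩ := expansion (E := E) (l := l) (L := L) (B := 4 * D) hl (by linarith)
  have hC0 : 0 < C := by linarith
  refine ⟨C * 4 * (4 * D) ^ α, α, ?_, ?_⟩
  · have : 1 ≤ (4 * D) ^ α := one_le_pow₀ (by linarith)
    nlinarith
  intro u x0 y t0 τ r R hr hτ hR hRτ hy hu
  have hr2 : 0 < r ^ 2 := by positivity
  have hτ0 : 0 < τ := by linarith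
  have h6r : 6 * r ≤ R := (abs_le_of_sq_le_sq' (a := 6 * r) (by nlinarith) hR).2
  have h1 := h u x0 t0 r hr (hu.mono (Set.prod_mono (Metric.closedBall_subset_closedBall h6r)
    (Icc_subset_Icc le_rfl (by linarith))))
  have hu0 : 0 ≤ u (x0, t0) := hu.2.1 _ ⟨by simpa using hR, by simp only; linarith,
    by simp only; linarith⟩
  have hq : 4 * D * (r ^ 2 / (4 * D)) = r ^ 2 := by field_simp
  have h2 := hα u x0 R (t0 + r ^ 2) (t0 + τ) (r ^ 2 / (4 * D)) (u (x0, t0) / C) (by positivity) hR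
    (by positivity) (by nlinarith) (hu.mono (Set.prod_mono le_rfl
      (Icc_subset_Icc (by linarith) le_rfl))) (fun z hz => by
        rw [hq] at hz
        rw [div_le_iff₀ hC0, mul_comm]
        exact h1 z (abs_le_of_sq_le_sq' hz hr.le).2) y (t0 + τ)
    ((abs_le_of_sq_le_sq' (a := ‖y - x0‖) (by nlinarith) hR).2) (by linarith) le_rfl
  have e : t0 + τ - (t0 + r ^ 2) = τ - r ^ 2 := by ring
  rw [e] at h2
  have hq0 : 0 < r ^ 2 / (4 * D) := by positivity
  have hs0 : 0 < r ^ 2 / (4 * D) + (τ - r ^ 2) := by linarith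
  have hA : (r ^ 2 / (4 * D * τ)) ^ α ≤ (r ^ 2 / (4 * D) / (r ^ 2 / (4 * D) + (τ - r ^ 2))) ^ α := by
    refine pow_le_pow_left₀ (by positivity) ?_ α
    rw [← div_div]
    gcongr
    have : r ^ 2 / (4 * D) ≤ r ^ 2 := div_le_self hr2.le (by linarith)
    linarith
  have hB : (1 / 2 : ℝ) ≤
      max (1 - ‖y - x0‖ ^ 2 / (4 * D * (r ^ 2 / (4 * D) + (τ - r ^ 2)))) 0 := by
    refine le_max_of_le_left ?_
    have : ‖y - x0‖ ^ 2 / (4 * D * (r ^ 2 / (4 * D) + (τ - r ^ 2))) ≤ 1 / 2 := by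
      rw [div_le_iff₀ (by positivity), mul_add, hq]; nlinarith
    linarith
  have h3 : u (x0, t0) / C * (r ^ 2 / (4 * D * τ)) ^ α * (1 / 2) ^ 2 ≤ u (y, t0 + τ) := by
    refine le_trans ?_ h2
    gcongr
  have e2 : u (x0, t0) / C * (r ^ 2 / (4 * D * τ)) ^ α * (1 / 2) ^ 2 =
      u (x0, t0) / (C * 4 * (4 * D) ^ α * (τ / r ^ 2) ^ α) := by
    have hA0 : (r ^ 2) ^ α ≠ 0 := by positivity
    rw [div_pow _ _ α, div_pow _ _ α, mul_pow]
    generalize (r ^ 2) ^ α = A at hA0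
    field_simp; ring
  rw [e2, div_le_iff₀ (by positivity)] at h3
  linarith

end KrylovSafonov

namespace KrylovSafonov

open Set Filter Topology MeasureTheory

variable {E : Type*} [NormedAddCommGroup E] [InnerProductSpace ℝ E] [FiniteDimensional ℝ E]

/-- A nonnegative solution on a ball during a time interval, continuous except possibly at the
endpoints of the interval, and continuous at the initial time off the set `K`. -/
structure GapSol (l L : ℝ) (w : E × ℝ → ℝ) (x0 : E) (r a b : ℝ) (K : Set E) : Prop where
  nonneg : ∀ y ∈ Metric.closedBall x0 r, ∀ s ∈ Icc a b, 0 ≤ w (y, s)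
  sol : ∀ y ∈ Metric.closedBall x0 r, ∀ s ∈ Icc a b, SolAt l L w (y, s)
  cont : ∀ y ∈ Metric.closedBall x0 r, ∀ s ∈ Ioo a b, ContinuousAt w (y, s)
  cont_left : ∀ y ∈ Metric.closedBall x0 r, y ∉ K → ContinuousAt w (y, a)

theorem GapSol.posSol {l L : ℝ} {w : E × ℝ → ℝ} {x0 : E} {r a b : ℝ} {K : Set E}
    (h : GapSol l L w x0 r a b K) {S : Set (E × ℝ)}
    (hS : S ⊆ Metric.closedBall x0 r ×ˢ Ioo a b) : PosSol l L w S :=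
  ⟨fun p hp => (h.cont p.1 (hS hp).1 p.2 (hS hp).2).continuousWithinAt,
    fun p hp => h.nonneg p.1 (hS hp).1 p.2 (Ioo_subset_Icc_self (hS hp).2),
    fun p hp => h.sol p.1 (hS hp).1 p.2 (Ioo_subset_Icc_self (hS hp).2)⟩

theorem GapSol.posSol_initial {l L : ℝ} {w : E × ℝ → ℝ} {x0 : E} {r a b s : ℝ} {K : Set E}
    (h : GapSol l L w x0 r a b K) {S : Set E} (hS : S ⊆ Metric.closedBall x0 r)
    (hSK : ∀ y ∈ S, y ∉ K) (hs : s < b) : PosSol l L w (S ×ˢ Icc a s) := by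
  refine ⟨?_, ?_, ?_⟩
  · rintro ⟨y, t⟩ ⟨hy, h1, h2⟩
    rcases h1.eq_or_lt with h3 | h3
    · simp only at h3
      subst h3
      exact (h.cont_left y (hS hy) (hSK y hy)).continuousWithinAt
    · exact (h.cont y (hS hy) t ⟨h3, lt_of_le_of_lt h2 hs⟩).continuousWithinAt
  · exact fun p hp => h.nonneg p.1 (hS hp.1) p.2 ⟨hp.2.1, hp.2.2.trans hs.le⟩
  · exact fun p hp => h.sol p.1 (hS hp.1) p.2 ⟨hp.2.1, hp.2.2.trans hs.le⟩

theorem GapSol.lower_bound {l L : ℝ} (hl : 0 < l) (hlL : l ≤ L) :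
    ∃ c : ℝ, 0 < c ∧ c ≤ 1 ∧ ∀ (w : E × ℝ → ℝ) (x0 : E) (r a b θ : ℝ) (K : Set E), 0 < r →
      GapSol l L w x0 r a b K → IsCompact K → x0 ∈ K → 0 ≤ θ →
      (∀ y ∈ K, ∀ s ∈ Icc a b, θ ≤ w (y, s)) →
      (∀ y ∈ Metric.closedBall x0 r, θ ≤ w (y, a)) →
      ∀ z, ‖z - x0‖ ≤ r / 12 → ∀ s ∈ Ioo a b, c * θ ≤ w (z, s) := by
  obtain ⟨C, β, hC, hH⟩ := harnack_poly (E := E) hl hlL (D := 5) le_rfl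
  obtain ⟨α, hα⟩ := expansion (E := E) (l := l) (L := L) (B := 1 / 16) hl (by norm_num)
  have hC2 : 1 ≤ C * 2 ^ β := one_le_mul_of_one_le_of_one_le hC (one_le_pow₀ (by norm_num))
  have hC0 : 0 < C * 2 ^ β := by linarith
  have hc1 : (C * 2 ^ β)⁻¹ ≤ 1 := inv_le_one_of_one_le₀ hC2
  have hc2 : (1 / 2 : ℝ) ^ α ≤ 1 := pow_le_one₀ (by norm_num) (by norm_num)
  have hc3 : (0 : ℝ) < (1 / 2 : ℝ) ^ α := by positivity
  have hc4 : 0 < (C * 2 ^ β)⁻¹ := by positivity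
  refine ⟨(C * 2 ^ β)⁻¹ * (1 / 2) ^ α, by positivity, mul_le_one₀ hc1 hc3.le hc2, ?_⟩
  intro w x0 r a b θ K hr hw hKc hx0 hθ hK ha z hz s hs
  have hsI : s ∈ Icc a b := Ioo_subset_Icc_self hs
  have hle1 : (C * 2 ^ β)⁻¹ * (1 / 2) ^ α * θ ≤ (C * 2 ^ β)⁻¹ * θ := by
    gcongr; exact mul_le_of_le_one_right hc4.le hc2
  have hle2 : (C * 2 ^ β)⁻¹ * (1 / 2) ^ α * θ ≤ (1 / 2) ^ α * θ := by
    gcongr; exact mul_le_of_le_one_left hc3.le hc1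
  have hle3 : (C * 2 ^ β)⁻¹ * θ ≤ θ := mul_le_of_le_one_left hθ hc1
  by_cases hzK : z ∈ K
  · exact (hle1.trans hle3).trans (hK z hzK s hsI)
  obtain ⟨x', hx'K, hx'⟩ := hKc.exists_infDist_eq_dist ⟨x0, hx0⟩ z
  obtain ⟨d, hd⟩ : ∃ d, d = Metric.infDist z K := ⟨_, rfl⟩
  rw [← hd] at hx'
  have hd0 : 0 < d := by
    rw [hd]; exact (hKc.isClosed.notMem_iff_infDist_pos ⟨x0, hx0⟩).1 hzK
  have hdr : d ≤ r / 12 := by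
    rw [hd]; exact (Metric.infDist_le_dist_of_mem hx0).trans (by rwa [dist_eq_norm])
  have hzx : ‖z - x'‖ = d := by rw [hx', dist_eq_norm]
  have hd2 : 0 < d ^ 2 := by positivity
  rcases le_or_gt (2 * d ^ 2) (s - a) with hcase | hcase
  · obtain ⟨ρ, hρ, hρ2⟩ : ∃ ρ : ℝ, 0 < ρ ∧ ρ ^ 2 = d ^ 2 / 2 :=
      ⟨√(d ^ 2 / 2), Real.sqrt_pos.2 (by positivity), Real.sq_sqrt (by positivity)⟩
    have h1 := hH w x' z (s - d ^ 2) (d ^ 2) ρ (5 * d) hρ (by linarith) (by positivity)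
      (by nlinarith) (by rw [hzx]; linarith) (hw.posSol (Set.prod_mono
        (Metric.closedBall_subset_closedBall' (by
          have h2 : dist x' x0 ≤ dist x' z + dist z x0 := dist_triangle _ _ _
          rw [dist_comm x' z, ← hx', dist_eq_norm z x0] at h2
          linarith))
        (fun q hq => ⟨by linarith [hq.1], by linarith [hq.2, hs.2]⟩)))
    rw [sub_add_cancel, hρ2] at h1
    have e : d ^ 2 / (d ^ 2 / 2) = 2 := by field_simp
    rw [e] at h1
    have h3 := (hK x' hx'K (s - d ^ 2) ⟨by linarith, by linarith [hs.2]⟩).trans h1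
    refine hle1.trans ?_
    rwa [inv_mul_le_iff₀ hC0]
  · have h1 := hα w z (d / 2) a s (2 * d ^ 2) θ (by positivity) (by positivity) hθ (by nlinarith)
      (hw.posSol_initial (Metric.closedBall_subset_closedBall' (by
        rw [dist_eq_norm]; linarith)) (fun y hy hyK => by
          have h2 : d ≤ dist z y := by rw [hd]; exact Metric.infDist_le_dist_of_mem hyK
          rw [Metric.mem_closedBall, dist_comm] at hy
          linarith) hs.2) (fun y hy => ha y (by
            have h2 : ‖y - z‖ ≤ d / 2 := by
              refine (abs_le_of_sq_le_sq' (a := ‖y - z‖) ?_ (by positivity)).2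
              nlinarith
            rw [Metric.mem_closedBall, dist_eq_norm]
            have := norm_sub_le_norm_sub_add_norm_sub y z x0
            linarith)) z s (by simpa using by positivity) hs.1.le le_rfl
    refine hle2.trans (le_trans ?_ h1)
    have hs0 : 0 < s - a := by linarith [hs.1]
    rw [sub_self, norm_zero]
    have e : max (1 - (0 : ℝ) ^ 2 / (1 / 16 * (2 * d ^ 2 + (s - a)))) 0 ^ 2 = 1 := by norm_num
    rw [e, mul_one, mul_comm]
    refine mul_le_mul_of_nonneg_left (pow_le_pow_left₀ (by norm_num) ?_ α) hθ
    rw [div_le_div_iff₀ (by norm_num) (by linarith)]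
    linarith

theorem GapSol.upper_bound_poly {l L : ℝ} (hl : 0 < l) (hlL : l ≤ L) :
    ∃ (C : ℝ) (α : ℕ), 1 ≤ C ∧ ∀ (w : E × ℝ → ℝ) (x0 : E) (r a b Θ : ℝ) (K : Set E), 0 < r →
      GapSol l L w x0 r a b K → IsCompact K → x0 ∈ K → 0 ≤ Θ →
      (∀ y ∈ K, ∀ s ∈ Icc a b, w (y, s) ≤ Θ) →
      (∀ y ∈ Metric.closedBall x0 r, w (y, b) ≤ Θ) →
      ∀ z, ‖z - x0‖ ≤ r / 6 → z ∉ K → ∀ s ∈ Ioo a b,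
        w (z, s) ≤ C * (1 + Metric.infDist z K ^ 2 / (s - a)) ^ α * Θ := by
  obtain ⟨C, β, hC, hH⟩ := harnack_poly (E := E) hl hlL (D := 5) le_rfl
  have hC0 : 0 < C := by linarith
  refine ⟨C * 2 ^ β, β, one_le_mul_of_one_le_of_one_le hC (one_le_pow₀ (by norm_num)), ?_⟩
  intro w x0 r a b Θ K hr hw hKc hx0 hΘ hK hb z hz hzK s hs
  obtain ⟨x', hx'K, hx'⟩ := hKc.exists_infDist_eq_dist ⟨x0, hx0⟩ z
  obtain ⟨d, hd⟩ : ∃ d, d = Metric.infDist z K := ⟨_, rfl⟩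
  rw [← hd] at hx' ⊢
  have hd0 : 0 < d := by
    rw [hd]; exact (hKc.isClosed.notMem_iff_infDist_pos ⟨x0, hx0⟩).1 hzK
  have hdr : d ≤ r / 6 := by
    rw [hd]; exact (Metric.infDist_le_dist_of_mem hx0).trans (by rwa [dist_eq_norm])
  have hzx : ‖x' - z‖ = d := by rw [hx', dist_comm, dist_eq_norm]
  have hd2 : 0 < d ^ 2 := by positivity
  have hσ : 0 < s - a := by linarith [hs.1]
  have hstep : ∀ (y : E) (τ : ℝ), 0 < τ → τ ≤ d ^ 2 → s + τ < b → ‖y - z‖ ^ 2 ≤ 5 * τ →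
      w (z, s) ≤ C * 2 ^ β * (1 + d ^ 2 / (s - a)) ^ β * w (y, s + τ) := by
    intro y τ hτ hτd hτb hy
    obtain ⟨m, hm⟩ : ∃ m, m = min (s - a) τ := ⟨_, rfl⟩
    have hm1 : m ≤ s - a := hm ▸ min_le_left _ _
    have hm2 : m ≤ τ := hm ▸ min_le_right _ _
    have hm0 : 0 < m := hm ▸ lt_min hσ hτ
    obtain ⟨ρ, hρ, hρ2⟩ : ∃ ρ : ℝ, 0 < ρ ∧ ρ ^ 2 = m / 2 :=
      ⟨√(m / 2), Real.sqrt_pos.2 (by positivity), Real.sq_sqrt (by positivity)⟩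
    have hps : PosSol l L w (Metric.closedBall z (5 * d) ×ˢ Icc (s - ρ ^ 2) (s + τ)) :=
      hw.posSol (Set.prod_mono (Metric.closedBall_subset_closedBall' (by
          rw [dist_eq_norm]; linarith))
        (fun q hq => ⟨by linarith [hq.1], by linarith [hq.2, hs.2]⟩))
    have h1 := hH w z y s τ ρ (5 * d) hρ (by linarith) (by positivity)
      (by nlinarith) hy hps
    have hy5 : ‖y - z‖ ≤ 5 * d := (abs_le_of_sq_le_sq' (a := ‖y - z‖) (by nlinarith)
      (by positivity)).2
    have hwy : 0 ≤ w (y, s + τ) := hps.2.1 (y, s + τ) ⟨by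
      rw [Metric.mem_closedBall, dist_eq_norm]; exact hy5, by
        simp only; linarith, le_rfl⟩
    refine h1.trans ?_
    rw [mul_assoc C (2 ^ β), ← mul_pow]
    refine mul_le_mul_of_nonneg_right (mul_le_mul_of_nonneg_left
      (pow_le_pow_left₀ (by positivity) ?_ β) hC0.le) hwy
    rw [hρ2, div_le_iff₀ (by positivity)]
    have h2 : d ^ 2 / (s - a) * m ≤ d ^ 2 := by
      rw [div_mul_eq_mul_div, div_le_iff₀ hσ]; gcongr
    rcases min_choice (s - a) τ with h3 | h3
    · rw [← hm] at h3
      have : d ^ 2 / (s - a) * m = d ^ 2 := by rw [h3]; field_simp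
      linarith
    · rw [← hm] at h3
      have : 0 ≤ d ^ 2 / (s - a) * m := by positivity
      linarith
  rcases lt_or_ge (s + d ^ 2) b with hcase | hcase
  · refine (hstep x' (d ^ 2) hd2 le_rfl hcase (by rw [hzx]; linarith)).trans ?_
    gcongr
    exact hK x' hx'K _ ⟨by linarith, hcase.le⟩
  · have hzb : z ∈ Metric.closedBall x0 r := by
      rw [Metric.mem_closedBall, dist_eq_norm]; linarith
    have hsb : s < b := hs.2
    obtain ⟨_, _, _, _, hder⟩ := hw.sol z hzb b ⟨by linarith [hs.1], le_rfl⟩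
    have hlim : Tendsto (fun t => C * 2 ^ β * (1 + d ^ 2 / (s - a)) ^ β * w (z, t)) (𝓝[<] b)
        (𝓝 (C * 2 ^ β * (1 + d ^ 2 / (s - a)) ^ β * w (z, b))) :=
      (hder.continuousAt.tendsto.mono_left nhdsWithin_le_nhds).const_mul _
    have h1 : w (z, s) ≤ C * 2 ^ β * (1 + d ^ 2 / (s - a)) ^ β * w (z, b) := by
      refine ge_of_tendsto hlim ?_
      filter_upwards [Ioo_mem_nhdsLT hsb] with t ht
      have := hstep z (t - s) (by linarith [ht.1]) (by linarith [ht.2]) (by linarith [ht.2])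
        (by rw [sub_self, norm_zero]; linarith [ht.1])
      rwa [add_sub_cancel] at this
    refine h1.trans ?_
    gcongr
    exact hb z hzb

set_option maxHeartbeats 1000000 in
theorem GapSol.upper_bound {l L : ℝ} (hl : 0 < l) (hlL : l ≤ L) :
    ∃ C : ℝ, 1 ≤ C ∧ ∀ (w : E × ℝ → ℝ) (x0 : E) (r a b Θ : ℝ) (K : Set E), 0 < r →
      GapSol l L w x0 r a b K → IsCompact K → x0 ∈ K → 0 ≤ Θ →
      (∀ y ∈ K, ∀ s ∈ Icc a b, w (y, s) ≤ Θ) →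
      (∀ y ∈ Metric.closedBall x0 r, w (y, a) ≤ Θ ∧ w (y, b) ≤ Θ) →
      ∀ z, ‖z - x0‖ ≤ r / 12 → ∀ s ∈ Ioo a b, w (z, s) ≤ C * Θ := by
  obtain ⟨C, β, hC, hP⟩ := GapSol.upper_bound_poly (E := E) hl hlL
  obtain ⟨α, hα⟩ := expansion (E := E) (l := l) (L := L) (B := 1) hl (by norm_num)
  have hC0 : 0 < C := by linarith
  obtain ⟨κ, hκ⟩ : ∃ κ : ℝ, κ = 1 / (16 * 4 ^ β * (α + 1)) := ⟨_, rfl⟩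
  have hα0 : (0 : ℝ) ≤ α := Nat.cast_nonneg _
  have hκ0 : 0 < κ := by rw [hκ]; positivity
  have hA1 : (1 : ℝ) ≤ 4 ^ β := one_le_pow₀ (by norm_num)
  have hκe : 16 * 4 ^ β * κ * (α + 1) = 1 := by rw [hκ]; field_simp
  have hκA : 16 * 4 ^ β * κ ≤ 1 := by
    have : 0 < 16 * 4 ^ β * κ := by positivity
    nlinarith
  have hκ8 : 16 * κ ≤ 1 := by nlinarith
  have hbern : 4 ^ β - 1 / 2 ≤ 4 ^ β * (1 / (1 + 8 * κ)) ^ α := by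
    have h1 := one_add_mul_le_pow (a := -(8 * κ)) (by linarith) α
    have h2 : 1 - 8 * κ ≤ 1 / (1 + 8 * κ) := by
      rw [le_div_iff₀ (by positivity)]; nlinarith
    have h3 : (1 + -(8 * κ)) ^ α ≤ (1 / (1 + 8 * κ)) ^ α := by
      gcongr
      · linarith
      · linarith
    have h4 : 1 + ↑α * -(8 * κ) ≤ (1 / (1 + 8 * κ)) ^ α := h1.trans h3
    have h5 := mul_le_mul_of_nonneg_left h4 (by positivity : (0 : ℝ) ≤ 4 ^ β)
    have h6 : 0 < 4 ^ β * κ := by positivity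
    nlinarith
  have hC2 : 0 ≤ C * (1 + 9 / κ) ^ β := by positivity
  refine ⟨2 + C * (1 + 9 / κ) ^ β, by linarith, ?_⟩
  intro w x0 r a b Θ K hr hw hKc hx0 hΘ hK hab z hz s hs
  have hsI : s ∈ Icc a b := Ioo_subset_Icc_self hs
  by_cases hzK : z ∈ K
  · have := hK z hzK s hsI
    nlinarith
  obtain ⟨d, hd⟩ : ∃ d, d = Metric.infDist z K := ⟨_, rfl⟩
  have hd0 : 0 < d := by
    rw [hd]; exact (hKc.isClosed.notMem_iff_infDist_pos ⟨x0, hx0⟩).1 hzK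
  have hdr : d ≤ r / 12 := by
    rw [hd]; exact (Metric.infDist_le_dist_of_mem hx0).trans (by rwa [dist_eq_norm])
  have hbK : ∀ y ∈ Metric.closedBall z (d / 2), y ∉ K := fun y hy hyK => by
    have h2 : d ≤ dist z y := by rw [hd]; exact Metric.infDist_le_dist_of_mem hyK
    rw [Metric.mem_closedBall, dist_comm] at hy
    linarith
  have hbB : Metric.closedBall z (d / 2) ⊆ Metric.closedBall x0 (r / 6) :=
    Metric.closedBall_subset_closedBall' (by rw [dist_eq_norm]; linarith)
  have hbB' : Metric.closedBall z (d / 2) ⊆ Metric.closedBall x0 r :=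
    hbB.trans (Metric.closedBall_subset_closedBall (by linarith))
  have hps := hw.posSol_initial hbB' hbK hs.2
  obtain ⟨⟨y, t⟩, ⟨hy, hta, hts⟩, hmax⟩ :=
    ((isCompact_closedBall z (d / 2)).prod (isCompact_Icc (a := a) (b := s))).exists_isMaxOn
    (f := fun p : E × ℝ => w p * (d / 2 - ‖p.1 - z‖) ^ (2 * β))
    ⟨(z, s), Metric.mem_closedBall_self (by positivity), hs.1.le, le_rfl⟩
    (hps.1.mul (by fun_prop))
  simp only at hta hts
  obtain ⟨g, hg⟩ : ∃ g, g = d / 2 - ‖y - z‖ := ⟨_, rfl⟩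
  have hy' : ‖y - z‖ ≤ d / 2 := by rwa [Metric.mem_closedBall, dist_eq_norm] at hy
  have hg0 : 0 ≤ g := by rw [hg]; linarith
  have hgd : g ≤ d / 2 := by rw [hg]; linarith [norm_nonneg (y - z)]
  have hmax' : ∀ x' t', ‖x' - z‖ ≤ d / 2 → a ≤ t' → t' ≤ s →
      w (x', t') * (d / 2 - ‖x' - z‖) ^ (2 * β) ≤ w (y, t) * g ^ (2 * β) := by
    intro x' t' h1 h2 h3
    rw [hg]
    exact hmax ⟨by rwa [Metric.mem_closedBall, dist_eq_norm], h2, h3⟩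
  have hmz := hmax' z s (by simpa using by positivity) hs.1.le le_rfl
  rw [sub_self, norm_zero, sub_zero] at hmz
  have hwy : 0 ≤ w (y, t) := hps.2.1 (y, t) ⟨hy, hta, hts⟩
  have hd2β : (0 : ℝ) < (d / 2) ^ (2 * β) := by positivity
  suffices h : w (y, t) * g ^ (2 * β) ≤ (2 + C * (1 + 9 / κ) ^ β) * Θ * (d / 2) ^ (2 * β) from
    le_of_mul_le_mul_right (hmz.trans h) hd2β
  have hgβ : g ^ (2 * β) ≤ (d / 2) ^ (2 * β) := by gcongr
  have hgβ0 : 0 ≤ g ^ (2 * β) := by positivity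
  have hCΘ : 0 ≤ C * (1 + 9 / κ) ^ β * Θ := by positivity
  have hbnd : w (y, t) ≤ 2 * Θ →
      w (y, t) * g ^ (2 * β) ≤ (2 + C * (1 + 9 / κ) ^ β) * Θ * (d / 2) ^ (2 * β) := by
    intro h
    have : w (y, t) ≤ (2 + C * (1 + 9 / κ) ^ β) * Θ := by linarith
    gcongr
  by_cases hg00 : g = 0
  · by_cases hβ : β = 0
    · subst hβ
      simp only [mul_zero, pow_zero, mul_one] at hmz ⊢
      rcases hta.eq_or_lt with h | h
      · rw [← h]
        have := (hab y (hbB' hy)).1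
        nlinarith
      · have := hP w x0 r a b Θ K hr hw hKc hx0 hΘ hK (fun y hy => (hab y hy).2) y
          (by simpa [dist_eq_norm] using hbB hy) (hbK y hy) t ⟨h, lt_of_le_of_lt hts hs.2⟩
        simp only [pow_zero, mul_one] at this
        nlinarith
    · rw [hg00, zero_pow (by omega), mul_zero]
      positivity
  have hgp : 0 < g := lt_of_le_of_ne hg0 (Ne.symm hg00)
  rcases le_or_gt (κ * g ^ 2) (t - a) with hcase | hcase
  · have hta' : 0 < t - a := lt_of_lt_of_le (by positivity) hcase
    have h1 := hP w x0 r a b Θ K hr hw hKc hx0 hΘ hK (fun y hy => (hab y hy).2) y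
      (by simpa [dist_eq_norm] using hbB hy) (hbK y hy) t
      ⟨by linarith, lt_of_le_of_lt hts hs.2⟩
    have h2 : Metric.infDist y K ≤ 3 / 2 * d := by
      have h3 : Metric.infDist y K ≤ Metric.infDist z K + dist y z :=
        Metric.infDist_le_infDist_add_dist
      rw [dist_eq_norm, ← hd] at h3
      linarith
    have h3 : Metric.infDist y K ^ 2 ≤ (3 / 2 * d) ^ 2 := by
      have := Metric.infDist_nonneg (x := y) (s := K)
      gcongr
    have h4 : (1 + Metric.infDist y K ^ 2 / (t - a)) * g ^ 2 ≤ (1 + 9 / κ) * (d / 2) ^ 2 := by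
      have h5 : Metric.infDist y K ^ 2 / (t - a) ≤ (3 / 2 * d) ^ 2 / (κ * g ^ 2) := by
        gcongr
      have h6 : (3 / 2 * d) ^ 2 / (κ * g ^ 2) * g ^ 2 = 9 / κ * (d / 2) ^ 2 := by
        field_simp; ring
      have h7 : g ^ 2 ≤ (d / 2) ^ 2 := by gcongr
      nlinarith [sq_nonneg g]
    have h0 : 0 ≤ 1 + Metric.infDist y K ^ 2 / (t - a) := by positivity
    calc w (y, t) * g ^ (2 * β)
        ≤ C * (1 + Metric.infDist y K ^ 2 / (t - a)) ^ β * Θ * g ^ (2 * β) := by gcongr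
      _ = C * ((1 + Metric.infDist y K ^ 2 / (t - a)) * g ^ 2) ^ β * Θ := by
          rw [mul_pow, pow_mul]; ring
      _ ≤ C * ((1 + 9 / κ) * (d / 2) ^ 2) ^ β * Θ := by gcongr
      _ = C * (1 + 9 / κ) ^ β * Θ * (d / 2) ^ (2 * β) := by
          rw [mul_pow, ← pow_mul]; ring
      _ ≤ _ := by gcongr; linarith
  · refine hbnd ?_
    by_contra hcon
    push Not at hcon
    have hA4 : (4 : ℝ) ^ β = 2 ^ (2 * β) := by rw [pow_mul]; norm_num
    have hballg : ∀ x' : E, ‖x' - y‖ ≤ g / 2 → ‖x' - z‖ ≤ d / 2 - g / 2 := by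
      intro x' hx'
      have := norm_sub_le_norm_sub_add_norm_sub x' y z
      linarith
    have hup : ∀ x' t', ‖x' - y‖ ≤ g / 2 → a ≤ t' → t' ≤ s → w (x', t') ≤ 4 ^ β * w (y, t) := by
      intro x' t' h1 h2 h3
      have h4 := hballg x' h1
      have h5 := hmax' x' t' (by linarith) h2 h3
      have h6 : 0 ≤ w (x', t') := hps.2.1 (x', t') ⟨by
        rw [Metric.mem_closedBall, dist_eq_norm]; linarith, h2, h3⟩
      have h7 : w (x', t') * (g / 2) ^ (2 * β) ≤ w (y, t) * g ^ (2 * β) := by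
        refine le_trans ?_ h5
        gcongr
        linarith
      rw [div_pow, ← hA4] at h7
      have h8 : w (x', t') * g ^ (2 * β) ≤ 4 ^ β * w (y, t) * g ^ (2 * β) := by
        rw [← mul_div_assoc, div_le_iff₀ (by positivity)] at h7; linarith
      exact le_of_mul_le_mul_right h8 (by positivity)
    have hWp : PosSol l L (fun p => (-1) * w p + 4 ^ β * w (y, t))
        (Metric.closedBall y (g / 2) ×ˢ Icc a t) := by
      refine (hps.mono (Set.prod_mono (fun x' hx' => ?_) (Icc_subset_Icc le_rfl hts))).affine _ _ ?_
      · rw [Metric.mem_closedBall, dist_eq_norm] at hx' ⊢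
        linarith [hballg x' hx']
      · rintro ⟨x', t'⟩ ⟨hx', h1, h2⟩
        rw [Metric.mem_closedBall, dist_eq_norm] at hx'
        have := hup x' t' hx' h1 (h2.trans hts)
        linarith
    have hin : 0 ≤ 4 ^ β * w (y, t) - Θ := by nlinarith only [hcon, hA1, hwy, hΘ]
    have hexp := hα _ y (g / 2) a t (g ^ 2 / 8) (4 ^ β * w (y, t) - Θ) (by positivity)
      (by positivity) hin (by nlinarith [sq_nonneg g]) hWp (fun x' hx' => by
        have h1 : ‖x' - y‖ ≤ g / 2 :=
          (abs_le_of_sq_le_sq' (a := ‖x' - y‖) (by nlinarith [sq_nonneg g]) (by positivity)).2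
        have h2 := (hab x' (hbB' (by
          rw [Metric.mem_closedBall, dist_eq_norm]; linarith [hballg x' h1]))).1
        linarith) y t (by simpa using by positivity) hta le_rfl
    rw [sub_self, norm_zero] at hexp
    have e : max (1 - (0 : ℝ) ^ 2 / (1 * (g ^ 2 / 8 + (t - a)))) 0 ^ 2 = 1 := by norm_num
    rw [e, mul_one] at hexp
    have h9 : (1 / (1 + 8 * κ)) ^ α ≤ (g ^ 2 / 8 / (g ^ 2 / 8 + (t - a))) ^ α := by
      refine pow_le_pow_left₀ (by positivity) ?_ α
      have hg2 : 0 < g ^ 2 := by positivity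
      rw [div_le_div_iff₀ (by positivity) (by linarith)]
      linarith only [hcase]
    have h10 := mul_le_mul_of_nonneg_left h9 hin
    have h11 := h10.trans hexp
    have h12 : (1 / (1 + 8 * κ)) ^ α ≤ 1 := by
      refine pow_le_one₀ (by positivity) ?_
      rw [div_le_one (by positivity)]; linarith
    have h13 := mul_le_mul_of_nonneg_left h12 hΘ
    have h14 := mul_le_mul_of_nonneg_right hbern hwy
    linarith only [h11, h13, h14, hcon]

end KrylovSafonov

namespace KrylovSafonov

open Set Filter Topology MeasureTheory

variable {E : Type*} [NormedAddCommGroup E] [InnerProductSpace ℝ E] [FiniteDimensional ℝ E]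

/-- The closed set of points near which `v` fails to be continuous. -/
def badSet (v : E × ℝ → ℝ) : Set (E × ℝ) := {p | ¬ ∀ᶠ q in 𝓝 p, ContinuousAt v q}

theorem isClosed_badSet (v : E × ℝ → ℝ) : IsClosed (badSet v) := by
  have h : badSet v = {p | ∀ᶠ q in 𝓝 p, ContinuousAt v q}ᶜ := rfl
  rw [h, isClosed_compl_iff]
  exact isOpen_setOfPred_eventually_nhds

theorem continuousAt_of_notMem_badSet {v : E × ℝ → ℝ} {p : E × ℝ} (h : p ∉ badSet v) :
    ContinuousAt v p := by
  have h1 : ∀ᶠ q in 𝓝 p, ContinuousAt v q := by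
    by_contra h2
    exact h h2
  exact h1.self_of_nhds

/-- If `v` is within `ω` of `c` on the time slices and on the vertical lines which meet the bad set,
then `v` is within a multiple of `ω` of `c` near the centre. -/
theorem oscillation_near_badSet {l L : ℝ} (hl : 0 < l) (hlL : l ≤ L) :
    ∃ C : ℝ, 1 ≤ C ∧ ∀ (v : E × ℝ → ℝ) (x0 : E) (ρ t1 t2 c ω : ℝ) (K : Set E) (F : Set ℝ),
      0 < ρ → t1 ≤ t2 → 0 ≤ c → 0 < ω → IsCompact K → IsCompact F → x0 ∈ K →
      t1 ∈ F → t2 ∈ F → F ⊆ Icc t1 t2 →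
      (∀ y ∈ Metric.closedBall x0 ρ, ∀ s ∈ Icc t1 t2, 0 ≤ v (y, s) ∧ SolAt l L v (y, s)) →
      (∀ y ∈ Metric.closedBall x0 ρ, ∀ s ∈ Icc t1 t2, y ∉ K ∨ s ∉ F → ContinuousAt v (y, s)) →
      (∀ y ∈ K, ∀ s ∈ Icc t1 t2, |v (y, s) - c| ≤ ω) →
      (∀ y ∈ Metric.closedBall x0 ρ, ∀ s ∈ F, |v (y, s) - c| ≤ ω) →
      ∃ r, 0 < r ∧ ∀ y ∈ Metric.closedBall x0 r, ∀ s ∈ Icc t1 t2, |v (y, s) - c| ≤ C * ω := by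
  obtain ⟨κ, hκ0, hκ1, hlow⟩ := GapSol.lower_bound (E := E) hl hlL
  obtain ⟨C, hC, hup⟩ := GapSol.upper_bound (E := E) hl hlL
  refine ⟨3 * C, by linarith, ?_⟩
  intro v x0 ρ t1 t2 c ω K F hρ h12 hc hω hKc hFc hx0 ht1 ht2 hF hv hcont hvK hvF
  have hgap : ∀ s ∈ Icc t1 t2, s ∉ F → ∃ a b, a ∈ F ∧ b ∈ F ∧ s ∈ Ioo a b ∧
      ∀ s' ∈ Ioo a b, s' ∉ F := by
    intro s hs hsF
    obtain ⟨a, ⟨haF, has⟩, ha⟩ := (hFc.inter_right isClosed_Iic).exists_isGreatest ⟨t1, ht1, hs.1⟩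
    obtain ⟨b, ⟨hbF, hbs⟩, hb⟩ := (hFc.inter_right isClosed_Ici).exists_isLeast ⟨t2, ht2, hs.2⟩
    have has' : a < s := lt_of_le_of_ne has (fun h => hsF (h ▸ haF))
    have hbs' : s < b := lt_of_le_of_ne hbs (fun h => hsF (h ▸ hbF))
    refine ⟨a, b, haF, hbF, ⟨has', hbs'⟩, fun s' hs' hs'F => ?_⟩
    rcases le_total s' s with h | h
    · exact absurd (ha ⟨hs'F, h⟩) (not_le.2 hs'.1)
    · exact absurd (hb ⟨hs'F, h⟩) (not_le.2 hs'.2)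
  have hGS : ∀ (m r a b : ℝ), r ≤ ρ → a ∈ F → b ∈ F → (∀ s' ∈ Ioo a b, s' ∉ F) →
      (∀ y ∈ Metric.closedBall x0 r, ∀ s ∈ Icc t1 t2, m ≤ v (y, s)) →
      GapSol l L (fun q => 1 * v q + -m) x0 r a b K := by
    intro m r a b hr ha hb hab hm
    have hsub : Icc a b ⊆ Icc t1 t2 := Icc_subset_Icc (hF ha).1 (hF hb).2
    have hball : Metric.closedBall x0 r ⊆ Metric.closedBall x0 ρ :=
      Metric.closedBall_subset_closedBall hr
    refine ⟨fun y hy s hs => ?_, fun y hy s hs => ?_, fun y hy s hs => ?_, fun y hy hyK => ?_⟩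
    · have := hm y hy s (hsub hs); linarith
    · exact ((hv y (hball hy) s (hsub hs)).2).affine 1 (-m)
    · exact ((hcont y (hball hy) s (hsub (Ioo_subset_Icc_self hs)) (Or.inr (hab s hs))).const_mul
        1).add_const _
    · exact ((hcont y (hball hy) a (hF ha) (Or.inl hyK)).const_mul 1).add_const _
  have hiter : ∀ j : ℕ, ∃ r, 0 < r ∧ r ≤ ρ ∧ ∀ y ∈ Metric.closedBall x0 r, ∀ s ∈ Icc t1 t2,
      c - ω - (1 - κ) ^ j * c ≤ v (y, s) := by
    intro j
    induction j with
    | zero =>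
      refine ⟨ρ, hρ, le_rfl, fun y hy s hs => ?_⟩
      have := (hv y hy s hs).1
      rw [pow_zero]; linarith
    | succ j ih =>
      obtain ⟨r, hr, hrρ, hm⟩ := ih
      have hθ : 0 ≤ (1 - κ) ^ j * c := mul_nonneg (pow_nonneg (by linarith) _) hc
      refine ⟨r / 12, by positivity, by linarith, fun y hy s hs => ?_⟩
      have hyr : y ∈ Metric.closedBall x0 r :=
        Metric.closedBall_subset_closedBall (by linarith) hy
      rw [pow_succ]
      by_cases hsF : s ∈ F
      · have h1 := (abs_le.1 (hvF y (Metric.closedBall_subset_closedBall hrρ hyr) s hsF)).1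
        have h2 : 0 ≤ (1 - κ) ^ j * (1 - κ) * c :=
          mul_nonneg (mul_nonneg (pow_nonneg (by linarith) _) (by linarith)) hc
        linarith
      · obtain ⟨a, b, haF, hbF, hsab, hab⟩ := hgap s hs hsF
        have hsub : Icc a b ⊆ Icc t1 t2 := Icc_subset_Icc (hF haF).1 (hF hbF).2
        have h1 := hlow _ x0 r a b ((1 - κ) ^ j * c) K hr (hGS _ r a b hrρ haF hbF hab hm) hKc hx0 hθ
          (fun y' hy' s' hs' => by
            have := (abs_le.1 (hvK y' hy' s' (hsub hs'))).1
            linarith)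
          (fun y' hy' => by
            have := (abs_le.1 (hvF y' (Metric.closedBall_subset_closedBall hrρ hy') a haF)).1
            linarith) y (by rwa [Metric.mem_closedBall, dist_eq_norm] at hy) s hsab
        linarith
  obtain ⟨j, hj⟩ : ∃ j : ℕ, (1 - κ) ^ j * c ≤ ω := by
    have h1 : Tendsto (fun j : ℕ => (1 - κ) ^ j * c) atTop (𝓝 (0 * c)) :=
      (tendsto_pow_atTop_nhds_zero_of_lt_one (by linarith) (by linarith)).mul_const c
    rw [zero_mul] at h1
    exact (h1.eventually (ge_mem_nhds hω)).exists
  obtain ⟨r, hr, hrρ, hm⟩ := hiter j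
  have hm' : ∀ y ∈ Metric.closedBall x0 r, ∀ s ∈ Icc t1 t2, c - 2 * ω ≤ v (y, s) := by
    intro y hy s hs
    have := hm y hy s hs
    linarith
  have hCω : ω ≤ C * ω := le_mul_of_one_le_left hω.le hC
  refine ⟨r / 12, by positivity, fun y hy s hs => ?_⟩
  have hyr : y ∈ Metric.closedBall x0 r :=
    Metric.closedBall_subset_closedBall (by linarith) hy
  by_cases hsF : s ∈ F
  · have := hvF y (Metric.closedBall_subset_closedBall hrρ hyr) s hsF
    linarith
  obtain ⟨a, b, haF, hbF, hsab, hab⟩ := hgap s hs hsF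
  have hsub : Icc a b ⊆ Icc t1 t2 := Icc_subset_Icc (hF haF).1 (hF hbF).2
  have h1 := hup _ x0 r a b (3 * ω) K hr (hGS _ r a b hrρ haF hbF hab hm') hKc hx0 (by linarith)
    (fun y' hy' s' hs' => by
      have := (abs_le.1 (hvK y' hy' s' (hsub hs'))).2
      linarith)
    (fun y' hy' => by
      have h2 := fun s' hs' =>
        (abs_le.1 (hvF y' (Metric.closedBall_subset_closedBall hrρ hy') s' hs')).2
      have h3 := h2 a haF
      have h4 := h2 b hbF
      constructor <;> linarith) y (by rwa [Metric.mem_closedBall, dist_eq_norm] at hy) s hsab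
  have h2 := hm' y hyr s hs
  rw [abs_le]
  constructor <;> linarith

theorem continuousAt_of_lipschitz_badSet {l L : ℝ} (hl : 0 < l) (hlL : l ≤ L) {v : E × ℝ → ℝ}
    {x0 : E} {t0 d N : ℝ} (hd : 0 < d) (hN : 0 < N)
    (hv : ∀ y ∈ Metric.closedBall x0 d, ∀ s ∈ Icc (t0 - d) (t0 + d),
      0 ≤ v (y, s) ∧ SolAt l L v (y, s))
    (h0 : (x0, t0) ∈ badSet v)
    (htime : ∀ x ∈ Metric.closedBall x0 d, ∀ t ∈ Icc (t0 - d) (t0 + d), (x, t) ∈ badSet v →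
      ∀ s, |s - t| ≤ 2 * d → |v (x, s) - v (x, t)| ≤ N * |s - t|)
    (hspace : ∀ x ∈ Metric.closedBall x0 d, ∀ t ∈ Icc (t0 - d) (t0 + d), (x, t) ∈ badSet v →
      ∀ y, ‖y - x‖ ≤ 2 * d → |v (y, t) - v (x, t)| ≤ N * ‖y - x‖) :
    ContinuousAt v (x0, t0) := by
  obtain ⟨C, hC, hosc⟩ := oscillation_near_badSet (E := E) hl hlL
  rw [Metric.continuousAt_iff]
  intro ε hε
  obtain ⟨ω, hω, hωε⟩ : ∃ ω, 0 < ω ∧ C * ω < ε :=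
    ⟨ε / (2 * C), by positivity, by field_simp; norm_num⟩
  obtain ⟨η, hη, hηd, hηω⟩ : ∃ η, 0 < η ∧ η ≤ d ∧ 8 * N * η ≤ ω :=
    ⟨min d (ω / (8 * N)), lt_min hd (by positivity), min_le_left _ _, by
      have := min_le_right d (ω / (8 * N))
      rw [le_div_iff₀ (by positivity)] at this
      linarith⟩
  have hNη : 0 < N * η := by positivity
  have hx0d : x0 ∈ Metric.closedBall x0 d := Metric.mem_closedBall_self hd.le
  have ht0d : t0 ∈ Icc (t0 - d) (t0 + d) := ⟨by linarith, by linarith⟩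
  have hslice : ∀ t ∈ Icc (t0 - d) (t0 + d), |t - t0| = η → ∃ ρ > 0, ∀ y ∈ Metric.closedBall x0 ρ,
      |v (y, t) - v (x0, t0)| ≤ ω := by
    intro t ht htη
    have h1 : ContinuousAt (fun y => v (y, t)) x0 := (hv x0 hx0d t ht).2.1.continuousAt
    obtain ⟨ρ, hρ, h2⟩ := Metric.continuousAt_iff.1 h1 (ω / 2) (by positivity)
    refine ⟨ρ / 2, by positivity, fun y hy => ?_⟩
    have h3 := h2 (lt_of_le_of_lt hy (by linarith))
    rw [Real.dist_eq] at h3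
    have h4 := htime x0 hx0d t0 ht0d h0 t (by rw [htη]; linarith)
    rw [htη] at h4
    have h5 := abs_sub_le (v (y, t)) (v (x0, t)) (v (x0, t0))
    linarith
  obtain ⟨ρ1, hρ1, hs1⟩ := hslice (t0 - η) ⟨by linarith, by linarith⟩ (by
    rw [sub_sub_cancel_left, abs_neg, abs_of_pos hη])
  obtain ⟨ρ2, hρ2, hs2⟩ := hslice (t0 + η) ⟨by linarith, by linarith⟩ (by
    rw [add_sub_cancel_left, abs_of_pos hη])
  obtain ⟨ρ, hρ, hρη, hρ1', hρ2'⟩ : ∃ ρ, 0 < ρ ∧ ρ ≤ η ∧ ρ ≤ ρ1 ∧ ρ ≤ ρ2 :=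
    ⟨min η (min ρ1 ρ2), lt_min hη (lt_min hρ1 hρ2), min_le_left _ _,
      (min_le_right _ _).trans (min_le_left _ _), (min_le_right _ _).trans (min_le_right _ _)⟩
  have hBd : Metric.closedBall x0 ρ ⊆ Metric.closedBall x0 d :=
    Metric.closedBall_subset_closedBall (by linarith)
  have hId : Icc (t0 - η) (t0 + η) ⊆ Icc (t0 - d) (t0 + d) :=
    Icc_subset_Icc (by linarith) (by linarith)
  have hcmp : IsCompact ((Metric.closedBall x0 ρ ×ˢ Icc (t0 - η) (t0 + η)) ∩ badSet v) :=
    ((isCompact_closedBall x0 ρ).prod isCompact_Icc).inter_right (isClosed_badSet v)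
  have hbad : ∀ x t, (x, t) ∈ (Metric.closedBall x0 ρ ×ˢ Icc (t0 - η) (t0 + η)) ∩ badSet v →
      |v (x, t) - v (x0, t0)| ≤ 2 * (N * η) := by
    rintro x t ⟨⟨hx, ht⟩, hxt⟩
    have h1 := htime x (hBd hx) t (hId ht) hxt t0 (by
      rw [abs_le]; constructor <;> linarith [ht.1, ht.2])
    have hx' : ‖x - x0‖ ≤ ρ := by rwa [Metric.mem_closedBall, dist_eq_norm] at hx
    have h2 := hspace x0 hx0d t0 ht0d h0 x (by linarith)
    have h3 : |t0 - t| ≤ η := by rw [abs_le]; constructor <;> linarith [ht.1, ht.2]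
    have h4 := abs_sub_le (v (x, t)) (v (x, t0)) (v (x0, t0))
    rw [abs_sub_comm] at h1
    have h5 : N * |t0 - t| ≤ N * η := by gcongr
    have h6 : N * ‖x - x0‖ ≤ N * η := by gcongr; linarith
    linarith
  obtain ⟨r, hr, hfin⟩ := hosc v x0 ρ (t0 - η) (t0 + η) (v (x0, t0)) ω
    (Prod.fst '' ((Metric.closedBall x0 ρ ×ˢ Icc (t0 - η) (t0 + η)) ∩ badSet v))
    (insert (t0 - η) (insert (t0 + η)
      (Prod.snd '' ((Metric.closedBall x0 ρ ×ˢ Icc (t0 - η) (t0 + η)) ∩ badSet v))))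
    hρ (by linarith) (hv x0 hx0d t0 ht0d).1 hω (hcmp.image continuous_fst)
    (((hcmp.image continuous_snd).insert _).insert _)
    ⟨(x0, t0), ⟨⟨Metric.mem_closedBall_self hρ.le, by linarith, by linarith⟩, h0⟩, rfl⟩
    (mem_insert _ _) (mem_insert_of_mem _ (mem_insert _ _))
    (by
      rintro s (rfl | rfl | ⟨q, hq, rfl⟩)
      · exact ⟨le_rfl, by linarith⟩
      · exact ⟨by linarith, le_rfl⟩
      · exact hq.1.2)
    (fun y hy s hs => hv y (hBd hy) s (hId hs))
    (by
      intro y hy s hs h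
      refine continuousAt_of_notMem_badSet fun hys => ?_
      rcases h with h | h
      · exact h ⟨(y, s), ⟨⟨hy, hs⟩, hys⟩, rfl⟩
      · exact h (mem_insert_of_mem _ (mem_insert_of_mem _ ⟨(y, s), ⟨⟨hy, hs⟩, hys⟩, rfl⟩)))
    (by
      rintro y ⟨⟨y', t⟩, hq, rfl⟩ s hs
      have h1 := hbad y' t hq
      have h3 : |s - t| ≤ 2 * η := by
        have h2 := hq.1.2
        simp only at h2
        rw [abs_le]; constructor <;> linarith [h2.1, h2.2, hs.1, hs.2]
      have h2 := htime y' (hBd hq.1.1) t (hId hq.1.2) hq.2 s (by linarith)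
      have h4 := abs_sub_le (v (y', s)) (v (y', t)) (v (x0, t0))
      have h5 : N * |s - t| ≤ N * (2 * η) := by gcongr
      simp only
      linarith)
    (by
      rintro y hy s (rfl | rfl | ⟨⟨x, t⟩, hq, rfl⟩)
      · exact hs1 y (Metric.closedBall_subset_closedBall hρ1' hy)
      · exact hs2 y (Metric.closedBall_subset_closedBall hρ2' hy)
      · have h1 := hbad x t hq
        have h3 : ‖y - x‖ ≤ 2 * ρ := by
          have h2 := hq.1.1
          rw [Metric.mem_closedBall] at h2 hy
          rw [← dist_eq_norm]
          linarith [dist_triangle_right y x x0]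
        have h2 := hspace x (hBd hq.1.1) t (hId hq.1.2) hq.2 y (by linarith)
        have h4 := abs_sub_le (v (y, t)) (v (x, t)) (v (x0, t0))
        have h5 : N * ‖y - x‖ ≤ N * (2 * η) := by gcongr; linarith
        simp only
        linarith)
  refine ⟨min r η, lt_min hr hη, fun {q} hq => ?_⟩
  obtain ⟨h1, h2⟩ := lt_min_iff.1 hq
  rw [Prod.dist_eq, max_lt_iff] at h1 h2
  have h3 := abs_lt.1 (Real.dist_eq _ _ ▸ h2.2)
  simp only at h3
  rw [Real.dist_eq]
  refine lt_of_le_of_lt (hfin q.1 h1.1.le q.2 ⟨by linarith, by linarith⟩) hωε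

/-- Points at which the time and space difference quotients of `v` at scales below `1 / N` are
bounded by `N`. -/
def lipSet (v : E × ℝ → ℝ) (N : ℝ) : Set (E × ℝ) :=
  {p | (∀ s, |s - p.2| < 1 / N → |v (p.1, s) - v p| ≤ N * |s - p.2|) ∧
    ∀ y, ‖y - p.1‖ < 1 / N → |v (y, p.2) - v p| ≤ N * ‖y - p.1‖}

theorem exists_mem_lipSet {l L : ℝ} {v : E × ℝ → ℝ} {p : E × ℝ} (h : SolAt l L v p) :
    ∃ M : ℝ, ∀ N, M ≤ N → p ∈ lipSet v N := by
  obtain ⟨hC, b, μ, hμ, hd⟩ := h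
  obtain ⟨c1, hc1⟩ := hd.isBigO_sub.bound
  obtain ⟨c2, hc2⟩ := (hC.differentiableAt (by norm_num)).hasFDerivAt.isBigO_sub.bound
  obtain ⟨e1, he1, h1⟩ := Metric.eventually_nhds_iff.1 hc1
  obtain ⟨e2, he2, h2⟩ := Metric.eventually_nhds_iff.1 hc2
  refine ⟨max (max c1 c2) (max (1 / e1) (1 / e2)), fun N hN => ?_⟩
  simp only [max_le_iff] at hN
  obtain ⟨⟨hN1, hN2⟩, hN3, hN4⟩ := hN
  have hNe : ∀ e : ℝ, 0 < e → 1 / e ≤ N → 1 / N ≤ e := fun e he h => by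
    have hN : 0 < N := lt_of_lt_of_le (by positivity) h
    rw [div_le_iff₀ hN]
    rw [div_le_iff₀ he] at h
    linarith
  refine ⟨fun s hs => ?_, fun y hy => ?_⟩
  · have := h1 (y := s) (by rw [Real.dist_eq]; linarith [hNe e1 he1 hN3])
    rw [Real.norm_eq_abs, Real.norm_eq_abs] at this
    exact this.trans (by gcongr)
  · have := h2 (y := y) (by rw [dist_eq_norm]; linarith [hNe e2 he2 hN4])
    rw [Real.norm_eq_abs] at this
    exact this.trans (by gcongr)

theorem lipSet_closed {l L : ℝ} {v : E × ℝ → ℝ} {N : ℝ} (hN : 0 < N) {f : ℕ → E × ℝ}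
    {p : E × ℝ} (hf : ∀ k, f k ∈ lipSet v N) (hp : Tendsto f atTop (𝓝 p))
    (hs : ∀ s, |s - p.2| < 1 / N → SolAt l L v (p.1, s))
    (hy : ∀ y, ‖y - p.1‖ < 1 / N → SolAt l L v (y, p.2)) : p ∈ lipSet v N := by
  have hp1 : Tendsto (fun k => (f k).1) atTop (𝓝 p.1) := (continuous_fst.tendsto p).comp hp
  have hp2 : Tendsto (fun k => (f k).2) atTop (𝓝 p.2) := (continuous_snd.tendsto p).comp hp
  have hN1 : 0 < 1 / N := by positivity
  have hvs : ∀ s, |s - p.2| < 1 / N →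
      Tendsto (fun k => v ((f k).1, s)) atTop (𝓝 (v (p.1, s))) := fun s h =>
    ((hs s h).1.continuousAt.tendsto).comp hp1
  have hvp : Tendsto (fun k => v (f k)) atTop (𝓝 (v p)) := by
    have h1 := hvs p.2 (by simpa using hN1)
    have h3 : Tendsto (fun k => |p.2 - (f k).2|) atTop (𝓝 0) := by
      have := (hp2.const_sub p.2).abs
      simpa using this
    have h2 : Tendsto (fun k => v ((f k).1, p.2) - v (f k)) atTop (𝓝 0) := by
      refine squeeze_zero_norm' ?_ (by simpa using h3.const_mul N)
      filter_upwards [h3.eventually (gt_mem_nhds hN1)] with k hk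
      exact (hf k).1 p.2 hk
    have := h1.sub h2
    simpa using this
  refine ⟨fun s hs' => ?_, fun y hy' => ?_⟩
  · refine le_of_tendsto_of_tendsto ((hvs s hs').sub hvp).abs
      (((hp2.const_sub s).abs).const_mul N) ?_
    filter_upwards [((hp2.const_sub s).abs).eventually (gt_mem_nhds hs')] with k hk
    exact (hf k).1 s hk
  · obtain ⟨_, _, _, _, hder⟩ := hy y hy'
    refine le_of_tendsto_of_tendsto
      (((hder.continuousAt.tendsto.comp hp2).sub hvp).abs)
      (((hp1.const_sub y).norm).const_mul N) ?_
    filter_upwards [((hp1.const_sub y).norm).eventually (gt_mem_nhds hy')] with k hk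
    exact (hf k).2 y hk

/-- A nonnegative function which is separately regular in space and time and solves a uniformly
parabolic equation pointwise is continuous. -/
theorem continuousOn_of_solAt {l L : ℝ} (hl : 0 < l) (hlL : l ≤ L) {v : E × ℝ → ℝ}
    {Ω : Set (E × ℝ)} (hΩ : IsOpen Ω) (hpos : ∀ p ∈ Ω, 0 ≤ v p) (hsol : ∀ p ∈ Ω, SolAt l L v p) :
    ∀ p ∈ Ω, ContinuousAt v p := by
  intro p0 hp0
  refine continuousAt_of_notMem_badSet fun hbad0 => ?_
  obtain ⟨ε, hε, hεΩ⟩ : ∃ ε, 0 < ε ∧ Metric.closedBall p0 (2 * ε) ⊆ Ω := by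
    obtain ⟨e, he, h⟩ := Metric.isOpen_iff.1 hΩ p0 hp0
    refine ⟨e / 4, by positivity, fun q hq => h ?_⟩
    rw [Metric.mem_closedBall] at hq
    rw [Metric.mem_ball]; linarith
  obtain ⟨X, hX⟩ : ∃ X, X = closure (badSet v ∩ Metric.ball p0 ε) := ⟨_, rfl⟩
  have hXc : IsClosed X := hX ▸ isClosed_closure
  have hXball : X ⊆ Metric.closedBall p0 ε := by
    rw [hX]
    exact closure_minimal (inter_subset_right.trans Metric.ball_subset_closedBall)
      Metric.isClosed_closedBall
  have hp0X : p0 ∈ X := hX ▸ subset_closure ⟨hbad0, Metric.mem_ball_self hε⟩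
  have hdom : ∀ p ∈ X, ∀ q, dist q p ≤ ε → q ∈ Ω := fun p hp q hq => hεΩ (by
    have := hXball hp
    rw [Metric.mem_closedBall] at this ⊢
    linarith [dist_triangle q p p0])
  have hNk : ∀ k : ℕ, 0 < (k : ℝ) + 1 / ε ∧ 1 / ((k : ℝ) + 1 / ε) ≤ ε := fun k => by
    have h1 : 0 < (k : ℝ) + 1 / ε := by positivity
    refine ⟨h1, ?_⟩
    rw [div_le_iff₀ h1, mul_add, mul_one_div_cancel hε.ne']
    have : 0 ≤ ε * (k : ℝ) := by positivity
    linarith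
  have hcl : ∀ k : ℕ, IsClosed ((fun p : X => (p : E × ℝ)) ⁻¹' lipSet v (k + 1 / ε)) := by
    intro k
    refine IsSeqClosed.isClosed fun f p hf hp => ?_
    refine lipSet_closed (l := l) (L := L) (hNk k).1 hf
      ((continuous_subtype_val.tendsto p).comp hp) (fun s hs => hsol _ (hdom p p.2 _ ?_))
      (fun y hy => hsol _ (hdom p p.2 _ ?_))
    · rw [Prod.dist_eq, max_le_iff]
      refine ⟨by simpa using hε.le, ?_⟩
      rw [Real.dist_eq]
      exact hs.le.trans (hNk k).2
    · rw [Prod.dist_eq, max_le_iff]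
      refine ⟨?_, by simpa using hε.le⟩
      rw [dist_eq_norm]
      exact hy.le.trans (hNk k).2
  have hcov : ⋃ k : ℕ, (fun p : X => (p : E × ℝ)) ⁻¹' lipSet v (k + 1 / ε) = univ := by
    refine eq_univ_of_forall fun p => ?_
    obtain ⟨M, hM⟩ := exists_mem_lipSet (hsol p (hdom p p.2 p (by simpa using hε.le)))
    obtain ⟨k, hk⟩ := exists_nat_ge M
    refine mem_iUnion.2 ⟨k, hM _ ?_⟩
    have : 0 < 1 / ε := by positivity
    linarith
  have : CompleteSpace X := hXc.completeSpace_coe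
  have : Nonempty X := ⟨⟨p0, hp0X⟩⟩
  obtain ⟨k, z, hz⟩ := nonempty_interior_of_iUnion_of_closed hcl hcov
  obtain ⟨V, hVsub, hVo, hzV⟩ := mem_interior.1 hz
  obtain ⟨U, hU, rfl⟩ := isOpen_induced_iff.1 hVo
  have hzX : (z : E × ℝ) ∈ closure (badSet v ∩ Metric.ball p0 ε) := hX ▸ z.2
  obtain ⟨⟨x1, t1⟩, hpU, hpbad, hpball⟩ := mem_closure_iff.1 hzX U hU hzV
  obtain ⟨N, hNdef⟩ : ∃ N : ℝ, N = k + 1 / ε := ⟨_, rfl⟩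
  have hN := hNk k
  rw [← hNdef] at hN hVsub
  obtain ⟨e, he, heU⟩ := Metric.isOpen_iff.1 (hU.inter Metric.isOpen_ball) (x1, t1) ⟨hpU, hpball⟩
  obtain ⟨d, hd, hde, hdN⟩ : ∃ d, 0 < d ∧ d < e ∧ 2 * d < 1 / N := by
    have h1 : 0 < 1 / N := by have := hN.1; positivity
    refine ⟨min (e / 2) (1 / N / 4), lt_min (by positivity) (by positivity), ?_, ?_⟩
    · linarith [min_le_left (e / 2) (1 / N / 4)]
    · linarith [min_le_right (e / 2) (1 / N / 4)]
  have hmem : ∀ x ∈ Metric.closedBall x1 d, ∀ t ∈ Icc (t1 - d) (t1 + d),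
      (x, t) ∈ U ∩ Metric.ball p0 ε := fun x hx t ht => heU (by
    rw [Metric.mem_ball, Prod.dist_eq, max_lt_iff]
    refine ⟨lt_of_le_of_lt hx hde, ?_⟩
    rw [Real.dist_eq, abs_lt]
    constructor <;> simp only <;> linarith [ht.1, ht.2])
  have hlip : ∀ x ∈ Metric.closedBall x1 d, ∀ t ∈ Icc (t1 - d) (t1 + d), (x, t) ∈ badSet v →
      (x, t) ∈ lipSet v N := fun x hx t ht hb => by
    have h1 := hmem x hx t ht
    have h2 : (x, t) ∈ X := hX ▸ subset_closure ⟨hb, h1.2⟩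
    exact hVsub (show (⟨(x, t), h2⟩ : X) ∈ _ from h1.1)
  have hcb : ∀ q, q ∈ Metric.ball p0 ε → q ∈ Ω := fun q hq => hεΩ (by
    rw [Metric.mem_ball] at hq
    rw [Metric.mem_closedBall]; linarith)
  have key : ∀ q ∈ Metric.ball (x1, t1) (d / 2), ContinuousAt v q := by
    intro q hq
    by_cases hqb : q ∈ badSet v
    · obtain ⟨x, t⟩ := q
      rw [Metric.mem_ball, Prod.dist_eq, max_lt_iff] at hq
      obtain ⟨hq1, hq2⟩ := hq
      simp only at hq1 hq2
      rw [Real.dist_eq, abs_lt] at hq2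
      have hB : Metric.closedBall x (d / 2) ⊆ Metric.closedBall x1 d :=
        Metric.closedBall_subset_closedBall' (by linarith)
      have hI : Icc (t - d / 2) (t + d / 2) ⊆ Icc (t1 - d) (t1 + d) :=
        Icc_subset_Icc (by linarith) (by linarith)
      refine continuousAt_of_lipschitz_badSet hl hlL (d := d / 2) (N := N) (by positivity) hN.1
        (fun y hy s hs => ?_) hqb (fun x' hx t' ht hb s hs => ?_) (fun x' hx t' ht hb y hy => ?_)
      · have h1 := hcb _ (hmem y (hB hy) s (hI hs)).2
        exact ⟨hpos _ h1, hsol _ h1⟩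
      · exact (hlip x' (hB hx) t' (hI ht) hb).1 s (by simp only; linarith)
      · exact (hlip x' (hB hx) t' (hI ht) hb).2 y (by simp only; linarith)
    · exact continuousAt_of_notMem_badSet hqb
  exact hpbad (by
    filter_upwards [Metric.ball_mem_nhds (x1, t1) (by positivity : 0 < d / 2)] with q hq
    exact key q hq)

end KrylovSafonov

namespace KrylovSafonov

open Set Filter Topology

theorem SolvesL.linear_combination {m : ℕ} {A : Spc m → Matrix (Fin (m + 1)) (Fin (m + 1)) ℝ}
    {u v : Spc m × ℝ → ℝ} {Ω : Set (Spc m × ℝ)} (hu : SolvesL A u Ω) (hv : SolvesL A v Ω)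
    (a b k : ℝ) : SolvesL A (fun q => a * u q + b * v q + k) Ω := by
  intro p hp
  obtain ⟨hu1, hu2⟩ := hu p hp
  obtain ⟨hv1, hv2⟩ := hv p hp
  refine ⟨((contDiffAt_const.mul hu1).add (contDiffAt_const.mul hv1)).add contDiffAt_const, ?_⟩
  have hdu : ∀ᶠ y in 𝓝 p.1, DifferentiableAt ℝ (fun z => u (z, p.2)) y := by
    filter_upwards [hu1.eventually (by simp)] with y hy
    exact hy.differentiableAt (by norm_num)
  have hdv : ∀ᶠ y in 𝓝 p.1, DifferentiableAt ℝ (fun z => v (z, p.2)) y := by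
    filter_upwards [hv1.eventually (by simp)] with y hy
    exact hy.differentiableAt (by norm_num)
  have hDu : ∀ e, DifferentiableAt ℝ (fun y => fderiv ℝ (fun z => u (z, p.2)) y e) p.1 := fun e =>
    ((hu1.fderiv_right (m := 1) (by norm_num)).differentiableAt (by norm_num)).clm_apply
      (differentiableAt_const e)
  have hDv : ∀ e, DifferentiableAt ℝ (fun y => fderiv ℝ (fun z => v (z, p.2)) y e) p.1 := fun e =>
    ((hv1.fderiv_right (m := 1) (by norm_num)).differentiableAt (by norm_num)).clm_apply
      (differentiableAt_const e)
  have hH : ∀ i j, sHess (fun q => a * u q + b * v q + k) p i j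
      = a * sHess u p i j + b * sHess v p i j := by
    intro i j
    unfold sHess
    have h1 : (fun y => fderiv ℝ (fun z => a * u (z, p.2) + b * v (z, p.2) + k) y (eVec m j))
        =ᶠ[𝓝 p.1] fun y => a * fderiv ℝ (fun z => u (z, p.2)) y (eVec m j)
          + b * fderiv ℝ (fun z => v (z, p.2)) y (eVec m j) := by
      filter_upwards [hdu, hdv] with y hy1 hy2
      rw [(((hy1.hasFDerivAt.const_mul a).fun_add (hy2.hasFDerivAt.const_mul b)).add_const k).fderiv]
      simp
    rw [h1.fderiv_eq, (((hDu (eVec m j)).hasFDerivAt.const_mul a).fun_add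
      ((hDv (eVec m j)).hasFDerivAt.const_mul b)).fderiv]
    simp
  have hL : Lop A (fun q => a * u q + b * v q + k) p = a * Lop A u p + b * Lop A v p := by
    unfold Lop
    rw [Finset.mul_sum, Finset.mul_sum, ← Finset.sum_add_distrib]
    refine Finset.sum_congr rfl fun i _ => ?_
    rw [Finset.mul_sum, Finset.mul_sum, ← Finset.sum_add_distrib]
    refine Finset.sum_congr rfl fun j _ => ?_
    rw [hH]; ring
  rw [hL]
  exact ((hu2.const_mul a).add (hv2.const_mul b)).add_const k

theorem SolvesL.solAt {m : ℕ} {A : Spc m → Matrix (Fin (m + 1)) (Fin (m + 1)) ℝ} {l L : ℝ}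
    (hA : IsElliptic l L A) {u : Spc m × ℝ → ℝ} {Ω : Set (Spc m × ℝ)} (hu : SolvesL A u Ω)
    {p : Spc m × ℝ} (hp : p ∈ Ω) : SolAt l L u p := by
  obtain ⟨h1, h2⟩ := hu p hp
  refine ⟨h1, ?_⟩
  have hherm : (A p.1).IsHermitian := by
    have := hA.1 p.1
    rw [Matrix.IsHermitian, Matrix.conjTranspose_eq_transpose_of_trivial]
    exact this
  obtain ⟨b, hb⟩ : ∃ b, b = hherm.eigenvectorBasis := ⟨_, rfl⟩
  obtain ⟨μ, hμ⟩ : ∃ μ, μ = hherm.eigenvalues := ⟨_, rfl⟩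
  have heig : ∀ k i, ∑ j, A p.1 i j * b k j = μ k * b k i := by
    intro k i
    have := congrFun (hherm.mulVec_eigenvectorBasis k) i
    rw [← hb, ← hμ] at this
    simpa [Matrix.mulVec, dotProduct] using this
  have hentry : ∀ i j, A p.1 i j = ∑ k, μ k * (b k i * b k j) := by
    intro i j
    have h3 : (∑ k, b k j • b k : Spc m) = EuclideanSpace.single j 1 := by
      conv_rhs => rw [← b.sum_repr (EuclideanSpace.single j 1)]
      refine Finset.sum_congr rfl fun k _ => ?_
      rw [b.repr_apply_apply]
      simp [EuclideanSpace.inner_single_right]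
    have h4 : ∀ j', ∑ k, b k j * b k j' = if j' = j then 1 else 0 := by
      intro j'
      have := congrArg (fun x : Spc m => x j') h3
      simpa [Finset.sum_apply] using this
    calc A p.1 i j = ∑ j', A p.1 i j' * (if j' = j then 1 else 0) := by simp
      _ = ∑ j', A p.1 i j' * ∑ k, b k j * b k j' := by simp_rw [h4]
      _ = ∑ k, b k j * ∑ j', A p.1 i j' * b k j' := by
          simp_rw [Finset.mul_sum]
          rw [Finset.sum_comm]
          refine Finset.sum_congr rfl fun k _ => Finset.sum_congr rfl fun j' _ => by ring
      _ = _ := by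
          refine Finset.sum_congr rfl fun k _ => ?_
          rw [heig]; ring
  have hfin : Module.finrank ℝ (Spc m) = m + 1 := finrank_euclideanSpace_fin
  let e : Fin (m + 1) ≃ Fin (Module.finrank ℝ (Spc m)) := finCongr hfin.symm
  refine ⟨b.reindex e, fun k => μ (e.symm k), fun k => ?_, ?_⟩
  · have h3 := hA.2 p.1 (b (e.symm k))
    rw [b.orthonormal.1] at h3
    have h4 : ∑ i, ∑ j, b (e.symm k) i * A p.1 i j * b (e.symm k) j = μ (e.symm k) := by
      have h5 : ∑ i, b (e.symm k) i ^ 2 = 1 := by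
        have := EuclideanSpace.real_norm_sq_eq (b (e.symm k))
        rw [b.orthonormal.1] at this
        linarith
      calc _ = ∑ i, b (e.symm k) i * ∑ j, A p.1 i j * b (e.symm k) j := by
            simp_rw [Finset.mul_sum, mul_assoc]
        _ = μ (e.symm k) * ∑ i, b (e.symm k) i ^ 2 := by
            simp_rw [heig, Finset.mul_sum]
            refine Finset.sum_congr rfl fun i _ => by ring
        _ = _ := by rw [h5, mul_one]
    rw [h4] at h3
    simpa using h3
  · convert h2 using 1
    have hH : ∀ i j, sHess u p i j
        = fderiv ℝ (fderiv ℝ fun z => u (z, p.2)) p.1 (eVec m i) (eVec m j) := by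
      intro i j
      unfold sHess
      have h5 : DifferentiableAt ℝ (fderiv ℝ fun z => u (z, p.2)) p.1 :=
        (h1.fderiv_right (m := 1) (by norm_num)).differentiableAt (by norm_num)
      rw [(h5.hasFDerivAt.clm_apply (hasFDerivAt_const (eVec m j) p.1)).fderiv]
      simp
    have hb' : ∀ k, b k = ∑ i, b k i • eVec m i := by
      intro k
      ext i
      simp [eVec, Finset.sum_apply, Pi.single_apply]
    rw [← e.sum_comp]
    simp only [OrthonormalBasis.reindex_apply, Equiv.symm_apply_apply]
    have hq : ∀ k, hess u p (b k) = ∑ i, ∑ j, b k i * b k j * sHess u p j i := by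
      intro k
      unfold hess
      conv_lhs => rw [hb' k]
      simp only [map_sum, map_smul, _root_.sum_apply, _root_.smul_apply,
        smul_eq_mul, Finset.mul_sum]
      refine Finset.sum_congr rfl fun i _ => Finset.sum_congr rfl fun j _ => ?_
      rw [hH]; ring
    simp_rw [hq]
    unfold Lop
    simp_rw [hentry, Finset.sum_mul, Finset.mul_sum]
    rw [Finset.sum_comm]
    refine Finset.sum_congr rfl fun i _ => ?_
    rw [Finset.sum_comm]
    refine Finset.sum_congr rfl fun j _ => Finset.sum_congr rfl fun k _ => by ring

end KrylovSafonov

namespace KrylovSafonov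

open Set Filter Topology

variable {E : Type*} [NormedAddCommGroup E] [InnerProductSpace ℝ E] [FiniteDimensional ℝ E]

/-- Reflection in the hyperplane orthogonal to the unit vector `ν`. -/
def mirror (ν x : E) : E := x - (2 * inner ℝ ν x) • ν

theorem inner_mirror {ν : E} (hν : ‖ν‖ = 1) (x : E) : inner ℝ ν (mirror ν x) = -inner ℝ ν x := by
  rw [mirror, inner_sub_right, inner_smul_right, real_inner_self_eq_norm_sq, hν]
  ring

theorem norm_mirror_sub {ν x0 : E} (hν : ‖ν‖ = 1) (hx0 : inner ℝ ν x0 = 0) (x : E) :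
    ‖mirror ν x - x0‖ = ‖x - x0‖ := by
  have h : ‖mirror ν x - x0‖ ^ 2 = ‖x - x0‖ ^ 2 := by
    have e : mirror ν x - x0 = (x - x0) - (2 * inner ℝ ν x) • ν := by
      rw [mirror]; abel
    rw [e, norm_sub_sq_real, inner_smul_right, norm_smul, hν, mul_one, Real.norm_eq_abs, sq_abs,
      real_inner_comm ν (x - x0), inner_sub_right, hx0]
    ring
  exact (sq_eq_sq₀ (norm_nonneg _) (norm_nonneg _)).1 h

theorem norm_mirror {ν : E} (hν : ‖ν‖ = 1) (x : E) : ‖mirror ν x‖ = ‖x‖ := by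
  simpa using norm_mirror_sub hν (inner_zero_right ν) x

theorem inner_sub_le_norm {ν : E} (hν : ‖ν‖ = 1) (x y : E) :
    inner ℝ ν x - inner ℝ ν y ≤ ‖x - y‖ := by
  rw [← inner_sub_right]
  have := real_inner_le_norm ν (x - y)
  rwa [hν, one_mul] at this

/-- Interior improvement: a supersolution which is at least `-a` and is large away from the
hyperplane is also large at half the distance. -/
theorem lower_bound_near_hyperplane {l L : ℝ} (hl : 0 < l) :
    ∃ c : ℝ, 0 < c ∧ c ≤ 1 ∧ ∀ (ν : E) (w : E × ℝ → ℝ) (y : E) (s e a b : ℝ), ‖ν‖ = 1 → 0 < e →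
      0 ≤ a → 0 ≤ b →
      e / 2 ≤ inner ℝ ν y →
      (∀ x t, ‖x - y‖ ≤ 9 / 4 * e → s - 21 / 16 * e ^ 2 ≤ t → t ≤ s → 0 < inner ℝ ν x →
        ContinuousAt w (x, t) ∧ SolAt l L w (x, t) ∧ -a ≤ w (x, t)) →
      (∀ x, ‖x - y‖ ≤ 9 / 4 * e → e ≤ inner ℝ ν x → b ≤ w (x, s - 21 / 16 * e ^ 2)) →
      c * b - a ≤ w (y, s) := by
  obtain ⟨α, hα⟩ := expansion (E := E) (l := l) (L := L) (B := 1) hl (by norm_num)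
  have hα1 : (4 / 25 : ℝ) ^ α ≤ 1 := pow_le_one₀ (by norm_num) (by norm_num)
  have hα0 : (0 : ℝ) < (4 / 25 : ℝ) ^ α := by positivity
  refine ⟨(4 / 25) ^ α * (9 / 25) ^ 2, by positivity, by norm_num; linarith, ?_⟩
  intro ν w y s e a b hν he ha hb hy hw hwb
  have hze : ‖(y + e • ν) - y‖ = e := by
    rw [add_sub_cancel_left, norm_smul, hν, mul_one, Real.norm_of_nonneg he.le]
  have hνz : inner ℝ ν (y + e • ν) = inner ℝ ν y + e := by
    rw [inner_add_right, inner_smul_right, real_inner_self_eq_norm_sq, hν]; ring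
  have hnear : ∀ x, ‖x - (y + e • ν)‖ ≤ 5 / 4 * e →
      ‖x - y‖ ≤ 9 / 4 * e ∧ inner ℝ ν y + e - ‖x - (y + e • ν)‖ ≤ inner ℝ ν x := by
    intro x hx
    have h1 := norm_sub_le_norm_sub_add_norm_sub x (y + e • ν) y
    have h2 := inner_sub_le_norm hν (y + e • ν) x
    rw [norm_sub_rev (y + e • ν) x, hνz] at h2
    constructor <;> linarith
  have hps : PosSol l L (fun q => 1 * w q + a)
      (Metric.closedBall (y + e • ν) (5 / 4 * e) ×ˢ Icc (s - 21 / 16 * e ^ 2) s) := by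
    have h0 : ∀ p ∈ Metric.closedBall (y + e • ν) (5 / 4 * e) ×ˢ Icc (s - 21 / 16 * e ^ 2) s,
        ContinuousAt w p ∧ SolAt l L w p ∧ -a ≤ w p := by
      rintro ⟨x, t⟩ ⟨hx, h1, h2⟩
      rw [Metric.mem_closedBall, dist_eq_norm] at hx
      obtain ⟨h3, h4⟩ := hnear x hx
      exact hw x t h3 h1 h2 (by simp only at hx; linarith)
    exact ⟨fun p hp => (((h0 p hp).1.const_mul 1).add_const a).continuousWithinAt,
      fun p hp => by have := (h0 p hp).2.2; linarith, fun p hp => (h0 p hp).2.1.affine 1 a⟩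
  have h1 := hα _ (y + e • ν) (5 / 4 * e) (s - 21 / 16 * e ^ 2) s (e ^ 2 / 4) b (by positivity)
    (by positivity) hb (by linarith only) hps (fun x hx => by
      have h2 : ‖x - (y + e • ν)‖ ≤ e / 2 :=
        (abs_le_of_sq_le_sq' (a := ‖x - (y + e • ν)‖) (by linarith) (by positivity)).2
      obtain ⟨h3, h4⟩ := hnear x (by linarith)
      have := hwb x h3 (by linarith)
      linarith) y s (by rw [norm_sub_rev, hze]; linarith) (by
        have := sq_nonneg e; linarith) le_rfl
  rw [norm_sub_rev, hze] at h1
  have he2 : 0 < e ^ 2 := by positivity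
  have e1 : e ^ 2 / 4 / (e ^ 2 / 4 + (s - (s - 21 / 16 * e ^ 2))) = 4 / 25 := by
    rw [div_eq_iff (by nlinarith)]; ring
  have e2 : max (1 - e ^ 2 / (1 * (e ^ 2 / 4 + (s - (s - 21 / 16 * e ^ 2))))) 0 = 9 / 25 := by
    have : e ^ 2 / (1 * (e ^ 2 / 4 + (s - (s - 21 / 16 * e ^ 2)))) = 16 / 25 := by
      rw [div_eq_iff (by nlinarith)]; ring
    rw [this]; norm_num
  rw [e1, e2] at h1
  linarith

/-- Iteration on dyadic cylinders: a solution in a slit cylinder which is slightly negative near the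
slit but large away from it is nonnegative on the axis. -/
theorem slit_iteration {l L : ℝ} (hl : 0 < l) (hlL : l ≤ L) :
    ∃ δ A : ℝ, 0 < δ ∧ δ ≤ 1 / 5 ∧ 0 < A ∧ ∀ (ν x0 : E) (t0 r : ℝ) (S : Set (E × ℝ))
      (w : E × ℝ → ℝ), ‖ν‖ = 1 → inner ℝ ν x0 = 0 → 0 < r → IsClosed S →
      (∀ p ∈ S, inner ℝ ν p.1 = 0) →
      (∀ p ∈ Metric.closedBall x0 r ×ˢ Icc (t0 - r ^ 2) t0, p ∉ S →
        ContinuousAt w p ∧ SolAt l L w p ∧ w (mirror ν p.1, p.2) = w p ∧ -1 ≤ w p) →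
      ContinuousOn (fun p => if p ∈ S then 0 else max (-w p) 0)
        (Metric.closedBall x0 r ×ˢ Icc (t0 - r ^ 2) t0) →
      (∀ p ∈ Metric.closedBall x0 r ×ˢ Icc (t0 - r ^ 2) t0, δ * r ≤ |inner ℝ ν p.1| → A ≤ w p) →
      ∀ h, |h| ≤ r → (x0 + h • ν, t0) ∉ S → 0 ≤ w (x0 + h • ν, t0) := by
  obtain ⟨Γ, hΓ, hstrip⟩ := strip_bound (E := E) (l := l) (L := L) hl (hl.le.trans hlL)
  obtain ⟨c, hc, hc1, hlow⟩ := lower_bound_near_hyperplane (E := E) (l := l) (L := L) hl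
  obtain ⟨δ, hδ, hδ5, hδq⟩ : ∃ δ : ℝ, 0 < δ ∧ δ ≤ 1 / 5 ∧ 4 * Γ * δ ^ 2 ≤ c / 2 := by
    refine ⟨min (1 / 5) (c / (8 * Γ)), lt_min (by norm_num) (by positivity), min_le_left _ _, ?_⟩
    have h1 := min_le_left (1 / 5) (c / (8 * Γ))
    have h2 := min_le_right (1 / 5) (c / (8 * Γ))
    have h3 : 0 < min (1 / 5) (c / (8 * Γ)) := lt_min (by norm_num) (by positivity)
    rw [le_div_iff₀ (by positivity)] at h2
    nlinarith
  obtain ⟨q, hq⟩ : ∃ q, q = 4 * Γ * δ ^ 2 := ⟨_, rfl⟩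
  have hq0 : 0 < q := by rw [hq]; positivity
  rw [← hq] at hδq
  have hA0 : 0 < 2 / c := by positivity
  have hcA : c * (2 / c) = 2 := by field_simp
  refine ⟨δ, 2 / c, hδ, hδ5, hA0, ?_⟩
  intro ν x0 t0 r S w hν hx0 hr hS hSν hw hcont hA h hh hhS
  obtain ⟨ρ, hρ⟩ : ∃ ρ : ℕ → ℝ, ∀ k, ρ k = r * (1 / 2) ^ k := ⟨_, fun _ => rfl⟩
  have hρ0 : ∀ k, 0 < ρ k := fun k => by rw [hρ]; positivity
  have hρr : ∀ k, ρ k ≤ r := fun k => by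
    rw [hρ]; exact mul_le_of_le_one_right hr.le (pow_le_one₀ (by norm_num) (by norm_num))
  have hρs : ∀ k, ρ (k + 1) = ρ k / 2 := fun k => by rw [hρ, hρ, pow_succ]; ring
  have hsubk : ∀ k, Metric.closedBall x0 (ρ k) ×ˢ Icc (t0 - ρ k ^ 2) t0 ⊆
      Metric.closedBall x0 r ×ˢ Icc (t0 - r ^ 2) t0 := fun k =>
    Set.prod_mono (Metric.closedBall_subset_closedBall (hρr k)) (Icc_subset_Icc (by
      have := pow_le_pow_left₀ (hρ0 k).le (hρr k) 2
      linarith) le_rfl)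
  have hmain : ∀ k : ℕ, ∀ p ∈ Metric.closedBall x0 (ρ k) ×ˢ Icc (t0 - ρ k ^ 2) t0, p ∉ S →
      -q ^ k ≤ w p ∧ (δ * ρ k ≤ |inner ℝ ν p.1| → 2 / c * q ^ k ≤ w p) := by
    intro k
    induction k with
    | zero =>
      intro p hp hpS
      have hp' := hsubk 0 hp
      refine ⟨by simpa using (hw p hp' hpS).2.2.2, fun h => ?_⟩
      rw [pow_zero, mul_one]
      exact hA p hp' (by simpa [hρ] using h)
    | succ k ih =>
      rintro ⟨x1, t1⟩ ⟨hx1, ht1, ht1'⟩ hpS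
      have hqk : 0 < q ^ k := by positivity
      have hρk := hρ0 k
      rw [hρs] at hx1 ht1 ⊢
      simp only at hx1 ht1 ht1'
      rw [Metric.mem_closedBall, dist_eq_norm] at hx1
      have hρk2 : 0 < ρ k ^ 2 := by positivity
      refine ⟨?_, ?_⟩
      · have hQ : Metric.closedBall x1 (ρ k / 2) ×ˢ Icc (t1 - (ρ k / 2) ^ 2) t1 ⊆
            Metric.closedBall x0 (ρ k) ×ˢ Icc (t0 - ρ k ^ 2) t0 :=
          Set.prod_mono (Metric.closedBall_subset_closedBall' (by rw [dist_eq_norm]; linarith))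
            (Icc_subset_Icc (by nlinarith) ht1')
        have h1 := hstrip (fun p => if p ∈ S then 0 else max (-w p) 0) x1 ν (ρ k / 2) t1 (δ * ρ k) 0
          (q ^ k) hν (by positivity) hqk (hcont.mono (hQ.trans (hsubk k)))
          (by
            intro p hp hpos _
            by_cases hpS' : p ∈ S
            · simp [hpS'] at hpos
            simp only [hpS', if_false] at hpos
            have hwp : w p < 0 := by
              rcases lt_max_iff.1 hpos with h2 | h2
              · linarith
              · exact absurd h2 (lt_irrefl _)
            obtain ⟨h2, h3, -, -⟩ := hw p (hsubk k (hQ hp)) hpS'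
            refine (h3.affine (-1) 0).congr ?_
            filter_upwards [hS.isOpen_compl.mem_nhds hpS', h2.eventually (gt_mem_nhds hwp)]
              with p' h4 h5
            have h4' : p' ∉ S := h4
            simp only [h4', if_false]
            rw [max_eq_left (by linarith)]
            ring)
          (by
            intro p hp hph
            by_cases hpS' : p ∈ S
            · simp [hpS']
            simp only [hpS', if_false]
            have h2 := (ih p (hQ hp) hpS').2 hph
            have h3 : 0 < 2 / c * q ^ k := by positivity
            exact max_le (by linarith) le_rfl)
          (by
            intro p hp
            by_cases hpS' : p ∈ S
            · simp [hpS', hqk.le]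
            simp only [hpS', if_false]
            have h2 := (ih p (hQ hp) hpS').1
            exact max_le (by linarith) (by linarith))
        simp only [hpS, if_false] at h1
        have h2 : 0 + q ^ k * (Γ * (δ * ρ k) ^ 2 / (ρ k / 2) ^ 2) = q ^ (k + 1) := by
          rw [pow_succ, hq]
          field_simp
          ring
        rw [h2] at h1
        linarith [le_max_left (-w (x1, t1)) 0]
      · intro hx
        have key : ∀ y, ‖y - x0‖ ≤ ρ k / 2 → δ * (ρ k / 2) ≤ inner ℝ ν y →
            2 / c * q ^ (k + 1) ≤ w (y, t1) := by
          intro y hy hyν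
          have hδρ : 0 < δ * ρ k := by positivity
          have hδρ5 : δ * ρ k ≤ ρ k / 5 := by nlinarith
          have hmem : ∀ x t, ‖x - y‖ ≤ 9 / 4 * (δ * ρ k) → t1 - 21 / 16 * (δ * ρ k) ^ 2 ≤ t →
              t ≤ t1 → (x, t) ∈ Metric.closedBall x0 (ρ k) ×ˢ Icc (t0 - ρ k ^ 2) t0 := by
            intro x t h1 h2 h3
            refine ⟨?_, ?_, h3.trans ht1'⟩
            · rw [Metric.mem_closedBall, dist_eq_norm]
              have := norm_sub_le_norm_sub_add_norm_sub x y x0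
              simp only
              linarith
            · simp only
              have : (δ * ρ k) ^ 2 ≤ (ρ k / 5) ^ 2 := by gcongr
              nlinarith
          have h1 := hlow ν w y t1 (δ * ρ k) (q ^ k) (2 / c * q ^ k) hν hδρ hqk.le (by positivity)
            (by linarith)
            (fun x t h1 h2 h3 h4 => by
              have h5 := hmem x t h1 h2 h3
              have h6 : (x, t) ∉ S := fun h6 => h4.ne' (hSν _ h6)
              obtain ⟨h7, h8, -, -⟩ := hw _ (hsubk k h5) h6
              exact ⟨h7, h8, (ih _ h5 h6).1⟩)
            (fun x h1 h2 => by
              have h5 := hmem x (t1 - 21 / 16 * (δ * ρ k) ^ 2) h1 le_rfl (by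
                have : 0 < (δ * ρ k) ^ 2 := by positivity
                linarith)
              have h6 : (x, t1 - 21 / 16 * (δ * ρ k) ^ 2) ∉ S := fun h6 => by
                have := hSν _ h6
                simp only at this
                linarith
              exact (ih _ h5 h6).2 (h2.trans (le_abs_self _)))
          rw [← mul_assoc, hcA] at h1
          have h2 : 2 / c * q ^ (k + 1) ≤ q ^ k := by
            have h3 : 2 / c * q ≤ 1 := by
              rw [div_mul_eq_mul_div, div_le_one hc]; linarith
            rw [pow_succ]
            nlinarith
          linarith
        rcases le_total 0 (inner ℝ ν x1) with h0 | h0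
        · exact key x1 hx1 (by rwa [abs_of_nonneg h0] at hx)
        · have h1 := (hw (x1, t1) (hsubk k ⟨by
            rw [Metric.mem_closedBall, dist_eq_norm]; simp only; linarith, by
              simp only; nlinarith, ht1'⟩) hpS).2.2.1
          rw [← h1]
          refine key (mirror ν x1) (by rwa [norm_mirror_sub hν hx0]) ?_
          rw [inner_mirror hν]
          rwa [abs_of_nonpos h0] at hx
  have hq1 : q < 1 := by linarith
  have hνh : inner ℝ ν (x0 + h • ν) = h := by
    rw [inner_add_right, inner_smul_right, real_inner_self_eq_norm_sq, hν, hx0]; ring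
  have hnh : ‖x0 + h • ν - x0‖ = |h| := by
    rw [add_sub_cancel_left, norm_smul, hν, mul_one, Real.norm_eq_abs]
  have hin : ∀ k, |h| ≤ ρ k →
      (x0 + h • ν, t0) ∈ Metric.closedBall x0 (ρ k) ×ˢ Icc (t0 - ρ k ^ 2) t0 := by
    intro k hk
    refine ⟨by rwa [Metric.mem_closedBall, dist_eq_norm, hnh], ?_, le_rfl⟩
    simp only
    have := sq_nonneg (ρ k)
    linarith
  by_cases hh0 : h = 0
  · have h1 : ∀ k : ℕ, 0 ≤ w (x0 + h • ν, t0) + q ^ k := fun k => by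
      have := (hmain k _ (hin k (by rw [hh0, abs_zero]; exact (hρ0 k).le)) hhS).1
      linarith
    have h2 : Tendsto (fun k : ℕ => w (x0 + h • ν, t0) + q ^ k) atTop
        (𝓝 (w (x0 + h • ν, t0) + 0)) :=
      (tendsto_pow_atTop_nhds_zero_of_lt_one hq0.le hq1).const_add _
    rw [add_zero] at h2
    exact ge_of_tendsto' h2 h1
  · have hpos : 0 < |h| := abs_pos.2 hh0
    have hex : ∃ k, δ * ρ k ≤ |h| := by
      have h1 : Tendsto (fun k : ℕ => δ * (r * (1 / 2 : ℝ) ^ k)) atTop (𝓝 (δ * (r * 0))) :=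
        ((tendsto_pow_atTop_nhds_zero_of_lt_one (by norm_num) (by norm_num)).const_mul r).const_mul δ
      rw [mul_zero, mul_zero] at h1
      obtain ⟨k, hk⟩ := (h1.eventually (ge_mem_nhds hpos)).exists
      exact ⟨k, by rwa [hρ]⟩
    have hk := Nat.find_spec hex
    have hle : |h| ≤ ρ (Nat.find hex) := by
      rcases hn : Nat.find hex with _ | j
      · simpa [hρ] using hh
      · have h1 := Nat.find_min hex (m := j) (by omega)
        push Not at h1
        rw [hρs]
        have := hρ0 j
        nlinarith
    have h1 := (hmain _ _ (hin _ hle) hhS).2 (by simp only; rwa [hνh])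
    have h2 : 0 < 2 / c * q ^ Nat.find hex := by positivity
    linarith

end KrylovSafonov

namespace KrylovSafonov

open Set Filter Topology

variable {E : Type*} [NormedAddCommGroup E] [InnerProductSpace ℝ E] [FiniteDimensional ℝ E]

/-- A positive continuous solution in the unit cylinder minus the slit `S`, even with respect to the
hyperplane orthogonal to `ν`. -/
structure SlitSol (l L : ℝ) (ν : E) (S : Set (E × ℝ)) (u : E × ℝ → ℝ) : Prop where
  unit : ‖ν‖ = 1
  closed : IsClosed S
  slit : ∀ p ∈ S, inner ℝ ν p.1 = 0
  reg : ∀ x t, ‖x‖ < 1 → -1 < t → t < 1 → (x, t) ∉ S →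
    ContinuousAt u (x, t) ∧ SolAt l L u (x, t) ∧ 0 < u (x, t) ∧ u (mirror ν x, t) = u (x, t)

theorem SlitSol.posSol {l L : ℝ} {ν : E} {S : Set (E × ℝ)} {u : E × ℝ → ℝ}
    (hu : SlitSol l L ν S u) {s : Set (E × ℝ)}
    (h : ∀ x t, (x, t) ∈ s → ‖x‖ < 1 ∧ -1 < t ∧ t < 1 ∧ 0 < inner ℝ ν x) : PosSol l L u s := by
  have h0 : ∀ p ∈ s, ContinuousAt u p ∧ SolAt l L u p ∧ 0 < u p ∧ u (mirror ν p.1, p.2) = u p := by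
    rintro ⟨x, t⟩ hp
    obtain ⟨h1, h2, h3, h4⟩ := h x t hp
    exact hu.reg x t h1 h2 h3 fun h5 => h4.ne' (hu.slit _ h5)
  exact ⟨fun p hp => (h0 p hp).1.continuousWithinAt, fun p hp => (h0 p hp).2.2.1.le,
    fun p hp => (h0 p hp).2.1⟩

/-- Harnack inequality between points of the upper half of the cylinder. -/
theorem SlitSol.harnack_upper {l L : ℝ} (hl : 0 < l) (hlL : l ≤ L) {ρ : ℝ} (hρ : 0 < ρ)
    (hρ1 : ρ ≤ 1 / 20) :
    ∃ C : ℝ, 1 ≤ C ∧ ∀ (ν : E) (S : Set (E × ℝ)) (u : E × ℝ → ℝ), SlitSol l L ν S u →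
      ∀ x y t s, ‖x‖ ≤ 9 / 10 → ‖y‖ ≤ 9 / 10 → ρ ≤ inner ℝ ν x → ρ ≤ inner ℝ ν y →
        -(9 / 10) ≤ t → s ≤ 9 / 10 → ρ ≤ s - t → u (x, t) ≤ C * u (y, s) := by
  obtain ⟨C, hC, hH⟩ := harnack_segment (E := E) hl hlL (D := 8 / ρ ^ 2) (τ0 := 1) one_pos
  refine ⟨C, hC, ?_⟩
  intro ν S u hu x y t s hx hy hνx hνy ht hs hst
  have hρ2 : ρ ^ 2 ≤ ρ / 20 := by nlinarith
  have hρ20 : 0 < ρ ^ 2 := by positivity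
  have h8 : 8 / ρ ^ 2 * (ρ / 2) ^ 2 = 2 := by field_simp; norm_num
  refine hH u x y t s (ρ / 2) (by positivity) (by nlinarith) (by rw [h8]; linarith) ?_ ?_
  · have h1 := norm_sub_le y x
    have h2 : 2 ≤ 8 / ρ ^ 2 * (ρ / 2) := by
      have : 8 / ρ ^ 2 * (ρ / 2) = 4 / ρ := by field_simp; norm_num
      rw [this, le_div_iff₀ hρ]; linarith
    linarith
  · intro θ hθ
    refine hu.posSol fun z τ hz => ?_
    obtain ⟨hz1, hz2, hz3⟩ := hz
    simp only at hz1 hz2 hz3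
    rw [Metric.mem_closedBall, dist_eq_norm] at hz1
    have hw : x + θ • (y - x) = (1 - θ) • x + θ • y := by
      rw [smul_sub, sub_smul, one_smul]; abel
    rw [hw] at hz1
    have h1 : ‖(1 - θ) • x + θ • y‖ ≤ 9 / 10 := by
      refine (norm_add_le _ _).trans ?_
      rw [norm_smul, norm_smul, Real.norm_of_nonneg hθ.1, Real.norm_of_nonneg (by linarith [hθ.2])]
      nlinarith [hθ.1, hθ.2]
    have h2 : ρ ≤ inner ℝ ν ((1 - θ) • x + θ • y) := by
      rw [inner_add_right, inner_smul_right, inner_smul_right]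
      nlinarith [hθ.1, hθ.2]
    have h3 := norm_le_norm_add_norm_sub ((1 - θ) • x + θ • y) z
    rw [norm_sub_rev] at h3
    have h4 := inner_sub_le_norm hu.unit ((1 - θ) • x + θ • y) z
    rw [norm_sub_rev] at h4
    refine ⟨by linarith, by nlinarith, by linarith, by linarith⟩

/-- Polynomial growth of solutions near the hyperplane. -/
theorem SlitSol.polynomial_bound {l L : ℝ} (hl : 0 < l) (hlL : l ≤ L) :
    ∃ (C : ℝ) (K : ℕ), 1 ≤ C ∧ ∀ (ν : E) (S : Set (E × ℝ)) (u : E × ℝ → ℝ), SlitSol l L ν S u →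
      ∀ x t, ‖x‖ ≤ 3 / 4 → -(1 / 2) ≤ t → t ≤ 7 / 20 → inner ℝ ν x ≠ 0 →
        |inner ℝ ν x| ^ K * u (x, t) ≤ C * u ((1 / 2 : ℝ) • ν, 1 / 2) := by
  obtain ⟨C0, hC0, hbase⟩ := SlitSol.harnack_upper (E := E) hl hlL (ρ := 1 / 32) (by norm_num)
    (by norm_num)
  obtain ⟨C1, hC1, hH⟩ := harnack_segment (E := E) hl hlL (D := 4) (τ0 := 4) (by norm_num)
  obtain ⟨K, hK⟩ := pow_unbounded_of_one_lt C1 (one_lt_two : (1 : ℝ) < 2)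
  refine ⟨C0, K, hC0, ?_⟩
  intro ν S u hu
  have hν := hu.unit
  have hhalf : ‖(1 / 2 : ℝ) • ν‖ = 1 / 2 := by rw [norm_smul, hν]; norm_num
  have hihalf : inner ℝ ν ((1 / 2 : ℝ) • ν) = 1 / 2 := by
    rw [inner_smul_right, real_inner_self_eq_norm_sq, hν]; norm_num
  have hB : ∀ x t, ‖x‖ ≤ 9 / 10 → -(1 / 2) ≤ t → t ≤ 2 / 5 → 1 / 32 ≤ inner ℝ ν x →
      inner ℝ ν x ^ K * u (x, t) ≤ C0 * u ((1 / 2 : ℝ) • ν, 1 / 2) := by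
    intro x t hx ht1 ht2 hxν
    have h1 := hbase ν S u hu x ((1 / 2 : ℝ) • ν) t (1 / 2) hx (by rw [hhalf]; norm_num) hxν
      (by rw [hihalf]; norm_num) (by linarith) (by norm_num) (by linarith)
    have h2 : inner ℝ ν x ≤ 1 := by
      have := real_inner_le_norm ν x
      rw [hν, one_mul] at this
      linarith
    have h3 : 0 < u (x, t) := (hu.reg x t (by linarith) (by linarith) (by linarith) fun h4 => by
      have := hu.slit _ h4
      simp only at this
      linarith).2.2.1
    have h4 : inner ℝ ν x ^ K ≤ 1 := pow_le_one₀ (by linarith) h2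
    exact (mul_le_of_le_one_left h3.le h4).trans h1
  have hstep : ∀ j : ℕ, ∀ x t, 0 < inner ℝ ν x → inner ℝ ν x ≤ 1 / 16 →
      1 / 32 ≤ 2 ^ j * inner ℝ ν x → ‖x‖ - inner ℝ ν x ≤ 3 / 4 → -(1 / 2) ≤ t →
      t - inner ℝ ν x ^ 2 / 3 ≤ 7 / 20 →
      inner ℝ ν x ^ K * u (x, t) ≤ C0 * u ((1 / 2 : ℝ) • ν, 1 / 2) := by
    intro j
    induction j with
    | zero =>
      intro x t h0 h1 h2 h3 h4 h5
      rw [pow_zero, one_mul] at h2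
      exact hB x t (by linarith) h4 (by nlinarith) h2
    | succ j ih =>
      intro x t h0 h1 h2 h3 h4 h5
      rcases le_or_gt (1 / 32) (inner ℝ ν x) with h6 | h6
      · exact hB x t (by linarith) h4 (by nlinarith) h6
      obtain ⟨h, hh⟩ : ∃ h, h = inner ℝ ν x := ⟨_, rfl⟩
      rw [← hh] at h0 h1 h2 h3 h5 h6 ⊢
      have hin : inner ℝ ν (x + h • ν) = 2 * h := by
        rw [inner_add_right, inner_smul_right, real_inner_self_eq_norm_sq, hν, ← hh]; ring
      have hnm : ‖x + h • ν‖ ≤ ‖x‖ + h := by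
        refine (norm_add_le _ _).trans ?_
        rw [norm_smul, hν, mul_one, Real.norm_of_nonneg h0.le]
      have h7 := ih (x + h • ν) (t + h ^ 2) (by rw [hin]; linarith) (by rw [hin]; linarith)
        (by rw [hin]; rw [pow_succ] at h2; linarith) (by rw [hin]; linarith)
        (by nlinarith) (by rw [hin]; linarith)
      rw [hin] at h7
      have h8 := hH u x (x + h • ν) t (t + h ^ 2) (h / 2) (by positivity) (by linarith)
        (by linarith [sq_nonneg h]) (by
          rw [add_sub_cancel_left, norm_smul, hν, mul_one, Real.norm_of_nonneg h0.le]; linarith)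
        (fun θ hθ => hu.posSol fun z τ hz => by
          obtain ⟨hz1, hz2, hz3⟩ := hz
          simp only at hz1 hz2 hz3
          rw [Metric.mem_closedBall, dist_eq_norm, add_sub_cancel_left] at hz1
          have h9 : inner ℝ ν (x + θ • h • ν) = h + θ * h := by
            rw [inner_add_right, inner_smul_right, inner_smul_right, real_inner_self_eq_norm_sq, hν,
              ← hh]
            ring
          have h10 : ‖x + θ • h • ν‖ ≤ ‖x‖ + h := by
            refine (norm_add_le _ _).trans ?_
            rw [norm_smul, norm_smul, hν, mul_one, Real.norm_of_nonneg h0.le,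
              Real.norm_of_nonneg hθ.1]
            nlinarith [hθ.2]
          have h11 := norm_le_norm_add_norm_sub (x + θ • h • ν) z
          rw [norm_sub_rev] at h11
          have h12 := inner_sub_le_norm hν (x + θ • h • ν) z
          rw [norm_sub_rev, h9] at h12
          have h13 : 0 ≤ θ * h := mul_nonneg hθ.1 h0.le
          have h14 : h ^ 2 ≤ 1 / 32 * h := by nlinarith
          refine ⟨by linarith, by nlinarith, by linarith, by linarith⟩)
      have hu2 : 0 ≤ u (x + h • ν, t + h ^ 2) := by
        refine (hu.reg _ _ (by linarith) (by nlinarith) (by nlinarith) fun h9 => ?_).2.2.1.le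
        have := hu.slit _ h9
        simp only at this
        rw [hin] at this
        linarith
      calc h ^ K * u (x, t) ≤ h ^ K * (C1 * u (x + h • ν, t + h ^ 2)) := by gcongr
        _ ≤ h ^ K * (2 ^ K * u (x + h • ν, t + h ^ 2)) := by gcongr
        _ = (2 * h) ^ K * u (x + h • ν, t + h ^ 2) := by rw [mul_pow]; ring
        _ ≤ _ := h7
  have hpos : ∀ x t, ‖x‖ ≤ 3 / 4 → -(1 / 2) ≤ t → t ≤ 7 / 20 → 0 < inner ℝ ν x →
      inner ℝ ν x ^ K * u (x, t) ≤ C0 * u ((1 / 2 : ℝ) • ν, 1 / 2) := by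
    intro x t hx h1 h2 h3
    rcases le_or_gt (1 / 32) (inner ℝ ν x) with h6 | h6
    · exact hB x t (by linarith) h1 (by linarith) h6
    · obtain ⟨j, hj⟩ := pow_unbounded_of_one_lt (1 / 32 / inner ℝ ν x) (one_lt_two : (1 : ℝ) < 2)
      rw [div_lt_iff₀ h3] at hj
      exact hstep j x t h3 (by linarith) hj.le (by linarith) h1
        (by have := sq_nonneg (inner ℝ ν x); linarith)
  intro x t hx h1 h2 h3
  rcases lt_or_gt_of_ne h3 with h4 | h4
  · have h5 := hpos (mirror ν x) t (by rwa [norm_mirror hν]) h1 h2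
      (by rw [inner_mirror hν]; linarith)
    have h6 := (hu.reg x t (by linarith) (by linarith) (by linarith)
      fun h => h3 (hu.slit _ h)).2.2.2
    rw [inner_mirror hν, h6] at h5
    rwa [abs_of_neg h4]
  · rw [abs_of_pos h4]
    exact hpos x t hx h1 h2 h4

end KrylovSafonov

namespace KrylovSafonov

open Set Filter Topology

variable {E : Type*} [NormedAddCommGroup E] [InnerProductSpace ℝ E] [FiniteDimensional ℝ E]

/-- Carleson estimate: a solution vanishing continuously on the slit is bounded by its value at an
interior point at a later time. -/
theorem SlitSol.carleson {l L : ℝ} (hl : 0 < l) (hlL : l ≤ L) :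
    ∃ M : ℝ, 0 < M ∧ ∀ (ν : E) (S : Set (E × ℝ)) (u : E × ℝ → ℝ), SlitSol l L ν S u →
      ContinuousOn (fun p => if p ∈ S then 0 else u p) {p | ‖p.1‖ < 1 ∧ -1 < p.2 ∧ p.2 < 1} →
      ∀ x t, ‖x‖ ≤ 5 / 8 → -(3 / 10) ≤ t → t ≤ 7 / 20 → (x, t) ∉ S →
        u (x, t) ≤ M * u ((1 / 2 : ℝ) • ν, 1 / 2) := by
  obtain ⟨C, K, hC, hpoly⟩ := SlitSol.polynomial_bound (E := E) hl hlL
  obtain ⟨Γ, hΓ, hstrip⟩ := strip_bound (E := E) (l := l) (L := L) hl (hl.le.trans hlL)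
  obtain ⟨κ, hκ, hκΓ⟩ : ∃ κ : ℝ, 0 < κ ∧ 2 ^ (K + 1) * (4 * Γ * κ ^ 2) ≤ 1 / 4 := by
    have h3 : 0 < min 1 (1 / (16 * Γ * 2 ^ (K + 1))) := lt_min (by norm_num) (by positivity)
    refine ⟨_, h3, ?_⟩
    have h1 := min_le_left 1 (1 / (16 * Γ * 2 ^ (K + 1)))
    have h2 := min_le_right 1 (1 / (16 * Γ * 2 ^ (K + 1)))
    rw [le_div_iff₀ (by positivity)] at h2
    obtain ⟨z, hz⟩ : ∃ z, z = min 1 (1 / (16 * Γ * 2 ^ (K + 1))) := ⟨_, rfl⟩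
    rw [← hz] at h1 h2 h3 ⊢
    have h4 : 0 ≤ z * (16 * Γ * 2 ^ (K + 1)) := by positivity
    have h5 : z * (z * (16 * Γ * 2 ^ (K + 1))) ≤ 1 := by nlinarith
    linarith
  refine ⟨2 * C / κ ^ K * 8 ^ (K + 1), by positivity, ?_⟩
  intro ν S u hu hcont
  have hν := hu.unit
  obtain ⟨U, hU⟩ : ∃ U, U = u ((1 / 2 : ℝ) • ν, 1 / 2) := ⟨_, rfl⟩
  have hU0 : 0 < U := by
    rw [hU]
    refine (hu.reg _ _ (by rw [norm_smul, hν]; norm_num) (by norm_num) (by norm_num)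
      fun h => ?_).2.2.1
    have := hu.slit _ h
    rw [inner_smul_right, real_inner_self_eq_norm_sq, hν] at this
    norm_num at this
  obtain ⟨f, hf⟩ : ∃ f : E × ℝ → ℝ, f = fun p => if p ∈ S then 0 else u p := ⟨_, rfl⟩
  rw [← hf] at hcont
  have hfS : ∀ p ∈ S, f p = 0 := fun p hp => by rw [hf]; simp [hp]
  have hfu : ∀ p, p ∉ S → f p = u p := fun p hp => by rw [hf]; simp [hp]
  obtain ⟨d, hd⟩ : ∃ d : E × ℝ → ℝ, d = fun p => min (3 / 4 - ‖p.1‖) (p.2 + 1 / 2) := ⟨_, rfl⟩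
  have hdc : Continuous d := by rw [hd]; fun_prop
  have hZ : Metric.closedBall (0 : E) (3 / 4) ×ˢ Icc (-(1 / 2) : ℝ) (7 / 20) ⊆
      {p | ‖p.1‖ < 1 ∧ -1 < p.2 ∧ p.2 < 1} := by
    rintro p ⟨h1, h2, h3⟩
    rw [mem_closedBall_zero_iff] at h1
    exact ⟨by linarith, by linarith, by linarith⟩
  obtain ⟨⟨x1, t1⟩, hP, hmax⟩ :=
    ((isCompact_closedBall (0 : E) (3 / 4)).prod
      (isCompact_Icc (a := (-(1 / 2) : ℝ)) (b := 7 / 20))).exists_isMaxOn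
    (f := fun p => f p * d p ^ (K + 1)) ⟨(0, 0), by simp; norm_num, by norm_num, by norm_num⟩
    ((hcont.mono hZ).mul (hdc.pow _).continuousOn)
  have hbound : f (x1, t1) * d (x1, t1) ^ (K + 1) ≤ 2 * C / κ ^ K * U := by
    by_contra hcon
    push Not at hcon
    obtain ⟨⟨hx1, ht1, ht1'⟩, hP'⟩ := And.intro hP hP
    rw [mem_closedBall_zero_iff] at hx1
    simp only at hx1 ht1 ht1'
    obtain ⟨δ, hδ⟩ : ∃ δ, δ = d (x1, t1) := ⟨_, rfl⟩
    have hδ1 : δ ≤ 3 / 4 - ‖x1‖ := by rw [hδ, hd]; exact min_le_left _ _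
    have hδ2 : δ ≤ t1 + 1 / 2 := by rw [hδ, hd]; exact min_le_right _ _
    have hδ0 : 0 ≤ δ := by
      rw [hδ, hd]
      exact le_min (by simp only; linarith) (by simp only; linarith)
    rw [← hδ] at hcon
    have hMU : 0 < 2 * C / κ ^ K * U := by positivity
    have hδp : 0 < δ := by
      refine lt_of_le_of_ne hδ0 fun h => ?_
      rw [← h, zero_pow (by omega), mul_zero] at hcon
      linarith
    have hfP : 0 < f (x1, t1) := pos_of_mul_pos_left (hMU.trans hcon) (by positivity)
    have hPS : (x1, t1) ∉ S := fun h => by rw [hfS _ h] at hfP; exact lt_irrefl _ hfP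
    have hδ34 : δ ≤ 3 / 4 := by linarith [norm_nonneg x1]
    have hball : ∀ y s, ‖y - x1‖ ≤ δ / 2 → t1 - (δ / 2) ^ 2 ≤ s → s ≤ t1 →
        ‖y‖ ≤ 3 / 4 ∧ -(1 / 2) ≤ s ∧ s ≤ 7 / 20 ∧ δ / 2 ≤ d (y, s) := by
      intro y s h1 h2 h3
      have h4 : ‖y‖ ≤ ‖x1‖ + ‖y - x1‖ := norm_le_norm_add_norm_sub' y x1
      have h5 : (δ / 2) ^ 2 ≤ δ / 2 := by nlinarith
      refine ⟨by linarith, by linarith, by linarith, ?_⟩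
      rw [hd]
      exact le_min (by simp only; linarith) (by simp only; linarith)
    have hbig : ∀ y s, ‖y‖ ≤ 3 / 4 → -(1 / 2) ≤ s → s ≤ 7 / 20 → κ * δ ≤ |inner ℝ ν y| →
        f (y, s) ≤ f (x1, t1) / 2 := by
      intro y s h1 h2 h3 h4
      have hκδ : 0 < κ * δ := by positivity
      have h5 : inner ℝ ν y ≠ 0 := fun h => by rw [h, abs_zero] at h4; linarith
      have h6 : (y, s) ∉ S := fun h => h5 (hu.slit _ h)
      have h7 := hpoly ν S u hu y s h1 h2 h3 h5
      have h8 : 0 < u (y, s) :=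
        (hu.reg y s (by linarith) (by linarith) (by linarith) h6).2.2.1
      rw [hfu _ h6]
      have h9 : (κ * δ) ^ K * u (y, s) ≤ C * U := by
        refine le_trans ?_ (hU ▸ h7)
        gcongr
      have h10 : 2 * C * U ≤ κ ^ K * δ ^ K * f (x1, t1) := by
        have h11 : δ ^ (K + 1) ≤ δ ^ K := by
          rw [pow_succ]; exact mul_le_of_le_one_right (by positivity) (by linarith)
        have h12 : 2 * C / κ ^ K * U * κ ^ K = 2 * C * U := by field_simp
        have h13 : f (x1, t1) * δ ^ (K + 1) ≤ f (x1, t1) * δ ^ K := by gcongr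
        have h14 := mul_le_mul_of_nonneg_right (hcon.le.trans h13)
          (by positivity : (0 : ℝ) ≤ κ ^ K)
        linarith
      rw [mul_pow] at h9
      have h15 : κ ^ K * δ ^ K * u (y, s) ≤ κ ^ K * δ ^ K * (f (x1, t1) / 2) := by linarith
      exact le_of_mul_le_mul_left h15 (by positivity)
    have hcyl : ∀ p ∈ Metric.closedBall x1 (δ / 2) ×ˢ Icc (t1 - (δ / 2) ^ 2) t1,
        ‖p.1‖ ≤ 3 / 4 ∧ -(1 / 2) ≤ p.2 ∧ p.2 ≤ 7 / 20 ∧ δ / 2 ≤ d p := by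
      rintro ⟨y, s⟩ ⟨h1, h2, h3⟩
      rw [Metric.mem_closedBall, dist_eq_norm] at h1
      exact hball y s h1 h2 h3
    have h1 := hstrip f x1 ν (δ / 2) t1 (κ * δ) (f (x1, t1) / 2) (2 ^ (K + 1) * f (x1, t1)) hν
      (by positivity) (by positivity)
      (hcont.mono fun p hp => hZ ⟨by
        rw [mem_closedBall_zero_iff]; exact (hcyl p hp).1, (hcyl p hp).2.1, (hcyl p hp).2.2.1⟩)
      (by
        intro p hp hpf _
        have hpS : p ∉ S := fun h => by rw [hfS p h] at hpf; linarith
        obtain ⟨h2, h3, h4, -⟩ := hcyl p hp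
        refine (hu.reg p.1 p.2 (by linarith) (by linarith) (by linarith) hpS).2.1.congr ?_
        filter_upwards [hu.closed.isOpen_compl.mem_nhds hpS] with p' hp'
        exact hfu p' hp')
      (by
        intro p hp hph
        obtain ⟨h2, h3, h4, -⟩ := hcyl p hp
        exact hbig p.1 p.2 h2 h3 h4 hph)
      (by
        intro p hp
        obtain ⟨h2, h3, h4, h5⟩ := hcyl p hp
        have hfp : 0 ≤ f p := by
          by_cases hpS : p ∈ S
          · rw [hfS p hpS]
          · rw [hfu p hpS]
            exact (hu.reg p.1 p.2 (by linarith) (by linarith) (by linarith) hpS).2.2.1.le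
        have h6 : f p * d p ^ (K + 1) ≤ f (x1, t1) * δ ^ (K + 1) := by
          rw [hδ]
          exact hmax ⟨by rw [mem_closedBall_zero_iff]; exact h2, h3, h4⟩
        have h7 : f p * (δ / 2) ^ (K + 1) ≤ f (x1, t1) * δ ^ (K + 1) := by
          refine le_trans ?_ h6
          gcongr
        rw [div_pow, ← mul_div_assoc, div_le_iff₀ (by positivity)] at h7
        have h8 : f p * δ ^ (K + 1) ≤ 2 ^ (K + 1) * f (x1, t1) * δ ^ (K + 1) := by linarith
        have h9 := le_of_mul_le_mul_right h8 (by positivity)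
        linarith)
    have h2 : Γ * (κ * δ) ^ 2 / (δ / 2) ^ 2 = 4 * Γ * κ ^ 2 := by field_simp; norm_num
    rw [h2] at h1
    have h3 := mul_le_mul_of_nonneg_right hκΓ hfP.le
    linarith
  intro x t hx ht1 ht2 hxS
  rw [← hU]
  have h1 : f (x, t) * d (x, t) ^ (K + 1) ≤ f (x1, t1) * d (x1, t1) ^ (K + 1) :=
    hmax ⟨by rw [mem_closedBall_zero_iff]; simp only; linarith, by simp only; linarith, ht2⟩
  have h2 : 1 / 8 ≤ d (x, t) := by
    rw [hd]
    exact le_min (by simp only; linarith) (by simp only; linarith)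
  have h3 : 0 < u (x, t) :=
    (hu.reg x t (by linarith) (by linarith) (by linarith) hxS).2.2.1
  rw [hfu _ hxS] at h1
  have h4 : u (x, t) * (1 / 8) ^ (K + 1) ≤ 2 * C / κ ^ K * U := by
    refine le_trans ?_ (h1.trans hbound)
    gcongr
  rw [div_pow, one_pow, mul_one_div, div_le_iff₀ (by positivity)] at h4
  linarith

/-- The boundary Harnack principle for even solutions in slit domains. -/
theorem SlitSol.boundary_harnack {l L : ℝ} (hl : 0 < l) (hlL : l ≤ L) :
    ∃ C : ℝ, 0 < C ∧ ∀ (ν : E) (S : Set (E × ℝ)) (u v : E × ℝ → ℝ), SlitSol l L ν S u →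
      SlitSol l L ν S v →
      ContinuousOn (fun p => if p ∈ S then 0 else u p) {p | ‖p.1‖ < 1 ∧ -1 < p.2 ∧ p.2 < 1} →
      (∀ a b x t, ‖x‖ < 1 → -1 < t → t < 1 → (x, t) ∉ S →
        SolAt l L (fun q => a * u q + b * v q + 0) (x, t)) →
      ∀ x t, ‖x‖ < 1 / 2 → -(1 / 4) < t → t < 1 / 4 → (x, t) ∉ S →
        u (x, t) / v (x, t) ≤
          C * (u ((1 / 2 : ℝ) • ν, 1 / 2) / v ((1 / 2 : ℝ) • ν, -(1 / 2))) := by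
  obtain ⟨M, hM, hcarl⟩ := SlitSol.carleson (E := E) hl hlL
  obtain ⟨δ, A, hδ, hδ5, hA, hiter⟩ := slit_iteration (E := E) hl hlL
  obtain ⟨C, hC, hharn⟩ := SlitSol.harnack_upper (E := E) hl hlL (ρ := δ * (1 / 8))
    (by positivity) (by linarith)
  have hC0 : 0 < C := by linarith
  refine ⟨M * (A + 1) * C, by positivity, ?_⟩
  intro ν S u v hu hv hcont hcomb x t hx ht1 ht2 hxS
  have hν := hu.unit
  have hhalf : ‖(1 / 2 : ℝ) • ν‖ = 1 / 2 := by rw [norm_smul, hν]; norm_num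
  have hihalf : inner ℝ ν ((1 / 2 : ℝ) • ν) = 1 / 2 := by
    rw [inner_smul_right, real_inner_self_eq_norm_sq, hν]; norm_num
  have hoff : ∀ s : ℝ, ((1 / 2 : ℝ) • ν, s) ∉ S := fun s h => by
    have := hu.slit _ h
    simp only [hihalf] at this
    norm_num at this
  obtain ⟨U, hU⟩ : ∃ U, U = u ((1 / 2 : ℝ) • ν, 1 / 2) := ⟨_, rfl⟩
  obtain ⟨V, hV⟩ : ∃ V, V = v ((1 / 2 : ℝ) • ν, -(1 / 2)) := ⟨_, rfl⟩
  have hU0 : 0 < U := by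
    rw [hU]
    exact (hu.reg _ _ (by rw [hhalf]; norm_num) (by norm_num) (by norm_num) (hoff _)).2.2.1
  have hV0 : 0 < V := by
    rw [hV]
    exact (hv.reg _ _ (by rw [hhalf]; norm_num) (by norm_num) (by norm_num) (hoff _)).2.2.1
  rw [← hU, ← hV]
  have huU : ∀ y s, ‖y‖ ≤ 5 / 8 → -(3 / 10) ≤ s → s ≤ 7 / 20 → (y, s) ∉ S → u (y, s) ≤ M * U := by
    rw [hU]; exact hcarl ν S u hu hcont
  have hvV : ∀ y s, ‖y‖ ≤ 5 / 8 → -(3 / 10) ≤ s → s ≤ 7 / 20 → δ * (1 / 8) ≤ |inner ℝ ν y| →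
      V ≤ C * v (y, s) := by
    have hpos : ∀ y s, ‖y‖ ≤ 5 / 8 → -(3 / 10) ≤ s → s ≤ 7 / 20 → δ * (1 / 8) ≤ inner ℝ ν y →
        V ≤ C * v (y, s) := by
      intro y s h1 h2 h3 h4
      rw [hV]
      exact hharn ν S v hv _ y _ s (by rw [hhalf]; norm_num) (by linarith)
        (by rw [hihalf]; linarith) h4 (by norm_num) (by linarith) (by linarith)
    intro y s h1 h2 h3 h4
    rcases le_total 0 (inner ℝ ν y) with h5 | h5
    · exact hpos y s h1 h2 h3 (by rwa [abs_of_nonneg h5] at h4)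
    · rw [abs_of_nonpos h5] at h4
      have h6 := hpos (mirror ν y) s (by rwa [norm_mirror hν]) h2 h3 (by rwa [inner_mirror hν])
      have h7 : (y, s) ∉ S := fun h => by
        have h8 := hv.slit _ h
        simp only at h8
        rw [h8] at h4
        linarith
      rwa [(hv.reg y s (by linarith) (by linarith) (by linarith) h7).2.2.2] at h6
  have hvx : 0 < v (x, t) := (hv.reg x t (by linarith) (by linarith) (by linarith) hxS).2.2.1
  suffices hmain : u (x, t) * V ≤ M * (A + 1) * C * U * v (x, t) by
    rw [div_le_iff₀ hvx]
    have h1 : M * (A + 1) * C * (U / V) * v (x, t) = M * (A + 1) * C * U * v (x, t) / V := by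
      field_simp
    rw [h1, le_div_iff₀ hV0]
    exact hmain
  rcases le_or_gt |inner ℝ ν x| (1 / 8) with hnear | hfar
  · obtain ⟨x0, hx0⟩ : ∃ x0, x0 = x - (inner ℝ ν x : ℝ) • ν := ⟨_, rfl⟩
    have hx0ν : inner ℝ ν x0 = 0 := by
      rw [hx0, inner_sub_right, inner_smul_right, real_inner_self_eq_norm_sq, hν]; ring
    have hx0x : x0 + (inner ℝ ν x : ℝ) • ν = x := by rw [hx0, sub_add_cancel]
    have hx0n : ‖x0‖ ≤ ‖x‖ := by
      refine (abs_le_of_sq_le_sq' (a := ‖x0‖) ?_ (norm_nonneg _)).2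
      have h1 : ‖x‖ ^ 2 = ‖x0‖ ^ 2 + (inner ℝ ν x) ^ 2 := by
        conv_lhs => rw [← hx0x]
        rw [norm_add_sq_real, inner_smul_right, real_inner_comm ν x0, hx0ν, norm_smul, hν,
          Real.norm_eq_abs, mul_one, sq_abs]
        ring
      linarith [sq_nonneg (inner ℝ ν x)]
    have hQ : ∀ p ∈ Metric.closedBall x0 (1 / 8) ×ˢ Icc (t - (1 / 8 : ℝ) ^ 2) t,
        ‖p.1‖ ≤ 5 / 8 ∧ -(3 / 10) ≤ p.2 ∧ p.2 ≤ 7 / 20 := by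
      rintro ⟨y, s⟩ ⟨h1, h2, h3⟩
      rw [Metric.mem_closedBall, dist_eq_norm] at h1
      simp only at h1 h2 h3 ⊢
      have h4 : ‖y‖ ≤ ‖x0‖ + ‖y - x0‖ := norm_le_norm_add_norm_sub' y x0
      refine ⟨by linarith, ?_, by linarith⟩
      norm_num at h2
      linarith
    obtain ⟨a, ha⟩ : ∃ a, a = -(1 / (M * U)) := ⟨_, rfl⟩
    obtain ⟨b, hb⟩ : ∃ b, b = (A + 1) * C / V := ⟨_, rfl⟩
    have haM : -a * (M * U) = 1 := by rw [ha]; field_simp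
    have hbV : b * V = (A + 1) * C := by rw [hb]; field_simp
    have hb0 : 0 < b := by rw [hb]; positivity
    have ha0 : 0 < -a := by rw [ha, neg_neg]; positivity
    have hau : ∀ p ∈ Metric.closedBall x0 (1 / 8) ×ˢ Icc (t - (1 / 8 : ℝ) ^ 2) t, p ∉ S →
        -a * u p ≤ 1 ∧ 0 < b * v p := by
      intro p hp hpS
      obtain ⟨h1, h2, h3⟩ := hQ p hp
      have h4 := mul_le_mul_of_nonneg_left (huU p.1 p.2 h1 h2 h3 hpS) ha0.le
      rw [haM] at h4
      exact ⟨h4, mul_pos hb0 (hv.reg p.1 p.2 (by linarith) (by linarith) (by linarith) hpS).2.2.1⟩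
    have hwc : ∀ p ∈ Metric.closedBall x0 (1 / 8) ×ˢ Icc (t - (1 / 8 : ℝ) ^ 2) t, p ∉ S →
        ContinuousAt (fun q => a * u q + b * v q + 0) p := by
      intro p hp hpS
      obtain ⟨h1, h2, h3⟩ := hQ p hp
      exact (((hu.reg p.1 p.2 (by linarith) (by linarith) (by linarith) hpS).1.const_mul a).add
        ((hv.reg p.1 p.2 (by linarith) (by linarith) (by linarith) hpS).1.const_mul b)).add_const 0
    have h1 := hiter ν x0 t (1 / 8) S (fun q => a * u q + b * v q + 0) hν hx0ν (by norm_num)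
      hu.closed hu.slit
      (by
        intro p hp hpS
        obtain ⟨h1, h2, h3⟩ := hQ p hp
        obtain ⟨h4, h5⟩ := hau p hp hpS
        refine ⟨hwc p hp hpS, hcomb a b p.1 p.2 (by linarith) (by linarith) (by linarith) hpS, ?_,
          by linarith⟩
        have h6 := (hu.reg p.1 p.2 (by linarith) (by linarith) (by linarith) hpS).2.2.2
        have h7 := (hv.reg p.1 p.2 (by linarith) (by linarith) (by linarith) hpS).2.2.2
        simp only [h6, h7])
      (by
        intro p hp
        by_cases hpS : p ∈ S
        · have hsub : Metric.closedBall x0 (1 / 8) ×ˢ Icc (t - (1 / 8 : ℝ) ^ 2) t ⊆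
              {p | ‖p.1‖ < 1 ∧ -1 < p.2 ∧ p.2 < 1} := fun q hq => by
            obtain ⟨h1, h2, h3⟩ := hQ q hq
            exact ⟨by linarith, by linarith, by linarith⟩
          have h1 : Tendsto (fun q => -a * if q ∈ S then 0 else u q)
              (𝓝[Metric.closedBall x0 (1 / 8) ×ˢ Icc (t - (1 / 8 : ℝ) ^ 2) t] p) (𝓝 0) := by
            have := ((hcont p (hsub hp)).mono hsub).tendsto.const_mul (-a)
            simpa [hpS] using this
          have h2 : Tendsto (fun q => if q ∈ S then 0 else max (-(a * u q + b * v q + 0)) 0)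
              (𝓝[Metric.closedBall x0 (1 / 8) ×ˢ Icc (t - (1 / 8 : ℝ) ^ 2) t] p) (𝓝 0) := by
            refine squeeze_zero' (Eventually.of_forall fun q => ?_) ?_ h1
            · split_ifs
              · exact le_rfl
              · exact le_max_right _ _
            · filter_upwards [self_mem_nhdsWithin] with q hq
              split_ifs with hqS
              · simp
              · obtain ⟨h4, h5⟩ := hau q hq hqS
                obtain ⟨h6, h7, h8⟩ := hQ q hq
                have h9 := (hu.reg q.1 q.2 (by linarith) (by linarith) (by linarith) hqS).2.2.1
                exact max_le (by linarith) (mul_pos ha0 h9).le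
          unfold ContinuousWithinAt
          simpa only [hpS, if_true] using h2
        · refine ContinuousAt.continuousWithinAt ?_
          refine ContinuousAt.congr (f := fun q => max (-(a * u q + b * v q + 0)) 0)
            ((hwc p hp hpS).neg.max continuousAt_const) ?_
          filter_upwards [hu.closed.isOpen_compl.mem_nhds hpS] with q hq
          have hq' : q ∉ S := hq
          simp only [hq', if_false])
      (by
        intro p hp hpδ
        obtain ⟨h1, h2, h3⟩ := hQ p hp
        have hpS : p ∉ S := fun h => by
          rw [hu.slit p h, abs_zero] at hpδ
          linarith
        obtain ⟨h4, h5⟩ := hau p hp hpS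
        have h6 := mul_le_mul_of_nonneg_left (hvV p.1 p.2 h1 h2 h3 hpδ) hb0.le
        rw [hbV] at h6
        have h7 : A + 1 ≤ b * v p := by
          have h8 : (A + 1) * C ≤ b * v p * C := by linarith
          exact le_of_mul_le_mul_right h8 hC0
        linarith) (inner ℝ ν x) hnear (by rwa [hx0x])
    rw [hx0x] at h1
    have h2 : -a * u (x, t) ≤ b * v (x, t) := by linarith
    have h3 := mul_le_mul_of_nonneg_left h2 (by positivity : 0 ≤ M * U * V)
    have e1 : M * U * V * (-a * u (x, t)) = u (x, t) * V := by
      linear_combination V * u (x, t) * haM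
    have e2 : M * U * V * (b * v (x, t)) = M * (A + 1) * C * U * v (x, t) := by
      linear_combination M * U * v (x, t) * hbV
    rwa [e1, e2] at h3
  · have h1 := huU x t (by linarith) (by linarith) (by linarith) hxS
    have h2 := hvV x t (by linarith) (by linarith) (by linarith) (by linarith)
    have h3 : u (x, t) * V ≤ M * U * (C * v (x, t)) := by gcongr
    have h4 : 0 < M * U * (C * v (x, t)) * A := by positivity
    linarith

theorem reflectLast_eq_mirror {m : ℕ} (x : Spc m) :
    reflectLast x = mirror (eVec m (Fin.last m)) x := by
  ext i
  by_cases h : i = Fin.last m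
  · subst h
    simp [reflectLast, mirror, eVec, EuclideanSpace.inner_single_left]
    ring
  · simp [reflectLast, mirror, eVec, h]

theorem SolvesL.slitSol {m : ℕ} {A : Spc m → Matrix (Fin (m + 1)) (Fin (m + 1)) ℝ} {l L : ℝ}
    (hl : 0 < l) (hlL : l ≤ L) (hA : IsElliptic l L A) {S : Set (Spc m × ℝ)} (hS : IsClosed S)
    (hS0 : S ⊆ {p | xlast p.1 = 0}) {u : Spc m × ℝ → ℝ} (hu : SolvesL A u (CylS m 1 \ S))
    (hpos : ∀ p ∈ CylS m 1 \ S, 0 < u p)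
    (heven : ∀ p ∈ CylS m 1 \ S, u (reflectLast p.1, p.2) = u p) :
    SlitSol l L (eVec m (Fin.last m)) S u := by
  refine ⟨by simp [eVec], hS, fun p hp => ?_, fun x t hx h1 h2 hxS => ?_⟩
  · have : xlast p.1 = 0 := hS0 hp
    simpa [eVec, EuclideanSpace.inner_single_left, xlast] using this
  · have hmem : (x, t) ∈ CylS m 1 \ S := ⟨⟨hx, by simpa using h1, by simpa using h2⟩, hxS⟩
    have hopen : IsOpen (CylS m 1 \ S) := by
      refine IsOpen.sdiff ?_ hS
      exact (isOpen_lt (continuous_norm.comp continuous_fst) continuous_const).inter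
        ((isOpen_lt continuous_const continuous_snd).inter
          (isOpen_lt continuous_snd continuous_const))
    refine ⟨continuousOn_of_solAt hl hlL hopen (fun p hp => (hpos p hp).le)
      (fun p hp => SolvesL.solAt hA hu hp) _ hmem, SolvesL.solAt hA hu hmem, hpos _ hmem, ?_⟩
    rw [← reflectLast_eq_mirror]
    exact heven _ hmem

end KrylovSafonov

/-- **Thin parabolic boundary Harnack principle in slit domains** (Theorem 1.4). -/
theorem thin_boundary_harnack (m : ℕ) (hm : 1 ≤ m) (lam Lam : ℝ)
    (hlam : 0 < lam) (hlamLam : lam ≤ Lam) :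
    ∃ C : ℝ, 0 < C ∧
      ∀ (A : Spc m → Matrix (Fin (m + 1)) (Fin (m + 1)) ℝ), IsElliptic lam Lam A →
      ∀ S : Set (Spc m × ℝ), IsClosed S → S ⊆ {p | xlast p.1 = 0} →
      ∀ u v : Spc m × ℝ → ℝ,
        SolvesL A u (CylS m 1 \ S) → SolvesL A v (CylS m 1 \ S) →
        (∀ p ∈ CylS m 1 \ S, 0 < u p) → (∀ p ∈ CylS m 1 \ S, 0 < v p) →
        (∀ p ∈ CylS m 1 \ S, u (reflectLast p.1, p.2) = u p) →
        (∀ p ∈ CylS m 1 \ S, v (reflectLast p.1, p.2) = v p) →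
        ContinuousOn (fun p => if p ∈ S then 0 else u p) (CylS m 1) →
        ∀ p ∈ CylS m (1 / 2) \ S, u p / v p ≤ C * (u (EbarS m) / v (EundS m)) := by
  obtain ⟨C, hC, h⟩ := KrylovSafonov.SlitSol.boundary_harnack (E := Spc m) hlam hlamLam
  refine ⟨C, hC, ?_⟩
  rintro A hA S hS hS0 u v hu hv hu0 hv0 hue hve hcont ⟨x, t⟩ ⟨⟨hx, ht1, ht2⟩, hxS⟩
  have hCyl : CylS m 1 = {p | ‖p.1‖ < 1 ∧ -1 < p.2 ∧ p.2 < 1} := by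
    unfold CylS; norm_num
  have hE : ((1 / 2 : ℝ) • eVec m (Fin.last m)) = EuclideanSpace.single (Fin.last m) (1 / 2) := by
    ext i
    simp [eVec]
  have h1 := h (eVec m (Fin.last m)) S u v
    (KrylovSafonov.SolvesL.slitSol hlam hlamLam hA hS hS0 hu hu0 hue)
    (KrylovSafonov.SolvesL.slitSol hlam hlamLam hA hS hS0 hv hv0 hve) (hCyl ▸ hcont)
    (fun a b y s hy h1 h2 hyS => KrylovSafonov.SolvesL.solAt hA
      (KrylovSafonov.SolvesL.linear_combination hu hv a b 0)
      ⟨by rw [hCyl]; exact ⟨hy, h1, h2⟩, hyS⟩) x t hx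
    (by norm_num at ht1; linarith) (by norm_num at ht2; linarith) hxS
  rw [hE] at h1
  exact h1
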